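/- Let X be a compact Ptolemy space with properties (E) and (I). Then X is homeomorphic to the unit sphere Sⁿ ⊆ ℝ^{n+1} for some integer n ≥ 1, and there exist integers k ≥ 1 and p ≥ 0 with k + p = n such that for every ω ∈ X the base B_ω of the canonical fibration is isometric to the Euclidean space ℝᵏ and every fiber of π_ω is homeomorphic to ℝᵖ. -/

import Mathlib

open scoped ENNReal

namespace Mobius

/-- An extended metric on `X`, allowed to have (at most) one infinitely remote point,
which is recorded in the field `rem`.  Distances take values in `ℝ≥0∞`, and the value `⊤`
occurs exactly on pairs of distinct points one of which is the remote point. -/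
structure ExtMetric (X : Type*) where
  d : X → X → ℝ≥0∞
  rem : Option X
  symm : ∀ x y, d x y = d y x
  d_self : ∀ x, d x x = 0
  pos : ∀ x y, x ≠ y → 0 < d x y
  triangle : ∀ x y z, d x z ≤ d x y + d y z
  d_eq_top_iff : ∀ x y, d x y = ⊤ ↔ (x ≠ y ∧ (rem = some x ∨ rem = some y))

/-- The finite factor of a distance used in cross-ratio triples: infinite factors are
dropped (replaced by `1`), in accordance with the standard conventions for cross-ratio
triples of quadruples containing the infinitely remote point. -/
noncomputable def ExtMetric.fd {X : Type*} (d : ExtMetric X) (x y : X) : ℝ :=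
  if d.d x y = ⊤ then 1 else (d.d x y).toReal

/-- A representative in `ℝ³` of the cross-ratio triple
`crt(x,y,z,u) = (d(x,y)d(z,u) : d(x,z)d(y,u) : d(x,u)d(y,z)) ∈ ℝP²`,
with the standard conventions when the infinitely remote point occurs among the points. -/
noncomputable def crtVec {X : Type*} (d : ExtMetric X) (x y z u : X) : ℝ × ℝ × ℝ :=
  (d.fd x y * d.fd z u, d.fd x z * d.fd y u, d.fd x u * d.fd y z)

/-- A quadruple is admissible if no entry occurs three or four times in it. -/
def Admissible {X : Type*} (x y z u : X) : Prop :=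
  ¬(x = y ∧ y = z) ∧ ¬(x = y ∧ y = u) ∧ ¬(x = z ∧ z = u) ∧ ¬(y = z ∧ z = u)

/-- Two vectors in `ℝ³` represent the same point of the projective plane (they are
positively proportional). -/
def ProjEq (v w : ℝ × ℝ × ℝ) : Prop :=
  ∃ lam : ℝ, 0 < lam ∧ w = lam • v

theorem ProjEq.refl (v : ℝ × ℝ × ℝ) : ProjEq v v :=
  ⟨1, one_pos, (one_smul ℝ v).symm⟩

theorem ProjEq.symm {v w : ℝ × ℝ × ℝ} (h : ProjEq v w) : ProjEq w v := by
  obtain ⟨l, hl, rfl⟩ := h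
  exact ⟨l⁻¹, inv_pos.mpr hl, by rw [smul_smul, inv_mul_cancel₀ hl.ne', one_smul]⟩

theorem ProjEq.trans' {v w u : ℝ × ℝ × ℝ} (h1 : ProjEq v w) (h2 : ProjEq v u) :
    ProjEq w u := by
  obtain ⟨l, hl, rfl⟩ := h1
  obtain ⟨m, hm, rfl⟩ := h2
  refine ⟨m * l⁻¹, by positivity, ?_⟩
  rw [smul_smul, mul_assoc, inv_mul_cancel₀ hl.ne', mul_one]

/-- A Möbius structure on a set `X`: a (maximal) class of pairwise Möbius-equivalent
extended metrics on `X`, i.e. metrics defining the same cross-ratio triples on all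
admissible quadruples. -/
structure MobiusStructure (X : Type*) where
  M : Set (ExtMetric X)
  nonempty : M.Nonempty
  compat : ∀ d ∈ M, ∀ d' ∈ M, ∀ x y z u : X, Admissible x y z u →
    ProjEq (crtVec d x y z u) (crtVec d' x y z u)
  maximal : ∀ d' : ExtMetric X,
    (∀ d ∈ M, ∀ x y z u : X, Admissible x y z u →
      ProjEq (crtVec d x y z u) (crtVec d' x y z u)) → d' ∈ M

/-- The Möbius structure generated by a single extended metric. -/
def MobiusStructure.ofMetric {X : Type*} (d₀ : ExtMetric X) : MobiusStructure X where
  M := {d | ∀ x y z u : X, Admissible x y z u →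
    ProjEq (crtVec d₀ x y z u) (crtVec d x y z u)}
  nonempty := ⟨d₀, fun _ _ _ _ _ => ProjEq.refl _⟩
  compat := fun _ hd _ hd' x y z u ha => (hd x y z u ha).trans' (hd' x y z u ha)
  maximal := fun _ h => h d₀ (fun _ _ _ _ _ => ProjEq.refl _)

/-- A Möbius structure is Ptolemy if the entries of every cross-ratio triple of every
admissible quadruple satisfy the triangle inequality. -/
def IsPtolemyStructure {X : Type*} (S : MobiusStructure X) : Prop :=
  ∀ d ∈ S.M, ∀ x y z u : X, Admissible x y z u →
    (crtVec d x y z u).1 ≤ (crtVec d x y z u).2.1 + (crtVec d x y z u).2.2 ∧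
    (crtVec d x y z u).2.1 ≤ (crtVec d x y z u).1 + (crtVec d x y z u).2.2 ∧
    (crtVec d x y z u).2.2 ≤ (crtVec d x y z u).1 + (crtVec d x y z u).2.1

/-- The topology of a Möbius space: generated by the open balls of the metrics of the
structure (centered at points distinct from the respective remote points) together with
the complements of the closed balls. -/
def mobiusTop {X : Type*} (S : MobiusStructure X) : TopologicalSpace X :=
  TopologicalSpace.generateFrom
    {s | ∃ d ∈ S.M, ∃ x : X, d.rem ≠ some x ∧ ∃ r : ℝ≥0∞, 0 < r ∧ r ≠ ⊤ ∧
      (s = {y | d.d y x < r} ∨ s = {y | r < d.d y x})}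

/-- Connected components of subsets with respect to the Möbius topology. -/
def mobiusCCIn {X : Type*} (S : MobiusStructure X) (F : Set X) (x : X) : Set X :=
  @connectedComponentIn X (mobiusTop S) F x

/-- The pair `(x,z)` separates the pair `(y,u)` in `σ`:  `y` and `u` lie in different
connected components of `σ \ {x,z}`. -/
def SeparatesIn {X : Type*} (S : MobiusStructure X) (σ : Set X) (x z y u : X) : Prop :=
  u ∉ mobiusCCIn S (σ \ {x, z}) y

/-- `σ` is homeomorphic to the circle `S¹` (with respect to the Möbius topology). -/
def HomeoToCircle {X : Type*} (S : MobiusStructure X) (σ : Set X) : Prop :=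
  letI : TopologicalSpace X := mobiusTop S
  Nonempty (σ ≃ₜ Metric.sphere (0 : ℂ) 1)

/-- `X` is homeomorphic to the sphere `Sⁿ ⊆ ℝ^{n+1}` (w.r.t. the Möbius topology). -/
def HomeoToSphere {X : Type*} (S : MobiusStructure X) (n : ℕ) : Prop :=
  letI : TopologicalSpace X := mobiusTop S
  Nonempty (X ≃ₜ Metric.sphere (0 : EuclideanSpace ℝ (Fin (n + 1))) 1)

/-- The subset `A ⊆ X` is homeomorphic to `ℝᵖ` (w.r.t. the Möbius topology). -/
def SubsetHomeoToEuclidean {X : Type*} (S : MobiusStructure X) (A : Set X) (p : ℕ) : Prop :=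
  letI : TopologicalSpace X := mobiusTop S
  Nonempty (A ≃ₜ EuclideanSpace ℝ (Fin p))

/-- The subset `A ⊆ X` is homeomorphic to `ℝ` (w.r.t. the Möbius topology). -/
def SubsetHomeoToReal {X : Type*} (S : MobiusStructure X) (A : Set X) : Prop :=
  letI : TopologicalSpace X := mobiusTop S
  Nonempty (A ≃ₜ ℝ)

/-- A Ptolemy circle: a subset homeomorphic to `S¹` on which the Ptolemy equality holds
for every quadruple of distinct points `(x,y,z,u)` such that `(x,z)` separates `(y,u)`. -/
def IsPtolemyCircle {X : Type*} (S : MobiusStructure X) (σ : Set X) : Prop :=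
  HomeoToCircle S σ ∧
  ∀ d ∈ S.M, ∀ x ∈ σ, ∀ y ∈ σ, ∀ z ∈ σ, ∀ u ∈ σ,
    x ≠ y → x ≠ z → x ≠ u → y ≠ z → y ≠ u → z ≠ u →
    SeparatesIn S σ x z y u →
    d.d x z * d.d y u = d.d x y * d.d z u + d.d x u * d.d y z

/-- A Möbius automorphism of `X`: a bijection preserving all cross-ratio triples. -/
def IsMobiusAuto {X : Type*} (S : MobiusStructure X) (f : X → X) : Prop :=
  Function.Bijective f ∧ ∀ d ∈ S.M, ∀ x y z u : X, Admissible x y z u →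
    ProjEq (crtVec d x y z u) (crtVec d (f x) (f y) (f z) (f u))

/-- A metric sphere between two distinct points `ω`, `ω'`. -/
def IsMetricSphere {X : Type*} (S : MobiusStructure X) (ω ω' : X) (Sp : Set X) : Prop :=
  ∃ d ∈ S.M, d.rem = some ω' ∧ ∃ r : ℝ≥0∞, 0 < r ∧ r ≠ ⊤ ∧ Sp = {x | d.d x ω = r}

/-- A space inversion with respect to `ω`, `ω'` and a metric sphere `Sp` between them. -/
def IsSpaceInversion {X : Type*} (S : MobiusStructure X) (ω ω' : X) (Sp : Set X)
    (φ : X → X) : Prop :=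
  IsMobiusAuto S φ ∧ Function.Involutive φ ∧ (∀ x, φ x ≠ x) ∧ φ ω = ω' ∧
  φ '' Sp = Sp ∧ ∀ σ : Set X, IsPtolemyCircle S σ → ω ∈ σ → ω' ∈ σ → φ '' σ = σ

/-- Property (E): existence of at least one Ptolemy circle. -/
def PropertyE {X : Type*} (S : MobiusStructure X) : Prop :=
  ∃ σ : Set X, IsPtolemyCircle S σ

/-- Property (I): existence and uniqueness of space inversions. -/
def PropertyI {X : Type*} (S : MobiusStructure X) : Prop :=
  ∀ ω ω' : X, ω ≠ ω' → ∀ Sp : Set X, IsMetricSphere S ω ω' Sp →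
    ∃! φ : X → X, IsSpaceInversion S ω ω' Sp φ

/-- The Möbius space is compact. -/
def MobiusCompact {X : Type*} (S : MobiusStructure X) : Prop :=
  letI : TopologicalSpace X := mobiusTop S
  CompactSpace X

/-- Property (H), the homothety property. -/
def PropertyH {X : Type*} (S : MobiusStructure X) : Prop :=
  ∀ ω ω' : X, ω ≠ ω' → ∀ σ : Set X, IsPtolemyCircle S σ → ω ∈ σ → ω' ∈ σ →
    ∀ x x' : X, x ∈ σ \ {ω, ω'} → x' ∈ mobiusCCIn S (σ \ {ω, ω'}) x →
    ∃ γ : X → X, IsMobiusAuto S γ ∧ γ ω = ω ∧ γ ω' = ω' ∧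
      (∀ σ' : Set X, IsPtolemyCircle S σ' → ω ∈ σ' → ω' ∈ σ' →
        γ '' σ' = σ' ∧ ∀ y ∈ σ' \ {ω, ω'}, γ y ∈ mobiusCCIn S (σ' \ {ω, ω'}) y) ∧
      γ x = x'

/-- A Ptolemy line in `X_ω`: a Ptolemy circle through `ω` with `ω` removed. -/
def IsPtolemyLine {X : Type*} (S : MobiusStructure X) (ω : X) (l : Set X) : Prop :=
  ∃ σ : Set X, IsPtolemyCircle S σ ∧ ω ∈ σ ∧ l = σ \ {ω}

/-- `c : ℝ → X` is a unit-speed parameterization of `l ⊆ X` w.r.t. the metric `d`. -/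
def IsUnitSpeed {X : Type*} (d : ExtMetric X) (l : Set X) (c : ℝ → X) : Prop :=
  Set.range c = l ∧ ∀ s t : ℝ, d.d (c s) (c t) = ENNReal.ofReal |s - t|

/-- `b` is a Busemann function of the Ptolemy line `l ⊆ X_ω`:  up to an additive constant,
`b x = lim_{t→∞} (d(x,c(t)) − t)` for a unit-speed parameterization `c` of `l`. -/
def IsBusemannOf {X : Type*} (S : MobiusStructure X) (d : ExtMetric X) (ω : X)
    (l : Set X) (b : X → ℝ) : Prop :=
  IsPtolemyLine S ω l ∧ ∃ c : ℝ → X, IsUnitSpeed d l c ∧ ∃ C : ℝ, ∀ x : X, x ≠ ω →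
    Filter.Tendsto (fun t => (d.d x (c t)).toReal - t) Filter.atTop (nhds (b x + C))

/-- The fiber through `x` of the canonical fibration `π_ω`: the set of points on which
every Busemann function of every Ptolemy line of `X_ω` takes the same value as at `x`. -/
def mobiusFiber {X : Type*} (S : MobiusStructure X) (d : ExtMetric X) (ω : X) (x : X) :
    Set X :=
  {y | y ≠ ω ∧ ∀ (l : Set X) (b : X → ℝ), IsBusemannOf S d ω l b → b y = b x}

/-- The base `B_ω` of the canonical fibration: the set of all fibers. -/
def mobiusBase {X : Type*} (S : MobiusStructure X) (d : ExtMetric X) (ω : X) :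
    Set (Set X) :=
  {F | ∃ x : X, x ≠ ω ∧ F = mobiusFiber S d ω x}

/-- The distance between two fibers. -/
noncomputable def fiberDist {X : Type*} (d : ExtMetric X) (F F' : Set X) : ℝ :=
  sInf {r : ℝ | ∃ x ∈ F, ∃ x' ∈ F', r = (d.d x x').toReal}

/-- Two Möbius spaces are Möbius equivalent: there is a bijection between them
preserving all cross-ratio triples. -/
def MobiusEquiv {X Y : Type*} (S : MobiusStructure X) (S' : MobiusStructure Y) : Prop :=
  ∃ f : X → Y, Function.Bijective f ∧ ∀ d ∈ S.M, ∀ d' ∈ S'.M, ∀ x y z u : X,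
    Admissible x y z u → ProjEq (crtVec d x y z u) (crtVec d' (f x) (f y) (f z) (f u))

/-- The standard extended Euclidean metric on the one-point extension
`ℝ̂ⁿ = ℝⁿ ∪ {∞}`, where `∞` is encoded by `none`. -/
noncomputable def stdExtMetric (n : ℕ) : ExtMetric (Option (EuclideanSpace ℝ (Fin n))) where
  d x y :=
    match x, y with
    | none, none => 0
    | none, some _ => ⊤
    | some _, none => ⊤
    | some a, some b => ENNReal.ofReal (dist a b)
  rem := some none
  symm := by intro x y; cases x <;> cases y <;> simp [dist_comm]
  d_self := by intro x; cases x <;> simp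
  pos := by
    intro x y h
    cases x <;> cases y
    · exact absurd rfl h
    · simp
    · simp
    · simp only [ne_eq, Option.some.injEq] at h
      exact ENNReal.ofReal_pos.mpr (dist_pos.mpr h)
  triangle := by
    intro x y z
    cases x <;> cases y <;> cases z <;>
      simp only [le_refl, le_top, zero_le, zero_add, add_zero, top_add, add_top,
        top_le_iff]
    rw [← ENNReal.ofReal_add dist_nonneg dist_nonneg]
    exact ENNReal.ofReal_le_ofReal (dist_triangle _ _ _)
  d_eq_top_iff := by
    intro x y
    cases x <;> cases y <;>
      simp [ENNReal.ofReal_ne_top]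

open Filter Topology

/-- The reference non-principal ultrafilter on `ℕ`, as a filter. -/
noncomputable def UF : Filter ℕ := (hyperfilter ℕ : Filter ℕ)

instance UF_neBot : UF.NeBot := by unfold UF; infer_instance

theorem UF_le : UF ≤ atTop := Nat.hyperfilter_le_atTop

/-- The limit of a sequence along the reference ultrafilter. -/
noncomputable def ulim {E : Type*} [TopologicalSpace E] [Nonempty E] (x : ℕ → E) : E := limUnder UF x

theorem exists_UF_lim_of_isCompact {E : Type*} [TopologicalSpace E] {s : Set E} (hs : IsCompact s)
    {x : ℕ → E} (hx : ∀ᶠ n in UF, x n ∈ s) : ∃ p ∈ s, Tendsto x UF (𝓝 p) := by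
  have h := hs.ultrafilter_le_nhds ((hyperfilter ℕ).map x)
    (by rw [Filter.le_principal_iff]; exact hx)
  obtain ⟨p, hp, h⟩ := h
  exact ⟨p, hp, h⟩

theorem tendsto_ulim_of_isCompact {E : Type*} [TopologicalSpace E] [Nonempty E] {s : Set E}
    (hs : IsCompact s) {x : ℕ → E} (hx : ∀ᶠ n in UF, x n ∈ s) : Tendsto x UF (𝓝 (ulim x)) := by
  obtain ⟨p, -, h⟩ := exists_UF_lim_of_isCompact hs hx
  exact tendsto_nhds_limUnder ⟨p, h⟩

theorem tendsto_ulim {E : Type*} [MetricSpace E] [ProperSpace E] [Nonempty E] {x : ℕ → E}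
    (o : E) (C : ℝ) (hx : ∀ᶠ n in UF, dist (x n) o ≤ C) : Tendsto x UF (𝓝 (ulim x)) :=
  tendsto_ulim_of_isCompact (isCompact_closedBall o C) hx

section Ultralimit

variable {E : Type*} [MetricSpace E] [ProperSpace E]

/-- A pointwise bounded sequence of isometries has an ultralimit, together with its inverses. -/
theorem exists_isometryEquiv_ulim (g : ℕ → E ≃ᵢ E) (x y : E) (hx : Tendsto (fun n => g n x) UF (𝓝 y)) :
    ∃ G : E ≃ᵢ E, (∀ z, Tendsto (fun n => g n z) UF (𝓝 (G z))) ∧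
      ∀ z, Tendsto (fun n => (g n).symm z) UF (𝓝 (G.symm z)) := by
  have : Nonempty E := ⟨x⟩
  have hb : ∀ᶠ n in UF, dist (g n x) y ≤ 1 := by
    filter_upwards [(Metric.tendsto_nhds.1 hx) 1 one_pos] with n hn using hn.le
  have h1 : ∀ z, Tendsto (fun n => g n z) UF (𝓝 (ulim fun n => g n z)) := fun z => by
    refine tendsto_ulim y (dist z x + 1) ?_
    filter_upwards [hb] with n hn
    calc dist (g n z) y ≤ dist (g n z) (g n x) + dist (g n x) y := dist_triangle _ _ _
      _ ≤ dist z x + 1 := by rw [(g n).dist_eq]; linarith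
  have h2 : ∀ z, Tendsto (fun n => (g n).symm z) UF (𝓝 (ulim fun n => (g n).symm z)) := fun z => by
    refine tendsto_ulim x (dist z y + 1) ?_
    filter_upwards [hb] with n hn
    calc dist ((g n).symm z) x = dist z (g n x) := by
          rw [← (g n).dist_eq, (g n).apply_symm_apply]
      _ ≤ dist z y + dist y (g n x) := dist_triangle _ _ _
      _ ≤ dist z y + 1 := by rw [dist_comm y]; linarith
  set G := fun z => ulim fun n => g n z
  set H := fun z => ulim fun n => (g n).symm z
  have hGH : ∀ z, G (H z) = z := fun z => by
    refine tendsto_nhds_unique (h1 (H z)) ?_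
    rw [tendsto_iff_dist_tendsto_zero]
    have := tendsto_iff_dist_tendsto_zero.1 (h2 z)
    refine this.congr fun n => ?_
    rw [← (g n).dist_eq, (g n).apply_symm_apply, dist_comm]
  have hHG : ∀ z, H (G z) = z := fun z => by
    refine tendsto_nhds_unique (h2 (G z)) ?_
    rw [tendsto_iff_dist_tendsto_zero]
    have := tendsto_iff_dist_tendsto_zero.1 (h1 z)
    refine this.congr fun n => ?_
    rw [← (g n).dist_eq ((g n).symm _), (g n).apply_symm_apply, dist_comm]
  have hG : Isometry G := Isometry.of_dist_eq fun a b =>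
    tendsto_nhds_unique ((h1 a).dist (h1 b)) (by simp only [(g _).dist_eq]; exact tendsto_const_nhds)
  refine ⟨⟨⟨G, H, hHG, hGH⟩, hG⟩, h1, h2⟩

/-- Ultralimits of isometric lines through convergent points. -/
theorem exists_line_ulim (c : ℕ → ℝ → E) (hc : ∀ n, Isometry (c n)) (y : E)
    (hy : Tendsto (fun n => c n 0) UF (𝓝 y)) :
    ∃ c' : ℝ → E, Isometry c' ∧ c' 0 = y ∧ ∀ t, Tendsto (fun n => c n t) UF (𝓝 (c' t)) := by
  have : Nonempty E := ⟨y⟩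
  have h1 : ∀ t, Tendsto (fun n => c n t) UF (𝓝 (ulim fun n => c n t)) := fun t => by
    refine tendsto_ulim y (|t| + 1) ?_
    filter_upwards [(Metric.tendsto_nhds.1 hy) 1 one_pos] with n hn
    calc dist (c n t) y ≤ dist (c n t) (c n 0) + dist (c n 0) y := dist_triangle _ _ _
      _ ≤ |t| + 1 := by rw [(hc n).dist_eq, Real.dist_eq, sub_zero]; linarith
  exact ⟨fun t => ulim fun n => c n t, Isometry.of_dist_eq fun a b =>
    tendsto_nhds_unique ((h1 a).dist (h1 b)) (by simp only [(hc _).dist_eq]; exact tendsto_const_nhds),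
    tendsto_nhds_unique (h1 0) hy, h1⟩

end Ultralimit

/-- A Ptolemy metric space with homotheties and inversions, containing a line. -/
class InvSpace (E : Type*) [MetricSpace E] : Prop where
  ptolemy : ∀ x y z u : E, dist x z * dist y u ≤ dist x y * dist z u + dist x u * dist y z
  homothety : ∀ (y : E) (r : ℝ), 0 < r → ∃ h : E ≃ E, (∀ a b, dist (h a) (h b) = r * dist a b) ∧
    h y = y ∧ ∀ c : ℝ → E, Isometry c → c 0 = y → ∀ t, h (c t) = c (r * t)
  exists_line : ∃ c : ℝ → E, Isometry c
  inversion : ∀ o : E, ∃ φ : E → E, (∀ x, x ≠ o → φ x ≠ o ∧ φ (φ x) = x ∧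
      dist (φ x) o = (dist x o)⁻¹) ∧
    (∀ x y, x ≠ o → y ≠ o → dist (φ x) (φ y) = dist x y / (dist x o * dist y o)) ∧
    ∀ c : ℝ → E, Isometry c → c 0 = o → ∀ t, t ≠ 0 → φ (c t) = c (-t⁻¹)

section Busemann

variable {E : Type*} [MetricSpace E]

theorem dist_line {c : ℝ → E} (hc : Isometry c) (s t : ℝ) : dist (c s) (c t) = |s - t| := by
  rw [hc.dist_eq, Real.dist_eq]

theorem isometry_rev {c : ℝ → E} (hc : Isometry c) : Isometry fun t => c (-t) :=
  Isometry.of_dist_eq fun a b => by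
    rw [dist_line hc, Real.dist_eq, ← abs_neg]; congr 1; ring

theorem isometry_shift {c : ℝ → E} (hc : Isometry c) (s : ℝ) : Isometry fun t => c (t + s) :=
  Isometry.of_dist_eq fun a b => by rw [dist_line hc, Real.dist_eq]; congr 1; ring

/-- The Busemann function of a line. -/
noncomputable def bus (c : ℝ → E) (x : E) : ℝ := ⨅ t : ℝ, (dist x (c t) - t)

theorem bus_antitone {c : ℝ → E} (hc : Isometry c) (x : E) :
    Antitone fun t => dist x (c t) - t := fun s t hst => by
  have := dist_triangle x (c s) (c t)
  rw [dist_line hc, abs_sub_comm, abs_of_nonneg (sub_nonneg.2 hst)] at this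
  show dist x (c t) - t ≤ dist x (c s) - s
  linarith

theorem bus_bddBelow {c : ℝ → E} (hc : Isometry c) (x : E) :
    BddBelow (Set.range fun t => dist x (c t) - t) := by
  refine ⟨-dist x (c 0), ?_⟩
  rintro _ ⟨t, rfl⟩
  have := dist_triangle (c 0) x (c t)
  rw [dist_line hc, dist_comm (c 0)] at this
  have h2 := neg_abs_le (0 - t)
  have h3 : t ≤ |0 - t| := by rw [zero_sub, abs_neg]; exact le_abs_self t
  show _ ≤ dist x (c t) - t
  linarith

theorem bus_tendsto {c : ℝ → E} (hc : Isometry c) (x : E) :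
    Tendsto (fun t => dist x (c t) - t) atTop (𝓝 (bus c x)) :=
  tendsto_atTop_ciInf (bus_antitone hc x) (bus_bddBelow hc x)

theorem bus_le {c : ℝ → E} (hc : Isometry c) (x : E) (t : ℝ) : bus c x ≤ dist x (c t) - t :=
  ciInf_le (bus_bddBelow hc x) t

theorem bus_unique {c : ℝ → E} (hc : Isometry c) {x : E} {b : ℝ}
    (h : Tendsto (fun t => dist x (c t) - t) atTop (𝓝 b)) : bus c x = b :=
  tendsto_nhds_unique (bus_tendsto hc x) h

theorem bus_le_add {c : ℝ → E} (hc : Isometry c) (x y : E) : bus c x ≤ bus c y + dist x y := by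
  refine le_of_tendsto_of_tendsto' (bus_tendsto hc x) ((bus_tendsto hc y).add_const _) fun t => ?_
  have := dist_triangle x y (c t)
  linarith

theorem abs_bus_sub_le {c : ℝ → E} (hc : Isometry c) (x y : E) : |bus c x - bus c y| ≤ dist x y := by
  rw [abs_le]
  have := bus_le_add hc x y
  have := bus_le_add hc y x
  rw [dist_comm] at this
  constructor <;> linarith

theorem continuous_bus {c : ℝ → E} (hc : Isometry c) : Continuous (bus c) :=
  (LipschitzWith.of_dist_le_mul (K := 1) fun x y => by
    simpa [Real.dist_eq] using abs_bus_sub_le hc x y).continuous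

theorem bus_line {c : ℝ → E} (hc : Isometry c) (s : ℝ) : bus c (c s) = -s := by
  refine bus_unique hc (tendsto_const_nhds.congr' ?_)
  filter_upwards [eventually_ge_atTop s] with t ht
  rw [dist_line hc, abs_sub_comm, abs_of_nonneg (sub_nonneg.2 ht)]; ring

theorem bus_shift {c : ℝ → E} (hc : Isometry c) (s : ℝ) (x : E) :
    bus (fun t => c (t + s)) x = bus c x + s := by
  refine bus_unique (isometry_shift hc s) ?_
  have := ((bus_tendsto hc x).comp (tendsto_atTop_add_const_right atTop s tendsto_id)).add_const s
  refine this.congr fun t => ?_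
  simp only [Function.comp, id]; ring

theorem bus_isometryEquiv {c : ℝ → E} (g : E ≃ᵢ E) (x : E) :
    bus (fun t => g (c t)) (g x) = bus c x := by
  unfold bus; simp only [g.dist_eq]

theorem bus_homothety {c : ℝ → E} (hc : Isometry c) {h : E → E} {r : ℝ} (hr : 0 < r)
    (hh : ∀ a b, dist (h a) (h b) = r * dist a b) (hhc : ∀ t, h (c t) = c (r * t)) (x : E) :
    bus c (h x) = r * bus c x := by
  refine bus_unique hc ?_
  have h1 : Tendsto (fun t : ℝ => r⁻¹ * t) atTop atTop :=
    tendsto_id.const_mul_atTop (inv_pos.2 hr)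
  refine (((bus_tendsto hc x).comp h1).const_mul r).congr fun t => ?_
  have : c t = h (c (r⁻¹ * t)) := by rw [hhc]; congr 1; field_simp
  simp only [Function.comp]
  rw [this, hh, mul_sub]; congr 1; field_simp

/-- The slope of the (negative) Busemann function of `c` along `m`. -/
noncomputable def slope (c m : ℝ → E) : ℝ := bus c (m 0) - bus c (m 1)

end Busemann

section

variable {E : Type*} [MetricSpace E] [InvSpace E]

theorem dist_convex {m : ℝ → E} (hm : Isometry m) (x : E) {s t u : ℝ} (hst : s ≤ t) (htu : t ≤ u) :
    dist x (m t) * (u - s) ≤ dist x (m s) * (u - t) + dist x (m u) * (t - s) := by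
  have := InvSpace.ptolemy x (m s) (m t) (m u)
  rwa [dist_line hm, dist_line hm, dist_line hm, abs_sub_comm s, abs_sub_comm s, abs_sub_comm t,
    abs_of_nonneg (by linarith), abs_of_nonneg (by linarith), abs_of_nonneg (by linarith)] at this

theorem bus_convex {c m : ℝ → E} (hc : Isometry c) (hm : Isometry m) {s t u : ℝ}
    (hst : s ≤ t) (htu : t ≤ u) :
    bus c (m t) * (u - s) ≤ bus c (m s) * (u - t) + bus c (m u) * (t - s) := by
  refine le_of_tendsto_of_tendsto' ((bus_tendsto hc (m t)).mul_const _)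
    (((bus_tendsto hc (m s)).mul_const _).add ((bus_tendsto hc (m u)).mul_const _)) fun v => ?_
  have := dist_convex hm (c v) hst htu
  rw [dist_comm _ (m s), dist_comm _ (m t), dist_comm _ (m u)] at this
  linarith

theorem bus_add_rev_nonneg {c : ℝ → E} (hc : Isometry c) (x : E) :
    0 ≤ bus c x + bus (fun t => c (-t)) x := by
  refine ge_of_tendsto ((bus_tendsto hc x).add (bus_tendsto (isometry_rev hc) x)) ?_
  filter_upwards [eventually_ge_atTop 0] with t ht
  have := dist_triangle (c t) x (c (-t))
  rw [dist_line hc, dist_comm (c t), sub_neg_eq_add, abs_of_nonneg (by linarith)] at this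
  linarith

theorem bus_add_rev_le {c : ℝ → E} (hc : Isometry c) (x : E) (t : ℝ) :
    bus c x + bus (fun t => c (-t)) x ≤ dist x (c t) + dist x (c (-t)) - 2 * t := by
  have h1 := bus_le hc x t
  have h2 := bus_le (isometry_rev hc) x t
  linarith

/-- Where the distance function to `x` is differentiable along `c` at `c 0`, the two Busemann
functions of `c` cancel at the image of `x` under the inversion at `c 0`. -/
theorem bus_rev_of_differentiableAt {c : ℝ → E} (hc : Isometry c) {φ : E → E}
    (h2 : ∀ x y, x ≠ c 0 → y ≠ c 0 → dist (φ x) (φ y) = dist x y / (dist x (c 0) * dist y (c 0)))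
    (h3 : ∀ t, t ≠ 0 → φ (c t) = c (-t⁻¹)) {x : E} (hx : x ≠ c 0)
    (hd : DifferentiableAt ℝ (fun t => dist x (c t)) 0) :
    bus c (φ x) + bus (fun t => c (-t)) (φ x) = 0 := by
  set f := fun t => dist x (c t)
  set β := bus c (φ x) + bus (fun t => c (-t)) (φ x)
  have hx0 : 0 < dist x (c 0) := dist_pos.2 hx
  have hcne : ∀ t, t ≠ 0 → c t ≠ c 0 := fun t ht h => ht (hc.injective h)
  have key : ∀ t, t ≠ 0 → dist (φ x) (c (-t⁻¹)) = f t / (dist x (c 0) * |t|) := fun t ht => by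
    rw [← h3 t ht, h2 x _ hx (hcne t ht), dist_line hc, sub_zero]
  have h4 : ∀ h : ℝ, 0 < h → dist x (c 0) * β ≤ h⁻¹ * (f h - f 0) + h⁻¹ * (f (-h) - f 0) := by
    intro h hh
    have e := bus_add_rev_le hc (φ x) h⁻¹
    have e1 := key h hh.ne'
    have e2 := key (-h) (neg_ne_zero.2 hh.ne')
    rw [abs_of_pos hh] at e1
    rw [abs_neg, abs_of_pos hh, inv_neg, neg_neg] at e2
    rw [e1, e2] at e
    have : dist x (c 0) * (f (-h) / (dist x (c 0) * h) + f h / (dist x (c 0) * h) - 2 * h⁻¹)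
      = h⁻¹ * (f h - f 0) + h⁻¹ * (f (-h) - f 0) := by
      simp only [f]; field_simp; ring
    rw [← this]
    exact mul_le_mul_of_nonneg_left e hx0.le
  have hD := hd.hasDerivAt
  have t1 : Tendsto (fun h : ℝ => h⁻¹ * (f h - f 0)) (𝓝[>] 0) (𝓝 (deriv f 0)) := by
    have := (hasDerivAt_iff_tendsto_slope_zero.1 hD).mono_left
      (nhdsWithin_mono (0:ℝ) (s := Set.Ioi 0) (t := {0}ᶜ) fun y hy => ne_of_gt hy)
    simpa using this
  have t2 : Tendsto (fun h : ℝ => h⁻¹ * (f (-h) - f 0)) (𝓝[>] 0) (𝓝 (-deriv f 0)) := by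
    have hD' : HasDerivAt (fun h => f (-h)) (-deriv f 0) 0 := by
      have : HasDerivAt f (deriv f 0) (-0) := by simpa using hD
      simpa [Function.comp_def] using this.scomp (0:ℝ) (hasDerivAt_neg 0)
    have := (hasDerivAt_iff_tendsto_slope_zero.1 hD').mono_left
      (nhdsWithin_mono (0:ℝ) (s := Set.Ioi 0) (t := {0}ᶜ) fun y hy => ne_of_gt hy)
    simpa using this
  have h5 : dist x (c 0) * β ≤ 0 := by
    have := ge_of_tendsto (t1.add t2) (by
      filter_upwards [self_mem_nhdsWithin] with h hh using h4 h hh)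
    simpa using this
  exact le_antisymm (nonpos_of_mul_nonpos_right h5 hx0) (bus_add_rev_nonneg hc _)

variable [ProperSpace E]

theorem bus_rev {c : ℝ → E} (hc : Isometry c) (x : E) : bus (fun t => c (-t)) x = -bus c x := by
  suffices H : ∃ t0, ∀ y, bus (fun t => c (t + t0)) y + bus (fun t => c (-t + t0)) y = 0 by
    obtain ⟨t0, H⟩ := H
    have := H x
    have e : (fun t => c (-t + t0)) = fun t => (fun s => c (-s)) (t + (-t0)) := by
      ext t; simp only; congr 1; ring
    rw [e, bus_shift hc, bus_shift (isometry_rev hc)] at this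
    linarith
  obtain ⟨D, hDc, hDd⟩ := TopologicalSpace.exists_countable_dense E
  have hae : ∀ᵐ t : ℝ, ∀ e ∈ D, DifferentiableAt ℝ (fun t => dist e (c t)) t := by
    rw [MeasureTheory.ae_ball_iff hDc]
    intro e _
    refine LipschitzWith.ae_differentiableAt_real (C := 1) (LipschitzWith.of_dist_le_mul fun a b => ?_)
    rw [← hc.dist_eq a b, NNReal.coe_one, one_mul, dist_comm e, dist_comm e]
    exact abs_dist_sub_le _ _ _
  obtain ⟨t0, ht0⟩ := hae.exists
  refine ⟨t0, ?_⟩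
  set c1 := fun t => c (t + t0)
  have hc1 : Isometry c1 := isometry_shift hc t0
  have hrev : (fun t => c (-t + t0)) = fun t => c1 (-t) := rfl
  rw [hrev]
  have hcont : Continuous fun y => bus c1 y + bus (fun t => c1 (-t)) y :=
    (continuous_bus hc1).add (continuous_bus (isometry_rev hc1))
  obtain ⟨φ, h1, h2, h3⟩ := InvSpace.inversion (c1 0)
  intro y
  by_cases hy : y = c1 0
  · rw [hy, bus_line hc1]
    have := bus_line (isometry_rev hc1) 0
    simp only [neg_zero] at this
    rw [this]; simp
  obtain ⟨hy1, hy2, hy3⟩ := h1 y hy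
  obtain ⟨e, heD, he⟩ := mem_closure_iff_seq_limit.1 (hDd (φ y))
  have hne : ∀ᶠ n in atTop, e n ≠ c1 0 := he.eventually_ne hy1
  have hφ : Tendsto (fun n => φ (e n)) atTop (𝓝 y) := by
    rw [tendsto_iff_dist_tendsto_zero]
    have hlim : Tendsto (fun n => dist (e n) (φ y) / (dist (e n) (c1 0) * dist (φ y) (c1 0))) atTop
        (𝓝 (dist (φ y) (φ y) / (dist (φ y) (c1 0) * dist (φ y) (c1 0)))) := by
      have hp := dist_pos.2 hy1
      exact (he.dist tendsto_const_nhds).div ((he.dist tendsto_const_nhds).mul tendsto_const_nhds)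
        (by positivity)
    rw [dist_self, zero_div] at hlim
    refine hlim.congr' ?_
    filter_upwards [hne] with n hn
    rw [← h2 _ _ hn hy1, hy2]
  refine tendsto_nhds_unique (hcont.continuousAt.tendsto.comp hφ) (tendsto_const_nhds.congr' ?_)
  filter_upwards [hne] with n hn
  refine (bus_rev_of_differentiableAt hc1 h2 (h3 c1 hc1 rfl) hn ?_).symm
  have := ht0 (e n) (heD n)
  have h0 : DifferentiableAt ℝ (fun t => dist (e n) (c t)) (0 + t0) := by simpa using this
  exact DifferentiableAt.comp (g := fun t => dist (e n) (c t)) (f := fun t : ℝ => t + t0) (0:ℝ) h0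
    (differentiableAt_id.add_const t0)

theorem bus_affine {c m : ℝ → E} (hc : Isometry c) (hm : Isometry m) (s : ℝ) :
    bus c (m s) = bus c (m 0) - s * slope c m := by
  have key : ∀ {s t u : ℝ}, s ≤ t → t ≤ u →
      bus c (m t) * (u - s) = bus c (m s) * (u - t) + bus c (m u) * (t - s) := by
    intro s t u h1 h2
    refine le_antisymm (bus_convex hc hm h1 h2) ?_
    have := bus_convex (isometry_rev hc) hm h1 h2
    simp only [bus_rev hc] at this
    linarith
  unfold slope
  rcases le_total s 0 with h | h
  · have := key h zero_le_one
    linarith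
  · rcases le_total s 1 with h' | h'
    · have := key h h'
      linarith
    · have := key zero_le_one h'
      linarith

theorem slope_self {c : ℝ → E} (hc : Isometry c) : slope c c = 1 := by
  unfold slope; rw [bus_line hc, bus_line hc]; ring

theorem slope_rev_rev {c m : ℝ → E} (hc : Isometry c) (hm : Isometry m) :
    slope (fun t => c (-t)) (fun t => m (-t)) = slope c m := by
  unfold slope
  simp only [bus_rev hc, neg_zero]
  rw [bus_affine hc hm (-1)]
  unfold slope; ring

theorem bus_parallel {c c' : ℝ → E} (hc : Isometry c) (hc' : Isometry c') (h : slope c c' = 1)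
    (x : E) : bus c' x = bus c x - bus c (c' 0) := by
  have key : ∀ {c c' : ℝ → E}, Isometry c → Isometry c' → slope c c' = 1 →
      bus c x - bus c (c' 0) ≤ bus c' x := by
    intro c c' hc hc' h
    refine ge_of_tendsto' (bus_tendsto hc' x) fun t => ?_
    have h1 := bus_le_add hc x (c' t)
    rw [bus_affine hc hc', h] at h1
    linarith
  refine le_antisymm ?_ (key hc hc' h)
  have := key (isometry_rev hc) (isometry_rev hc') ((slope_rev_rev hc hc').trans h)
  simp only [bus_rev hc, bus_rev hc', neg_zero] at this
  linarith

theorem parallel_unique {c c' : ℝ → E} (hc : Isometry c) (hc' : Isometry c') (h : slope c c' = 1)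
    (h0 : c 0 = c' 0) : c = c' := by
  have key : ∀ {c c' : ℝ → E}, Isometry c → Isometry c' → slope c c' = 1 → c 0 = c' 0 →
      ∀ t, 0 ≤ t → c t = c' t := by
    intro c c' hc hc' h h0 t ht
    have hb : ∀ t, bus c (c' t) = -t := fun t => by
      rw [bus_affine hc hc', h, ← h0, bus_line hc]; ring
    have hd : ∀ s t : ℝ, s ≤ 0 → 0 ≤ t → dist (c s) (c' t) = t - s := by
      intro s t hs ht
      refine le_antisymm ?_ ?_
      · refine (dist_triangle _ (c 0) _).trans ?_
        nth_rw 2 [h0]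
        rw [dist_line hc, dist_line hc', sub_zero, zero_sub, abs_neg, abs_of_nonneg ht,
          abs_of_nonpos hs]; linarith
      · have := abs_bus_sub_le hc (c s) (c' t)
        rw [bus_line hc, hb] at this
        have := le_abs_self (-s - -t)
        linarith
    set e : ℝ → E := fun s => if s ≤ 0 then c s else c' s
    have he : Isometry e := Isometry.of_dist_eq fun a b => by
      simp only [e, Real.dist_eq]
      split_ifs with h1 h2 h2
      · rw [dist_line hc]
      · rw [hd a b h1 (by linarith), abs_sub_comm, abs_of_nonneg (by linarith)]
      · rw [dist_comm, hd b a h2 (by linarith), abs_of_nonneg (by linarith)]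
      · rw [dist_line hc']
    obtain ⟨H, -, -, h3⟩ := InvSpace.homothety (c (-1)) (1 + t) (by linarith)
    have e1 := h3 (fun t => c (t + -1)) (isometry_shift hc _) (by simp) 1
    have e2 := h3 (fun t => e (t + -1)) (isometry_shift he _) (by simp [e]) 1
    rcases ht.eq_or_lt with rfl | ht'
    · exact h0
    · have e0 : e 0 = c 0 := by simp [e]
      have et : e t = c' t := by simp [e, ht']
      have a1 : (1 + t) * 1 + -1 = t := by ring
      simp only [a1] at e1 e2
      rw [show (1:ℝ) + -1 = 0 by ring] at e1 e2
      rw [← e1, ← et, ← e2, e0]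
  ext t
  rcases le_total 0 t with ht | ht
  · exact key hc hc' h h0 t ht
  · have := key (isometry_rev hc) (isometry_rev hc') ((slope_rev_rev hc hc').trans h) (by simpa) (-t)
      (by linarith)
    simpa using this

/-- A homothety, as a function of centre and ratio (only meaningful for positive ratio). -/
noncomputable def hom (y : E) (r : ℝ) : E ≃ E :=
  if h : 0 < r then (InvSpace.homothety y r h).choose else Equiv.refl E

theorem hom_dist (y : E) {r : ℝ} (hr : 0 < r) (a b : E) :
    dist (hom y r a) (hom y r b) = r * dist a b := by
  unfold hom; rw [dif_pos hr]; exact (InvSpace.homothety y r hr).choose_spec.1 a b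

theorem hom_self (y : E) {r : ℝ} (hr : 0 < r) : hom y r y = y := by
  unfold hom; rw [dif_pos hr]; exact (InvSpace.homothety y r hr).choose_spec.2.1

theorem hom_line {c : ℝ → E} (hc : Isometry c) {r : ℝ} (hr : 0 < r) (t : ℝ) :
    hom (c 0) r (c t) = c (r * t) := by
  unfold hom; rw [dif_pos hr]; exact (InvSpace.homothety (c 0) r hr).choose_spec.2.2 c hc rfl t

theorem dist_hom_symm (y : E) {r : ℝ} (hr : 0 < r) (a b : E) :
    dist ((hom y r).symm a) ((hom y r).symm b) = r⁻¹ * dist a b := by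
  have := hom_dist y hr ((hom y r).symm a) ((hom y r).symm b)
  rw [Equiv.apply_symm_apply, Equiv.apply_symm_apply] at this
  rw [this]; field_simp

/-- The isometry contracting at `x` after expanding at `y`. -/
noncomputable def shiftIso (x y : E) (n : ℕ) : E ≃ᵢ E where
  toEquiv := (hom y ((n : ℝ) + 1)).trans (hom x ((n : ℝ) + 1)⁻¹)
  isometry_toFun := Isometry.of_dist_eq fun a b => by
    have hn : (0:ℝ) < n + 1 := by positivity
    show dist (hom x _ (hom y _ a)) (hom x _ (hom y _ b)) = _
    rw [hom_dist x (inv_pos.2 hn), hom_dist y hn]; field_simp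

theorem shiftIso_apply (x y : E) (n : ℕ) (z : E) :
    shiftIso x y n z = hom x ((n : ℝ) + 1)⁻¹ (hom y ((n : ℝ) + 1) z) := rfl

theorem tendsto_inv_nat : Tendsto (fun n : ℕ => ((n : ℝ) + 1)⁻¹) UF (𝓝 0) := by
  refine Tendsto.mono_left ?_ UF_le
  simpa using tendsto_one_div_add_atTop_nhds_zero_nat (𝕜 := ℝ)

theorem tendsto_shiftIso (x y : E) : Tendsto (fun n => shiftIso x y n y) UF (𝓝 x) := by
  rw [tendsto_iff_dist_tendsto_zero]
  have := tendsto_inv_nat.mul_const (dist y x)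
  rw [zero_mul] at this
  refine this.congr fun n => ?_
  have hn : (0:ℝ) < n + 1 := by positivity
  rw [shiftIso_apply, hom_self y hn, ← hom_dist x (inv_pos.2 hn), hom_self x (inv_pos.2 hn)]

theorem exists_parallel {c : ℝ → E} (hc : Isometry c) (y : E) :
    ∃ c' : ℝ → E, Isometry c' ∧ c' 0 = y ∧ slope c c' = 1 := by
  obtain ⟨G, hG, hG'⟩ := exists_isometryEquiv_ulim (shiftIso (c 0) y) y (c 0) (tendsto_shiftIso _ _)
  have hGy : G y = c 0 := tendsto_nhds_unique (hG y) (tendsto_shiftIso _ _)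
  have hc' : Isometry fun t => G.symm (c t) := G.symm.isometry.comp hc
  refine ⟨fun t => G.symm (c t), hc', by simp [← hGy], ?_⟩
  set c' := fun t => G.symm (c t)
  have h0 : c' 0 = y := by simp [c', ← hGy]
  -- evaluate the Busemann function along the approximating isometries in two ways
  have t1 : Tendsto (fun n => bus c (shiftIso (c 0) y n (c' 1))) UF (𝓝 (-1)) := by
    have := (continuous_bus hc).continuousAt.tendsto.comp (hG (c' 1))
    simp only [c', G.apply_symm_apply] at this
    rwa [bus_line hc] at this
  have t2 : Tendsto (fun n => bus c (shiftIso (c 0) y n (c' 1))) UF (𝓝 (-slope c c')) := by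
    have : Tendsto (fun n : ℕ => ((n : ℝ) + 1)⁻¹ * bus c (c' 0) - slope c c') UF
        (𝓝 (0 * bus c (c' 0) - slope c c')) := (tendsto_inv_nat.mul_const _).sub_const _
    rw [zero_mul, zero_sub] at this
    refine this.congr fun n => ?_
    have hn : (0:ℝ) < n + 1 := by positivity
    rw [shiftIso_apply, bus_homothety hc (inv_pos.2 hn) (hom_dist _ (inv_pos.2 hn))
      (hom_line hc (inv_pos.2 hn)), ← h0, hom_line hc' hn, bus_affine hc hc' ((n + 1) * 1)]
    field_simp
  have := tendsto_nhds_unique t1 t2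
  linarith

theorem exists_line_through (y : E) : ∃ c : ℝ → E, Isometry c ∧ c 0 = y := by
  obtain ⟨c, hc⟩ := InvSpace.exists_line (E := E)
  obtain ⟨c', h, h', -⟩ := exists_parallel hc y
  exact ⟨c', h, h'⟩

theorem bus_hom {c : ℝ → E} (hc : Isometry c) (y : E) {r : ℝ} (hr : 0 < r) (z : E) :
    bus c (hom y r z) = bus c y + r * (bus c z - bus c y) := by
  obtain ⟨c', hc', h0, hs⟩ := exists_parallel hc y
  have h1 := bus_homothety hc' hr (hom_dist y hr) (fun t => by rw [← h0]; exact hom_line hc' hr t) z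
  rw [bus_parallel hc hc' hs, bus_parallel hc hc' hs, h0] at h1
  linarith

/-- Isometries changing every Busemann function by a constant only. -/
def IsShift (g : E ≃ᵢ E) : Prop :=
  ∀ c : ℝ → E, Isometry c → ∀ z w, bus c (g z) - bus c z = bus c (g w) - bus c w

theorem exists_isShift (x y : E) : ∃ g : E ≃ᵢ E, g x = y ∧ IsShift g := by
  obtain ⟨G, hG, -⟩ := exists_isometryEquiv_ulim (shiftIso y x) x y (tendsto_shiftIso _ _)
  have hGy : G x = y := tendsto_nhds_unique (hG x) (tendsto_shiftIso _ _)
  refine ⟨G, hGy, fun c hc => ?_⟩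
  have : ∀ z, bus c (G z) = bus c z + (bus c y - bus c x) := fun z => by
    refine tendsto_nhds_unique ((continuous_bus hc).continuousAt.tendsto.comp (hG z)) ?_
    have : Tendsto (fun n : ℕ => bus c z + ((1 - ((n : ℝ) + 1)⁻¹) * bus c y -
        (1 - ((n : ℝ) + 1)⁻¹) * bus c x)) UF
        (𝓝 (bus c z + ((1 - 0) * bus c y - (1 - 0) * bus c x))) :=
      (((tendsto_inv_nat.const_sub 1).mul_const _).sub
        ((tendsto_inv_nat.const_sub 1).mul_const _)).const_add _
    rw [sub_zero, one_mul, one_mul] at this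
    refine this.congr fun n => ?_
    have hn : (0:ℝ) < n + 1 := by positivity
    simp only [Function.comp]
    rw [shiftIso_apply, bus_hom hc y (inv_pos.2 hn), bus_hom hc x hn]
    field_simp; ring
  intro z w
  rw [this, this]; ring

theorem slope_symm {c m : ℝ → E} (hc : Isometry c) (hm : Isometry m) (h : c 0 = m 0) :
    slope c m = slope m c := by
  obtain ⟨φ, -, h2, h3⟩ := InvSpace.inversion (c 0)
  have hne : ∀ {c : ℝ → E}, Isometry c → ∀ t, t ≠ 0 → c t ≠ c 0 := fun hc t ht h =>
    ht (hc.injective h)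
  have key : ∀ t : ℝ, 0 < t → dist (m 1) (c t) = dist (m (-t)) (c (-1)) := fun t ht => by
    have e1 := h2 (m 1) (c t) (by rw [h]; exact hne hm 1 one_ne_zero) (hne hc t ht.ne')
    rw [h3 m hm h.symm 1 one_ne_zero, h3 c hc rfl t ht.ne', dist_line hc, h, dist_line hm] at e1
    have e2 := hom_dist (c 0) ht (m (-1⁻¹)) (c (-t⁻¹))
    rw [hom_line hc ht, h, hom_line hm ht, e1] at e2
    simp only [sub_zero, abs_one, abs_of_pos ht, one_mul, inv_one] at e2
    rw [show t * -1 = -t by ring, show t * -t⁻¹ = -1 by field_simp] at e2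
    rw [e2]; field_simp
  have t1 := bus_tendsto hc (m 1)
  have t2 := bus_tendsto (isometry_rev hm) (c (-1))
  have : bus c (m 1) = bus (fun t => m (-t)) (c (-1)) := by
    refine tendsto_nhds_unique t1 (t2.congr' ?_)
    filter_upwards [eventually_gt_atTop 0] with t ht
    rw [key t ht, dist_comm]
  rw [bus_rev hm, bus_affine hc hm, bus_affine hm hc, ← h, bus_line hc, h, bus_line hm] at this
  linarith

/-- Parallel lines stay at sublinear distance. -/
theorem tendsto_parallel_dist {c c' : ℝ → E} (hc : Isometry c) (hc' : Isometry c')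
    (h : slope c c' = 1) (h0 : bus c (c' 0) = 0) :
    Tendsto (fun n : ℕ => ((n : ℝ) + 1)⁻¹ * dist (c (n + 1)) (c' (n + 1))) UF (𝓝 0) := by
  set C : ℕ → ℝ → E := fun n t => hom (c 0) ((n : ℝ) + 1)⁻¹ (c' ((n + 1) * t))
  have hC : ∀ n, Isometry (C n) := fun n => Isometry.of_dist_eq fun a b => by
    have hn : (0:ℝ) < n + 1 := by positivity
    simp only [C]
    rw [hom_dist _ (inv_pos.2 hn), dist_line hc', ← mul_sub, abs_mul, abs_of_pos hn, Real.dist_eq]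
    field_simp
  have hy : Tendsto (fun n => C n 0) UF (𝓝 (c 0)) := by
    rw [tendsto_iff_dist_tendsto_zero]
    have := tendsto_inv_nat.mul_const (dist (c' 0) (c 0))
    rw [zero_mul] at this
    refine this.congr fun n => ?_
    have hn : (0:ℝ) < n + 1 := by positivity
    simp only [C, mul_zero]
    rw [← hom_dist (c 0) (inv_pos.2 hn), hom_self _ (inv_pos.2 hn)]
  obtain ⟨m, hm, hm0, hmt⟩ := exists_line_ulim C hC (c 0) hy
  have hbC : ∀ n t, bus c (C n t) = -t := fun n t => by
    have hn : (0:ℝ) < n + 1 := by positivity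
    simp only [C]
    rw [bus_hom hc _ (inv_pos.2 hn), bus_line hc, bus_affine hc hc', h, h0]; field_simp; ring
  have hbm : ∀ t, bus c (m t) = -t := fun t =>
    tendsto_nhds_unique ((continuous_bus hc).continuousAt.tendsto.comp (hmt t))
      (by simp only [Function.comp_def, hbC]; exact tendsto_const_nhds)
  have hcm : c = m := parallel_unique hc hm (by unfold slope; rw [hbm, hbm]; ring) hm0.symm
  have := tendsto_iff_dist_tendsto_zero.1 (hmt 1)
  rw [← hcm] at this
  refine this.congr fun n => ?_
  have hn : (0:ℝ) < n + 1 := by positivity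
  have e : c 1 = hom (c 0) ((n : ℝ) + 1)⁻¹ (c (n + 1)) := by
    rw [hom_line hc (inv_pos.2 hn)]; congr 1; field_simp
  rw [e, hom_dist _ (inv_pos.2 hn), dist_comm, mul_one]

end

/-- A symmetric positive kernel satisfying the Ptolemy inequality. -/
structure PtData (X : Type*) where
  q : X → X → ℝ
  symm : ∀ x y, q x y = q y x
  self : ∀ x, q x x = 0
  pos : ∀ x y, x ≠ y → 0 < q x y
  ptolemy : ∀ x y z u, q x z * q y u ≤ q x y * q z u + q x u * q y z

/-- The punctured space `X ∖ {a}`, to be metrized with infinitely remote point `a`. -/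
def PtData.Aff {X : Type*} (_P : PtData X) (a : X) : Type _ := {x : X // x ≠ a}

/-- The kernel normalized so that `a` is infinitely remote. -/
noncomputable def affDist {X : Type*} (q : X → X → ℝ) (a x y : X) : ℝ := q x y / (q x a * q y a)

noncomputable instance {X : Type*} (P : PtData X) (a : X) : MetricSpace (P.Aff a) where
  dist x y := affDist P.q a x.1 y.1
  dist_self x := by simp [affDist, P.self]
  dist_comm x y := by simp only [affDist]; rw [P.symm x.1 y.1, mul_comm]
  dist_triangle x y z := by
    have hx := P.pos _ _ x.2
    have hy := P.pos _ _ y.2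
    have hz := P.pos _ _ z.2
    have h := P.ptolemy x.1 y.1 z.1 a
    simp only [affDist]
    rw [div_add_div _ _ (by positivity) (by positivity), div_le_div_iff₀ (by positivity) (by positivity)]
    have e : 0 ≤ P.q x.1 a * P.q z.1 a * P.q y.1 a := by positivity
    nlinarith [mul_le_mul_of_nonneg_left h e]
  eq_of_dist_eq_zero {x y} h := by
    by_contra hne
    have hx := P.pos _ _ x.2
    have hy := P.pos _ _ y.2
    have := P.pos x.1 y.1 (fun e => hne (Subtype.ext e))
    have : 0 < affDist P.q a x.1 y.1 := by unfold affDist; positivity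
    exact this.ne' h

theorem PtData.dist_def {X : Type*} (P : PtData X) (a : X) (x y : P.Aff a) :
    dist x y = affDist P.q a x.1 y.1 := rfl

theorem PtData.affDist_change {X : Type*} (P : PtData X) {a b x y : X} (hx : x ≠ b)
    (hy : y ≠ b) (hab : a ≠ b) (hxa : x ≠ a) (hya : y ≠ a) :
    affDist P.q a x y = (P.q a b ^ 2)⁻¹ * (affDist P.q b x y / (affDist P.q b x a * affDist P.q b y a)) := by
  have := P.pos _ _ hx
  have := P.pos _ _ hy
  have := P.pos _ _ hab
  have := P.pos _ _ hxa
  have := P.pos _ _ hya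
  unfold affDist
  field_simp

/-- Equality of all cross-ratios. -/
def CrossEq {X : Type*} (q q' : X → X → ℝ) : Prop :=
  ∀ x y z u, q' x y * q' z u * (q x z * q y u) = q' x z * q' y u * (q x y * q z u)

theorem CrossEq.affDist {X : Type*} {q q' : X → X → ℝ} (h : CrossEq q q')
    (hq : ∀ x, q x x = 0) (hq' : ∀ x, q' x x = 0) (hs : ∀ x y, q x y = q y x)
    (hs' : ∀ x y, q' x y = q' y x)
    (hp : ∀ x y, x ≠ y → 0 < q x y) (hp' : ∀ x y, x ≠ y → 0 < q' x y) (a : X) :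
    ∃ k : ℝ, 0 < k ∧ ∀ x y, x ≠ a → y ≠ a → affDist q' a x y = k * affDist q a x y := by
  have apos : ∀ {x y}, x ≠ a → y ≠ a → x ≠ y → 0 < Mobius.affDist q a x y := fun hx hy hxy => by
    have := hp _ _ hx; have := hp _ _ hy; have := hp _ _ hxy
    unfold Mobius.affDist; positivity
  have apos' : ∀ {x y}, x ≠ a → y ≠ a → x ≠ y → 0 < Mobius.affDist q' a x y := fun hx hy hxy => by
    have := hp' _ _ hx; have := hp' _ _ hy; have := hp' _ _ hxy
    unfold Mobius.affDist; positivity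
  have asymm : ∀ x y, Mobius.affDist q a x y = Mobius.affDist q a y x := fun x y => by
    unfold Mobius.affDist; rw [hs x y, mul_comm (q x a)]
  have asymm' : ∀ x y, Mobius.affDist q' a x y = Mobius.affDist q' a y x := fun x y => by
    unfold Mobius.affDist; rw [hs' x y, mul_comm (q' x a)]
  -- ratios with a common point agree
  have key : ∀ {x y z}, x ≠ a → y ≠ a → z ≠ a → x ≠ y → x ≠ z →
      Mobius.affDist q' a x y / Mobius.affDist q a x y = Mobius.affDist q' a x z / Mobius.affDist q a x z := by
    intro x y z hx hy hz hxy hxz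
    have e := h x y z a
    have := hp _ _ hx; have := hp _ _ hy; have := hp _ _ hz; have := hp _ _ hxy; have := hp _ _ hxz
    have := hp' _ _ hx; have := hp' _ _ hy; have := hp' _ _ hz; have := hp' _ _ hxy; have := hp' _ _ hxz
    unfold Mobius.affDist
    field_simp
    linear_combination e
  by_cases hex : ∃ x0 y0, x0 ≠ a ∧ y0 ≠ a ∧ x0 ≠ y0
  · obtain ⟨x0, y0, hx0, hy0, hxy0⟩ := hex
    refine ⟨Mobius.affDist q' a x0 y0 / Mobius.affDist q a x0 y0, div_pos (apos' hx0 hy0 hxy0) (apos hx0 hy0 hxy0), ?_⟩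
    intro x y hx hy
    rcases eq_or_ne x y with rfl | hxy
    · simp [Mobius.affDist, hq, hq']
    rw [← div_eq_iff (apos hx hy hxy).ne']
    by_cases h1 : x = x0
    · subst h1; exact key hx hy hy0 hxy hxy0
    · rw [key hx hy hx0 hxy h1, asymm x x0, asymm' x x0]
      exact key hx0 hx hy0 (Ne.symm h1) hxy0
  · refine ⟨1, one_pos, fun x y hx hy => ?_⟩
    have : x = y := by by_contra hxy; exact hex ⟨x, y, hx, hy, hxy⟩
    subst this
    simp [Mobius.affDist, hq, hq']

section fd

variable {X : Type*} (d : ExtMetric X)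

theorem ExtMetric.fd_symm (x y : X) : d.fd x y = d.fd y x := by
  unfold ExtMetric.fd; rw [d.symm]

theorem ExtMetric.fd_self (x : X) : d.fd x x = 0 := by
  unfold ExtMetric.fd; simp [d.d_self]

theorem ExtMetric.fd_pos (x y : X) (h : x ≠ y) : 0 < d.fd x y := by
  unfold ExtMetric.fd
  split_ifs with h1
  · exact one_pos
  · exact ENNReal.toReal_pos (d.pos x y h).ne' h1

theorem crossEq_of_projEq {q q' : X → X → ℝ} (hq' : ∀ x, q' x x = 0)
    (h : ∀ x y z u, Admissible x y z u → ProjEq (q x y * q z u, q x z * q y u, q x u * q y z)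
      (q' x y * q' z u, q' x z * q' y u, q' x u * q' y z)) : CrossEq q q' := by
  intro x y z u
  by_cases ha : Admissible x y z u
  · obtain ⟨l, -, e⟩ := h x y z u ha
    simp only [Prod.smul_mk, smul_eq_mul, Prod.mk.injEq] at e
    rw [e.1, e.2.1]; ring
  · unfold Admissible at ha
    simp only [← not_or, not_not] at ha
    rcases ha with ⟨rfl, rfl⟩ | ⟨rfl, rfl⟩ | ⟨rfl, rfl⟩ | ⟨rfl, rfl⟩ <;> simp [hq']

variable {S : MobiusStructure X}

/-- The Ptolemy kernel given by a metric of a Ptolemy structure. -/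
noncomputable def ptData (hpt : IsPtolemyStructure S) {d : ExtMetric X} (hd : d ∈ S.M) : PtData X where
  q := d.fd
  symm := d.fd_symm
  self := d.fd_self
  pos := d.fd_pos
  ptolemy x y z u := by
    by_cases ha : Admissible x y z u
    · exact (hpt d hd x y z u ha).2.1
    · unfold Admissible at ha
      simp only [← not_or, not_not] at ha
      have hnn : ∀ x y, 0 ≤ d.fd x y := fun x y => by
        rcases eq_or_ne x y with rfl | h
        · rw [d.fd_self]
        · exact (d.fd_pos x y h).le
      have h0 : d.fd x z * d.fd y u = 0 := by
        rcases ha with ⟨rfl, rfl⟩ | ⟨rfl, rfl⟩ | ⟨rfl, rfl⟩ | ⟨rfl, rfl⟩ <;> simp [d.fd_self]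
      rw [h0]
      exact add_nonneg (mul_nonneg (hnn _ _) (hnn _ _)) (mul_nonneg (hnn _ _) (hnn _ _))

theorem crossEq_of_mem {d d' : ExtMetric X} (hd : d ∈ S.M) (hd' : d' ∈ S.M) : CrossEq d.fd d'.fd :=
  crossEq_of_projEq d'.fd_self (S.compat d hd d' hd')

theorem crossEq_of_isMobiusAuto {d : ExtMetric X} (hd : d ∈ S.M) {f : X → X} (hf : IsMobiusAuto S f) :
    CrossEq d.fd (fun x y => d.fd (f x) (f y)) :=
  crossEq_of_projEq (fun _ => d.fd_self _) (hf.2 d hd)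

theorem ExtMetric.fd_of_rem {a x y : X} (h : d.rem = some a) (hx : x ≠ a) (hy : y ≠ a) :
    d.d x y = ENNReal.ofReal (affDist d.fd a x y) := by
  have h1 : ∀ {z}, z ≠ a → d.fd z a = 1 := fun {z} hz => by
    unfold ExtMetric.fd
    rw [if_pos ((d.d_eq_top_iff z a).2 ⟨hz, Or.inr h⟩)]
  have h2 : d.d x y ≠ ⊤ := fun e => by
    have := ((d.d_eq_top_iff x y).1 e).2
    rw [h] at this
    rcases this with e | e
    · exact hx (Option.some.inj e).symm
    · exact hy (Option.some.inj e).symm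
  unfold affDist
  rw [h1 hx, h1 hy, mul_one, div_one]
  unfold ExtMetric.fd
  rw [if_neg h2, ENNReal.ofReal_toReal h2]

/-- Metrics of the structure with remote point `a` are the multiples of the normalized kernel. -/
theorem exists_affDist_of_rem {d d' : ExtMetric X} (hd : d ∈ S.M) (hd' : d' ∈ S.M) {a : X}
    (h : d'.rem = some a) : ∃ k : ℝ, 0 < k ∧ ∀ x y, x ≠ a → y ≠ a →
      d'.d x y = ENNReal.ofReal (k * affDist d.fd a x y) := by
  obtain ⟨k, hk, e⟩ := (crossEq_of_mem hd hd').affDist d.fd_self d'.fd_self d.fd_symm d'.fd_symm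
    d.fd_pos d'.fd_pos a
  exact ⟨k, hk, fun x y hx hy => by rw [d'.fd_of_rem h hx hy, e x y hx hy]⟩

/-- The extended metric on `X` with remote point `a` given by the normalized kernel. -/
noncomputable def affExt (P : PtData X) (a : X) : ExtMetric X := by
  classical
  exact
  { d := fun x y => if x = y then 0 else if x = a ∨ y = a then ⊤ else ENNReal.ofReal (affDist P.q a x y)
    rem := some a
    symm := fun x y => by
      have : affDist P.q a x y = affDist P.q a y x := by
        unfold affDist; rw [P.symm x y, mul_comm (P.q x a)]
      simp only [eq_comm (a := x) (b := y), or_comm (a := x = a), this]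
    d_self := by simp
    pos := fun x y h => by
      rw [if_neg h]
      split_ifs with h1
      · simp
      · push Not at h1
        have := P.pos _ _ h1.1; have := P.pos _ _ h1.2; have := P.pos _ _ h
        exact ENNReal.ofReal_pos.2 (by unfold affDist; positivity)
    triangle := fun x y z => by
      by_cases h1 : x = z
      · simp [h1]
      by_cases h2 : x = y
      · subst h2; simp
      by_cases h3 : y = z
      · subst h3; simp
      by_cases h4 : y = a
      · rw [if_neg h2, if_pos (Or.inr h4), top_add]; exact le_top
      by_cases h5 : x = a
      · rw [if_neg h2, if_pos (c := x = a ∨ y = a) (Or.inl h5), top_add]; exact le_top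
      by_cases h6 : z = a
      · rw [if_neg h3, if_pos (c := y = a ∨ z = a) (Or.inr h6), add_top]; exact le_top
      simp only [h1, h2, h3, h4, h5, h6, if_false, or_self]
      have := dist_triangle (α := P.Aff a) ⟨x, h5⟩ ⟨y, h4⟩ ⟨z, h6⟩
      rw [← ENNReal.ofReal_add]
      · exact ENNReal.ofReal_le_ofReal this
      · exact dist_nonneg (α := P.Aff a) (x := ⟨x, h5⟩) (y := ⟨y, h4⟩)
      · exact dist_nonneg (α := P.Aff a) (x := ⟨y, h4⟩) (y := ⟨z, h6⟩)
    d_eq_top_iff := fun x y => by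
      by_cases h : x = y
      · simp [h]
      · by_cases h1 : x = a ∨ y = a
        · simp [h, h1, eq_comm (a := a)]
        · simp [h, h1, eq_comm (a := a)] }

theorem affExt_d (P : PtData X) {a x y : X} (hx : x ≠ a) (hy : y ≠ a) :
    (affExt P a).d x y = ENNReal.ofReal (affDist P.q a x y) := by
  classical
  show (if x = y then 0 else if x = a ∨ y = a then ⊤ else ENNReal.ofReal (affDist P.q a x y)) = _
  by_cases h : x = y
  · subst h; simp [affDist, P.self]
  · simp [h, hx, hy]

theorem affExt_fd (P : PtData X) {a x y : X} (hx : x ≠ a) (hy : y ≠ a) :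
    (affExt P a).fd x y = affDist P.q a x y := by
  have : 0 ≤ affDist P.q a x y := dist_nonneg (α := P.Aff a) (x := ⟨x, hx⟩) (y := ⟨y, hy⟩)
  unfold ExtMetric.fd
  rw [affExt_d P hx hy, if_neg ENNReal.ofReal_ne_top, ENNReal.toReal_ofReal this]

theorem affExt_fd_rem (P : PtData X) {a x : X} (hx : x ≠ a) : (affExt P a).fd x a = 1 := by
  have : (affExt P a).d x a = ⊤ := ((affExt P a).d_eq_top_iff x a).2 ⟨hx, Or.inr rfl⟩
  unfold ExtMetric.fd
  rw [if_pos this]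

theorem affExt_mem (hpt : IsPtolemyStructure S) {d : ExtMetric X} (hd : d ∈ S.M) (a : X) :
    affExt (ptData hpt hd) a ∈ S.M := by
  classical
  set P := ptData hpt hd
  refine S.maximal _ fun d1 hd1 x y z u ha => ?_
  refine (S.compat d hd d1 hd1 x y z u ha).trans' ?_
  -- a uniform formula for the finite factor: `fd x y = q x y / (v x * v y)`
  set v : X → ℝ := fun x => if x = a then 1 else P.q x a
  have hv : ∀ x, 0 < v x := fun x => by
    simp only [v]; split_ifs with h
    · exact one_pos
    · exact P.pos _ _ h
  have hf : ∀ x y, (affExt P a).fd x y = P.q x y / (v x * v y) := fun x y => by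
    rcases eq_or_ne x y with rfl | hxy
    · rw [ExtMetric.fd_self, P.self, zero_div]
    by_cases hx : x = a
    · subst hx
      rw [ExtMetric.fd_symm, affExt_fd_rem P hxy.symm]
      have := (P.pos _ _ hxy.symm).ne'
      simp only [v, if_true, if_neg hxy.symm, one_mul]
      rw [P.symm x y, div_self this]
    by_cases hy : y = a
    · subst hy
      rw [affExt_fd_rem P hxy]
      have := (P.pos _ _ hxy).ne'
      simp only [v, if_true, if_neg hxy, mul_one]
      rw [div_self this]
    · rw [affExt_fd P hx hy]; simp only [v, if_neg hx, if_neg hy]; rfl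
  have := hv x; have := hv y; have := hv z; have := hv u
  refine ⟨(v x * v y * v z * v u)⁻¹, by positivity, ?_⟩
  unfold crtVec
  simp only [hf, Prod.smul_mk, smul_eq_mul, Prod.mk.injEq]
  refine ⟨?_, ?_, ?_⟩ <;> simp only [P, ptData] <;> field_simp

end fd

/-- The inclusion of the punctured space. -/
def PtData.val {X : Type*} (P : PtData X) (a : X) : P.Aff a → X := Subtype.val

theorem PtData.val_injective {X : Type*} (P : PtData X) (a : X) : Function.Injective (P.val a) :=
  Subtype.val_injective

theorem range_val {X : Type*} (P : PtData X) (a : X) : Set.range (P.val a) = {a}ᶜ := by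
  ext x; constructor
  · rintro ⟨y, rfl⟩; exact y.2
  · intro h; exact ⟨⟨x, h⟩, rfl⟩

section

variable {X : Type*} {S : MobiusStructure X} (hpt : IsPtolemyStructure S) {d : ExtMetric X}
  (hd : d ∈ S.M) [T : TopologicalSpace X] (hT : T = mobiusTop S)

include hT

theorem isOpen_image_val (a : X) (U : Set ((ptData hpt hd).Aff a)) (hU : IsOpen U) :
    IsOpen ((ptData hpt hd).val a '' U) := by
  set P := ptData hpt hd
  have hball : ∀ x : P.Aff a, ∀ r > 0, IsOpen (P.val a '' Metric.ball x r) := by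
    intro x r hr
    rw [hT]
    apply TopologicalSpace.isOpen_generateFrom_of_mem
    refine ⟨affExt P a, affExt_mem hpt hd a, x.1, fun h => x.2 (Option.some.inj h).symm,
      ENNReal.ofReal r, ENNReal.ofReal_pos.2 hr, ENNReal.ofReal_ne_top, Or.inl ?_⟩
    ext y
    simp only [Set.mem_image, Metric.mem_ball, Set.mem_setOf_eq]
    constructor
    · rintro ⟨z, hz, rfl⟩
      rw [affExt_d P (show P.val a z ≠ a from z.2) x.2]
      exact (ENNReal.ofReal_lt_ofReal_iff hr).2 hz
    · intro h
      have hy : y ≠ a := by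
        rintro rfl
        rw [((affExt P y).d_eq_top_iff y x.1).2 ⟨x.2.symm, Or.inl rfl⟩] at h
        exact absurd h (by simp)
      rw [affExt_d P hy x.2] at h
      exact ⟨⟨y, hy⟩, (ENNReal.ofReal_lt_ofReal_iff hr).1 h, rfl⟩
  rw [isOpen_iff_forall_mem_open]
  rintro _ ⟨x, hx, rfl⟩
  obtain ⟨r, hr, hrU⟩ := Metric.isOpen_iff.1 hU x hx
  exact ⟨_, Set.image_mono hrU, hball x r hr, ⟨x, Metric.mem_ball_self hr, rfl⟩⟩

theorem continuous_val (a : X) : Continuous ((ptData hpt hd).val a) := by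
  classical
  set P := ptData hpt hd
  rw [hT]
  refine continuous_generateFrom_iff.2 ?_
  rintro s ⟨d', hd', x, hx, r, hr, hrt, hs⟩
  obtain ⟨k, hk, hk'⟩ := (crossEq_of_mem hd hd').affDist d.fd_self d'.fd_self d.fd_symm d'.fd_symm
    d.fd_pos d'.fd_pos a
  set v : P.Aff a → ℝ := fun y => if d'.rem = some y.1 then 0 else (d'.fd y.1 a)⁻¹
  have hfd : ∀ {y z : X}, y ≠ z → d'.rem ≠ some y → d'.rem ≠ some z →
      d'.d y z = ENNReal.ofReal (d'.fd y z) := fun {y z} h h1 h2 => by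
    have : d'.d y z ≠ ⊤ := fun e => by
      rcases ((d'.d_eq_top_iff y z).1 e).2 with e | e
      · exact h1 e
      · exact h2 e
    unfold ExtMetric.fd
    rw [if_neg this, ENNReal.ofReal_toReal this]
  have hfr : ∀ {y z : X}, y ≠ z → d'.rem = some z → d'.fd y z = 1 := fun {y z} h h1 => by
    unfold ExtMetric.fd
    rw [if_pos ((d'.d_eq_top_iff y z).2 ⟨h, Or.inr h1⟩)]
  have hv0 : ∀ y, 0 ≤ v y := fun y => by
    simp only [v]; split_ifs
    · exact le_rfl
    · exact (inv_pos.2 (d'.fd_pos _ _ y.2)).le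
  have hdd : ∀ y z : P.Aff a, affDist d'.fd a y.1 z.1 = k * dist y z := fun y z => hk' _ _ y.2 z.2
  have hlip : ∀ y z, v y ≤ v z + k * dist y z := by
    intro y z
    rw [← hdd]
    rcases eq_or_ne y z with rfl | hyz
    · simp [affDist, d'.fd_self]
    have hyz' : y.1 ≠ z.1 := fun h => hyz (Subtype.ext h)
    have py := d'.fd_pos _ _ y.2
    have pz := d'.fd_pos _ _ z.2
    have pyz := d'.fd_pos _ _ hyz'
    by_cases hy : d'.rem = some y.1
    · have : v y = 0 := if_pos hy
      rw [this]
      have := hv0 z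
      have : 0 < affDist d'.fd a y.1 z.1 := by unfold affDist; positivity
      linarith
    by_cases hz : d'.rem = some z.1
    · have e1 : v y = (d'.fd y.1 a)⁻¹ := if_neg hy
      have e2 : v z = 0 := if_pos hz
      rw [e1, e2, zero_add]; unfold affDist
      rw [d'.fd_symm z.1 a, hfr hyz' hz, hfr z.2.symm hz, mul_one, one_div]
    have e1 : v y = (d'.fd y.1 a)⁻¹ := if_neg hy
    have e2 : v z = (d'.fd z.1 a)⁻¹ := if_neg hz
    rw [e1, e2]; unfold affDist
    have tri : d'.fd z.1 a ≤ d'.fd y.1 a + d'.fd y.1 z.1 := by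
      by_cases ha : d'.rem = some a
      · rw [hfr y.2 ha, hfr z.2 ha]; linarith
      · have := d'.triangle z.1 y.1 a
        rw [hfd z.2 hz ha, hfd y.2 hy ha, hfd hyz'.symm hz hy,
          ← ENNReal.ofReal_add (d'.fd_pos _ _ hyz'.symm).le py.le,
          ENNReal.ofReal_le_ofReal_iff (by rw [d'.fd_symm]; linarith), d'.fd_symm z.1 y.1] at this
        linarith
    rw [inv_eq_one_div, inv_eq_one_div, div_add_div _ _ pz.ne' (by positivity),
      div_le_div_iff₀ py (by positivity)]
    nlinarith [mul_pos py pz]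
  have hvc : Continuous v := by
    refine (LipschitzWith.of_dist_le_mul (K := ⟨k, hk.le⟩) fun y z => ?_).continuous
    rw [Real.dist_eq, abs_sub_le_iff]
    have h1 := hlip y z
    have h2 := hlip z y
    rw [dist_comm] at h2
    exact ⟨by show _ ≤ k * _; linarith, by show _ ≤ k * _; linarith⟩
  lift r to NNReal using hrt
  have hr' : (0:ℝ) < r := by exact_mod_cast hr
  by_cases hxa : x = a
  · subst hxa
    have key : ∀ y : P.Aff x, d'.d y.1 x = if d'.rem = some y.1 then ⊤ else ENNReal.ofReal (v y)⁻¹ := by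
      intro y
      split_ifs with h
      · exact (d'.d_eq_top_iff _ _).2 ⟨y.2, Or.inl h⟩
      · have : v y = (d'.fd y.1 x)⁻¹ := if_neg h
        rw [this, inv_inv, hfd y.2 h hx]
    rcases hs with rfl | rfl
    · have : P.val x ⁻¹' {y | d'.d y x < r} = {y | 1 < r * v y} := by
        ext y
        show d'.d y.1 x < r ↔ 1 < r * v y
        rw [key]
        split_ifs with h
        · have : v y = 0 := if_pos h
          rw [this]; simp
        · have : 0 < v y := by
            have : v y = (d'.fd y.1 x)⁻¹ := if_neg h
            rw [this]; exact inv_pos.2 (d'.fd_pos _ _ y.2)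
          rw [← ENNReal.ofReal_coe_nnreal, ENNReal.ofReal_lt_ofReal_iff hr', inv_lt_iff_one_lt_mul₀ this]
      rw [this]
      exact isOpen_lt continuous_const (continuous_const.mul hvc)
    · have : P.val x ⁻¹' {y | r < d'.d y x} = {y | r * v y < 1} := by
        ext y
        show r < d'.d y.1 x ↔ r * v y < 1
        rw [key]
        split_ifs with h
        · have : v y = 0 := if_pos h
          rw [this]; simp
        · have : 0 < v y := by
            have : v y = (d'.fd y.1 x)⁻¹ := if_neg h
            rw [this]; exact inv_pos.2 (d'.fd_pos _ _ y.2)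
          rw [← ENNReal.ofReal_coe_nnreal, ENNReal.ofReal_lt_ofReal_iff (inv_pos.2 this), lt_inv_comm₀ hr' this,
            ← one_div, lt_div_iff₀ hr', mul_comm]
      rw [this]
      exact isOpen_lt (continuous_const.mul hvc) continuous_const
  · set x' : P.Aff a := ⟨x, hxa⟩
    have hvx : 0 < v x' := by
      have : v x' = (d'.fd x a)⁻¹ := if_neg hx
      rw [this]; exact inv_pos.2 (d'.fd_pos _ _ hxa)
    have key : ∀ y : P.Aff a, d'.d y.1 x = if d'.rem = some y.1 then ⊤ else
        ENNReal.ofReal (k * dist y x' / (v y * v x')) := by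
      intro y
      split_ifs with h
      · refine (d'.d_eq_top_iff _ _).2 ⟨fun e => ?_, Or.inl h⟩
        rw [e] at h; exact hx h
      · rw [← hdd]
        rcases eq_or_ne y.1 x with e | e
        · have e' : y = x' := Subtype.ext e
          rw [e, d'.d_self, e']
          have : d'.fd x x'.1 = 0 := d'.fd_self x
          simp [affDist, this]
          try (right; exact .inl this)
        have e1 : v y = (d'.fd y.1 a)⁻¹ := if_neg h
        have e2 : v x' = (d'.fd x a)⁻¹ := if_neg hx
        rw [e1, e2, hfd e h hx]
        congr 1
        unfold affDist
        have := (d'.fd_pos _ _ y.2).ne'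
        have := (d'.fd_pos _ _ hxa).ne'
        simp only [x']
        field_simp
    have hvy : ∀ y : P.Aff a, d'.rem ≠ some y.1 → 0 < v y := fun y h => by
      have : v y = (d'.fd y.1 a)⁻¹ := if_neg h
      rw [this]; exact inv_pos.2 (d'.fd_pos _ _ y.2)
    rcases hs with rfl | rfl
    · have : P.val a ⁻¹' {y | d'.d y x < r} = {y | k * dist y x' < r * (v y * v x')} := by
        ext y
        show d'.d y.1 x < r ↔ k * dist y x' < r * (v y * v x')
        rw [key]
        split_ifs with h
        · have : v y = 0 := if_pos h
          rw [this]; simp; positivity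
        · have := hvy y h
          rw [← ENNReal.ofReal_coe_nnreal, ENNReal.ofReal_lt_ofReal_iff hr', div_lt_iff₀ (by positivity)]
      rw [this]
      exact isOpen_lt (continuous_const.mul (continuous_id.dist continuous_const))
        (continuous_const.mul (hvc.mul continuous_const))
    · have : P.val a ⁻¹' {y | r < d'.d y x} = {y | r * (v y * v x') < k * dist y x'} := by
        ext y
        show r < d'.d y.1 x ↔ r * (v y * v x') < k * dist y x'
        rw [key]
        split_ifs with h
        · have h0 : v y = 0 := if_pos h
          have : 0 < dist y x' := dist_pos.2 fun e => by rw [e] at h; exact hx h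
          rw [h0]; simp; positivity
        · have := hvy y h
          rw [← ENNReal.ofReal_coe_nnreal, ENNReal.ofReal_lt_ofReal_iff', lt_div_iff₀ (by positivity)]
          constructor
          · exact fun h => h.1
          · intro h
            refine ⟨h, ?_⟩
            have : 0 < r * (v y * v x') := by positivity
            exact div_pos (this.trans h) (by positivity)
      rw [this]
      exact isOpen_lt (continuous_const.mul (hvc.mul continuous_const))
        (continuous_const.mul (continuous_id.dist continuous_const))

theorem isOpenEmbedding_val (a : X) : IsOpenEmbedding ((ptData hpt hd).val a) :=
  .of_continuous_injective_isOpenMap (continuous_val hpt hd hT a) ((ptData hpt hd).val_injective a)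
    fun U hU => isOpen_image_val hpt hd hT a U hU

theorem properSpace_aff [CompactSpace X] (a : X) : ProperSpace ((ptData hpt hd).Aff a) := by
  set P := ptData hpt hd
  refine ⟨fun x r => ?_⟩
  refine IsCompact.of_isClosed_subset ?_ Metric.isClosed_closedBall
    (Metric.closedBall_subset_closedBall (le_max_left r 1))
  set R := max r 1
  have hR : 0 < R := lt_of_lt_of_le one_pos (le_max_right _ _)
  have hemb := isOpenEmbedding_val hpt hd hT a
  rw [hemb.isEmbedding.isCompact_iff]
  refine IsClosed.isCompact ?_
  rw [← isOpen_compl_iff, hT]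
  apply TopologicalSpace.isOpen_generateFrom_of_mem
  refine ⟨affExt P a, affExt_mem hpt hd a, x.1, fun h => x.2 (Option.some.inj h).symm,
    ENNReal.ofReal R, ENNReal.ofReal_pos.2 hR, ENNReal.ofReal_ne_top, Or.inr ?_⟩
  ext y
  simp only [Set.mem_compl_iff, Set.mem_image, Metric.mem_closedBall, Set.mem_setOf_eq]
  by_cases hy : y = a
  · subst hy
    rw [((affExt P y).d_eq_top_iff y x.1).2 ⟨x.2.symm, Or.inl rfl⟩]
    simp only [ENNReal.ofReal_lt_top, iff_true]
    rintro ⟨z, -, e⟩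
    exact z.2 e
  · rw [affExt_d P hy x.2, ENNReal.ofReal_lt_ofReal_iff']
    constructor
    · intro h
      have : R < dist (α := P.Aff a) ⟨y, hy⟩ x := by
        by_contra hc
        exact h ⟨⟨y, hy⟩, not_lt.1 hc, rfl⟩
      exact ⟨this, hR.trans this⟩
    · rintro ⟨h, -⟩ ⟨z, hz, rfl⟩
      exact absurd hz (not_le.2 h)

include hpt hd in
theorem t2Space_of_infinite [Infinite X] : T2Space X := by
  classical
  refine ⟨fun x y hxy => ?_⟩
  obtain ⟨a, ha⟩ := Infinite.exists_notMem_finset ({x, y} : Finset X)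
  simp only [Finset.mem_insert, Finset.mem_singleton, not_or] at ha
  set P := ptData hpt hd
  have hemb := isOpenEmbedding_val hpt hd hT a
  obtain ⟨U, V, hU, hV, hx, hy, hUV⟩ := t2_separation (X := P.Aff a) (x := ⟨x, Ne.symm ha.1⟩)
    (y := ⟨y, Ne.symm ha.2⟩) (fun e => hxy (congrArg Subtype.val e))
  exact ⟨_, _, hemb.isOpenMap _ hU, hemb.isOpenMap _ hV, ⟨_, hx, rfl⟩, ⟨_, hy, rfl⟩,
    (Set.disjoint_image_iff (P.val_injective a)).2 hUV⟩

end

/-- A Ptolemy kernel describing the metrics of a compact Ptolemy structure. -/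
structure Model {X : Type*} [T : TopologicalSpace X] (S : MobiusStructure X) (P : PtData X) : Prop where
  top : T = mobiusTop S
  mem : ∀ a, affExt P a ∈ S.M
  emb : ∀ a, IsOpenEmbedding (P.val a)
  proper : ∀ a, ProperSpace (P.Aff a)
  auto : ∀ f, IsMobiusAuto S f → CrossEq P.q (fun x y => P.q (f x) (f y))
  rem : ∀ d' ∈ S.M, ∀ a, d'.rem = some a → ∃ k : ℝ, 0 < k ∧ ∀ x y, x ≠ a → y ≠ a →
      d'.d x y = ENNReal.ofReal (k * affDist P.q a x y)

theorem model_ptData {X : Type*} {S : MobiusStructure X} (hpt : IsPtolemyStructure S) {d : ExtMetric X}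
    (hd : d ∈ S.M) [T : TopologicalSpace X] (hT : T = mobiusTop S) [CompactSpace X] :
    Model S (ptData hpt hd) where
  top := hT
  mem := affExt_mem hpt hd
  emb := isOpenEmbedding_val hpt hd hT
  proper := properSpace_aff hpt hd hT
  auto _ hf := crossEq_of_isMobiusAuto hd hf
  rem _ hd' _ h := exists_affDist_of_rem hd hd' h

/-- The space is the one-point compactification of each punctured space. -/
theorem Model.nonempty_homeo_onePoint {X : Type*} [TopologicalSpace X] {S : MobiusStructure X}
    {P : PtData X} (M : Model S P) [CompactSpace X] [T2Space X] (a : X) :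
    Nonempty (OnePoint (P.Aff a) ≃ₜ X) :=
  ⟨OnePoint.equivOfIsEmbeddingOfRangeEq a _ (M.emb a).isEmbedding (range_val P a)⟩

theorem exists_circle_param (p : Metric.sphere (0 : ℂ) 1) :
    ∃ f : ℝ → Metric.sphere (0 : ℂ) 1, IsEmbedding f ∧ Set.range f = {p}ᶜ := by
  haveI : Fact (Module.finrank ℝ ℂ = 1 + 1) := ⟨Complex.finrank_real_complex⟩
  set e := stereographic' (E := ℂ) 1 p
  have he : e.symm.source = Set.univ := by
    rw [OpenPartialHomeomorph.symm_source]; exact stereographic'_target p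
  have h1 := e.symm.isOpenEmbedding he
  set g : ℝ ≃ₜ EuclideanSpace ℝ (Fin 1) :=
    ((EuclideanSpace.equiv (Fin 1) ℝ).toHomeomorph.trans (Homeomorph.funUnique (Fin 1) ℝ)).symm
  refine ⟨e.symm ∘ g, h1.isEmbedding.comp g.isEmbedding, ?_⟩
  rw [Set.range_comp, g.surjective.range_eq, ← he, e.symm.image_source_eq_target]
  exact stereographic'_source p

theorem abs_ptolemy_of_between {a b e f : ℝ} (h : (b - a) * (b - e) * ((f - a) * (f - e)) < 0) :
    |a - e| * |b - f| = |a - b| * |e - f| + |a - f| * |b - e| := by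
  wlog hae : a ≤ e generalizing a e
  · have := this (a := e) (e := a) (by linarith) (by linarith)
    rw [abs_sub_comm a e, this, abs_sub_comm a b, abs_sub_comm b e, abs_sub_comm a f, abs_sub_comm e f]
    rw [abs_sub_comm e b, abs_sub_comm b a, abs_sub_comm f a, abs_sub_comm f e,
      abs_sub_comm a f, abs_sub_comm e f]
    ring
  wlog hb : (b - a) * (b - e) < 0 generalizing b f
  · have hb' : 0 ≤ (b - a) * (b - e) := not_lt.1 hb
    have h2 : (f - a) * (f - e) < 0 := by nlinarith
    have := this (b := f) (f := b) (by linarith) h2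
    rw [abs_sub_comm b f, this, abs_sub_comm e b, abs_sub_comm f e]; ring
  have hf : 0 < (f - a) * (f - e) := by nlinarith
  have h1 : a < b := by nlinarith
  have h2 : b < e := by nlinarith
  rcases pos_and_pos_or_neg_and_neg_of_mul_pos hf with ⟨h3, h4⟩ | ⟨h3, h4⟩
  · rw [abs_of_nonpos (by linarith : a - e ≤ 0), abs_of_nonpos (by linarith : b - f ≤ 0),
      abs_of_nonpos (by linarith : a - b ≤ 0), abs_of_nonpos (by linarith : e - f ≤ 0),
      abs_of_nonpos (by linarith : a - f ≤ 0), abs_of_nonpos (by linarith : b - e ≤ 0)]; ring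
  · rw [abs_of_nonpos (by linarith : a - e ≤ 0), abs_of_nonneg (by linarith : 0 ≤ b - f),
      abs_of_nonpos (by linarith : a - b ≤ 0), abs_of_nonneg (by linarith : 0 ≤ e - f),
      abs_of_nonneg (by linarith : 0 ≤ a - f), abs_of_nonpos (by linarith : b - e ≤ 0)]; ring

section

variable {X : Type*} {S : MobiusStructure X} {P : PtData X}

section top

variable [T : TopologicalSpace X] (M : Model S P) [CompactSpace X] [T2Space X]

include M

theorem isClosed_circle_of_line {ω : X} {c : ℝ → P.Aff ω} (hc : Isometry c) :
    IsClosed (insert ω (Set.range (P.val ω ∘ c))) := by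
  have : (insert ω (Set.range (P.val ω ∘ c)))ᶜ = P.val ω '' (Set.range c)ᶜ := by
    ext x
    simp only [Set.mem_compl_iff, Set.mem_insert_iff, not_or, Set.mem_image, Set.mem_range, Function.comp]
    constructor
    · rintro ⟨h1, h2⟩
      exact ⟨⟨x, h1⟩, fun ⟨t, e⟩ => h2 ⟨t, by rw [e]; rfl⟩, rfl⟩
    · rintro ⟨y, h1, rfl⟩
      exact ⟨y.2, fun ⟨t, e⟩ => h1 ⟨t, P.val_injective ω e⟩⟩
  rw [← isOpen_compl_iff, this]
  exact (M.emb ω).isOpenMap _ hc.isClosedEmbedding.isClosed_range.isOpen_compl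

theorem homeoToCircle_of_line {ω : X} {c : ℝ → P.Aff ω} (hc : Isometry c) :
    HomeoToCircle S (insert ω (Set.range (P.val ω ∘ c))) := by
  set σ := insert ω (Set.range (P.val ω ∘ c))
  have hcl : IsClosed σ := isClosed_circle_of_line M hc
  haveI : CompactSpace σ := isCompact_iff_compactSpace.1 hcl.isCompact
  have hemb := ((M.emb ω).isEmbedding.comp hc.isEmbedding).codRestrict σ
    fun t => Or.inr ⟨t, rfl⟩
  have hr : Set.range (σ.codRestrict (P.val ω ∘ c) fun t => Or.inr ⟨t, rfl⟩) = {⟨ω, Or.inl rfl⟩}ᶜ := by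
    ext ⟨x, hx⟩
    simp only [Set.mem_range, Set.mem_compl_iff, Set.mem_singleton_iff, Subtype.mk.injEq]
    constructor
    · rintro ⟨t, e⟩ h
      rw [← Subtype.val_inj] at e
      exact (c t).2 (e.trans (congrArg Subtype.val h))
    · intro h
      rcases hx with hx | ⟨t, ht⟩
      · exact absurd (Subtype.ext hx) h
      · exact ⟨t, Subtype.ext ht⟩
  have p : Metric.sphere (0 : ℂ) 1 := ⟨1, by simp⟩
  obtain ⟨f, hf, hfr⟩ := exists_circle_param p
  haveI : CompactSpace (Metric.sphere (0 : ℂ) 1) := isCompact_iff_compactSpace.1 (isCompact_sphere _ _)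
  have := (OnePoint.equivOfIsEmbeddingOfRangeEq _ _ hemb hr).symm.trans
    (OnePoint.equivOfIsEmbeddingOfRangeEq p f hf hfr)
  obtain rfl := M.top
  exact ⟨this⟩

theorem isPreconnected_ray {ω : X} {c : ℝ → P.Aff ω} (hc : Isometry c) (s : ℝ) :
    IsPreconnected (insert ω ((P.val ω ∘ c) '' Set.Ici s)) := by
  have hemb := M.emb ω
  set A := (P.val ω ∘ c) '' Set.Ici s
  have hA : IsPreconnected A :=
    isPreconnected_Ici.image _ (hemb.continuous.comp hc.continuous).continuousOn
  refine hA.subset_closure (Set.subset_insert _ _) (Set.insert_subset ?_ subset_closure)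
  by_contra hω
  have hsub : closure A ⊆ Set.range (P.val ω) := by
    rw [range_val P ω]
    intro x hx h
    rw [Set.mem_singleton_iff] at h
    exact hω (h ▸ hx)
  have hK : IsCompact (P.val ω ⁻¹' closure A) := by
    rw [hemb.isEmbedding.isCompact_iff, Set.image_preimage_eq_of_subset hsub]
    exact isClosed_closure.isCompact
  obtain ⟨R, hR⟩ := hK.isBounded.subset_closedBall (c s)
  have h1 : c (s + (|R| + 1)) ∈ P.val ω ⁻¹' closure A :=
    subset_closure ⟨_, Set.mem_Ici.2 (by linarith [abs_nonneg R]), rfl⟩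
  have h2 := hR h1
  rw [Metric.mem_closedBall, hc.dist_eq, Real.dist_eq, add_sub_cancel_left,
    abs_of_pos (by linarith [abs_nonneg R])] at h2
  linarith [le_abs_self R]

theorem isPreconnected_ray' {ω : X} {c : ℝ → P.Aff ω} (hc : Isometry c) (s : ℝ) :
    IsPreconnected (insert ω ((P.val ω ∘ c) '' Set.Iic s)) := by
  have := isPreconnected_ray M (isometry_rev hc) (-s)
  convert this using 2
  ext x; constructor
  · rintro ⟨t, ht, rfl⟩; exact ⟨-t, neg_le_neg (Set.mem_Iic.1 ht), by simp⟩
  · rintro ⟨t, ht, rfl⟩; exact ⟨-t, by simpa using neg_le_neg (Set.mem_Ici.1 ht), rfl⟩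

/-- A separating quadruple on the circle of a line is interleaved in the parameter. -/
theorem fd_eq_of_separates {ω : X} {c : ℝ → P.Aff ω} (hc : Isometry c) {x y z u : X}
    (hx : x ∈ insert ω (Set.range (P.val ω ∘ c)))
    (hy : y ∈ insert ω (Set.range (P.val ω ∘ c)))
    (hz : z ∈ insert ω (Set.range (P.val ω ∘ c)))
    (hu : u ∈ insert ω (Set.range (P.val ω ∘ c)))
    (hxy : x ≠ y) (hxz : x ≠ z) (hxu : x ≠ u) (hyz : y ≠ z) (hyu : y ≠ u) (hzu : z ≠ u)
    (hs : SeparatesIn S (insert ω (Set.range (P.val ω ∘ c))) x z y u) :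
    (affExt P ω).fd x z * (affExt P ω).fd y u =
      (affExt P ω).fd x y * (affExt P ω).fd z u +
      (affExt P ω).fd x u * (affExt P ω).fd y z := by
  set f : ℝ → X := P.val ω ∘ c
  set σ := insert ω (Set.range f)
  have hfc : Continuous f := (M.emb ω).continuous.comp hc.continuous
  have hfi : Function.Injective f := (P.val_injective ω).comp hc.injective
  have hfω : ∀ t, f t ≠ ω := fun t => (c t).2
  have sep : ∀ A : Set X, IsPreconnected A → A ⊆ σ → x ∉ A → z ∉ A → y ∈ A → u ∈ A → False := by
    intro A hA h1 h2 h3 h4 h5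
    refine hs ?_
    unfold mobiusCCIn
    rw [← M.top]
    refine hA.subset_connectedComponentIn h4 (show A ⊆ σ \ {x, z} from fun w hw => ⟨h1 hw, ?_⟩) h5
    rintro (rfl | h)
    · exact h2 hw
    · rw [Set.mem_singleton_iff] at h; subst h; exact h3 hw
  have hseg : ∀ a b, IsPreconnected (f '' Set.Icc a b) := fun a b =>
    isPreconnected_Icc.image _ hfc.continuousOn
  have hR : ∀ s, IsPreconnected (insert ω (f '' Set.Ici s)) := isPreconnected_ray M hc
  have hL : ∀ s, IsPreconnected (insert ω (f '' Set.Iic s)) := isPreconnected_ray' M hc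
  have hLR : ∀ s t, IsPreconnected (insert ω (f '' Set.Iic s) ∪ insert ω (f '' Set.Ici t)) := fun s t =>
    (hL s).union ω (Set.mem_insert _ _) (Set.mem_insert _ _) (hR t)
  have sub1 : ∀ A, f '' A ⊆ σ := fun A w ⟨t, _, e⟩ => Or.inr ⟨t, e⟩
  have sub2 : ∀ A, insert ω (f '' A) ⊆ σ := fun A => Set.insert_subset_insert (Set.image_subset_range _ _)
  have mem1 : ∀ {A t}, f t ∈ f '' A ↔ t ∈ A := fun {A t} => hfi.mem_set_image
  have mem2 : ∀ {A t}, f t ∈ insert ω (f '' A) ↔ t ∈ A := fun {A t} => by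
    rw [Set.mem_insert_iff, mem1]; exact or_iff_right (hfω t)
  have nω : ∀ {A}, ω ∉ f '' A := fun {A} ⟨t, _, e⟩ => hfω t e
  have fd1 : ∀ s t, (affExt P ω).fd (f s) (f t) = |s - t| := fun s t => by
    rw [affExt_fd P (hfω s) (hfω t), ← Real.dist_eq, ← hc.dist_eq]; rfl
  have fd2 : ∀ s, (affExt P ω).fd (f s) ω = 1 := fun s => affExt_fd_rem P (hfω s)
  have fd3 : ∀ s, (affExt P ω).fd ω (f s) = 1 := fun s => by rw [ExtMetric.fd_symm, fd2]
  have hxω : x = ω ∨ ∃ t, x = f t := hx.imp id fun ⟨t, e⟩ => ⟨t, e.symm⟩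
  have hyω : y = ω ∨ ∃ t, y = f t := hy.imp id fun ⟨t, e⟩ => ⟨t, e.symm⟩
  have hzω : z = ω ∨ ∃ t, z = f t := hz.imp id fun ⟨t, e⟩ => ⟨t, e.symm⟩
  have huω : u = ω ∨ ∃ t, u = f t := hu.imp id fun ⟨t, e⟩ => ⟨t, e.symm⟩
  clear hx hy hz hu
  -- one point of the separating pair is `ω`
  have case1 : ∀ e b g : ℝ, (∀ A : Set X, IsPreconnected A → A ⊆ σ → ω ∉ A → f e ∉ A → f b ∈ A →
      f g ∈ A → False) → |b - g| = |e - g| + |b - e| := by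
    intro e b g h
    have key : ¬ (b < e ∧ g < e) ∧ ¬ (e < b ∧ e < g) := by
      constructor
      · rintro ⟨h1, h2⟩
        refine h (f '' Set.Icc (min b g) (max b g)) (hseg _ _) (sub1 _) nω ?_ ?_ ?_
        · rw [mem1]; intro h3; exact absurd h3.2 (not_le.2 (max_lt h1 h2))
        · exact mem1.2 ⟨min_le_left _ _, le_max_left _ _⟩
        · exact mem1.2 ⟨min_le_right _ _, le_max_right _ _⟩
      · rintro ⟨h1, h2⟩
        refine h (f '' Set.Icc (min b g) (max b g)) (hseg _ _) (sub1 _) nω ?_ ?_ ?_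
        · rw [mem1]; intro h3; exact absurd h3.1 (not_le.2 (lt_min h1 h2))
        · exact mem1.2 ⟨min_le_left _ _, le_max_left _ _⟩
        · exact mem1.2 ⟨min_le_right _ _, le_max_right _ _⟩
    have : e ∈ Set.uIcc b g := by
      rw [Set.mem_uIcc]
      by_contra hcon
      push Not at hcon
      rcases le_or_gt b e with h1 | h1
      · have h2 := hcon.1 h1
        rcases h1.eq_or_lt with rfl | h3
        · exact absurd (hcon.2 h2.le) (lt_irrefl _)
        · exact key.1 ⟨h3, h2⟩
      · refine key.2 ⟨h1, ?_⟩
        by_contra h2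
        exact absurd (hcon.2 (not_lt.1 h2)) (not_lt.2 h1.le)
    rw [Set.mem_uIcc] at this
    rcases this with ⟨h1, h2⟩ | ⟨h1, h2⟩
    · rw [abs_of_nonpos (by linarith), abs_of_nonpos (by linarith), abs_of_nonpos (by linarith)]; ring
    · rw [abs_of_nonneg (by linarith), abs_of_nonneg (by linarith), abs_of_nonneg (by linarith)]; ring
  -- one point of the separated pair is `ω`
  have case2 : ∀ a e g : ℝ, (∀ A : Set X, IsPreconnected A → A ⊆ σ → f a ∉ A → f e ∉ A → ω ∈ A →
      f g ∈ A → False) → |a - e| = |e - g| + |a - g| := by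
    intro a e g h
    have k1 : ¬ (a < g ∧ e < g) := by
      rintro ⟨h1, h2⟩
      exact h _ (hR g) (sub2 _) (by rw [mem2]; exact not_le.2 h1) (by rw [mem2]; exact not_le.2 h2)
        (Set.mem_insert _ _) (mem2.2 Set.self_mem_Ici)
    have k2 : ¬ (g < a ∧ g < e) := by
      rintro ⟨h1, h2⟩
      exact h _ (hL g) (sub2 _) (by rw [mem2]; exact not_le.2 h1) (by rw [mem2]; exact not_le.2 h2)
        (Set.mem_insert _ _) (mem2.2 Set.self_mem_Iic)
    rcases le_or_gt a g with h1 | h1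
    · rcases le_or_gt g e with h2 | h2
      · rw [abs_of_nonpos (by linarith), abs_of_nonneg (by linarith), abs_of_nonpos (by linarith)]; ring
      · have : a = g := h1.eq_of_not_lt fun h3 => k1 ⟨h3, h2⟩
        subst this; rw [sub_self, abs_zero, add_zero, abs_sub_comm]
    · have h2 : e ≤ g := not_lt.1 fun h3 => k2 ⟨h1, h3⟩
      rw [abs_of_nonneg (by linarith), abs_of_nonpos (by linarith), abs_of_nonneg (by linarith)]; ring
  rcases hxω with rfl | ⟨a, rfl⟩
  · obtain ⟨b, rfl⟩ := hyω.resolve_left hxy.symm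
    obtain ⟨e, rfl⟩ := hzω.resolve_left hxz.symm
    obtain ⟨g, rfl⟩ := huω.resolve_left hxu.symm
    rw [fd3, fd3, fd3, fd1, fd1, fd1, one_mul, one_mul, one_mul]
    exact case1 e b g sep
  rcases hzω with rfl | ⟨e, rfl⟩
  · obtain ⟨b, rfl⟩ := hyω.resolve_left hyz
    obtain ⟨g, rfl⟩ := huω.resolve_left hzu.symm
    rw [fd2, fd1, fd1, fd3, fd1, fd2, one_mul, mul_one, mul_one, add_comm, case1 a b g
      (fun A h1 h2 h3 h4 => sep A h1 h2 h4 h3), abs_sub_comm b a]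
  rcases hyω with rfl | ⟨b, rfl⟩
  · obtain ⟨g, rfl⟩ := huω.resolve_left hyu.symm
    rw [fd1, fd3, fd2, fd1, fd1, fd3, one_mul, mul_one, mul_one]
    exact case2 a e g sep
  rcases huω with rfl | ⟨g, rfl⟩
  · rw [fd1, fd2, fd1, fd2, fd2, fd1, one_mul, mul_one, mul_one, add_comm, abs_sub_comm a b]
    rw [abs_sub_comm a e, case2 e a b (fun A h1 h2 h3 h4 h5 h6 => sep A h1 h2 h4 h3 h6 h5),
      abs_sub_comm a b, abs_sub_comm e b, add_comm]
  rw [fd1, fd1, fd1, fd1, fd1, fd1]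
  have nab : b ≠ a := fun h => hxy (h ▸ rfl)
  have nae : a ≠ e := fun h => hxz (h ▸ rfl)
  have nag : g ≠ a := fun h => hxu (h ▸ rfl)
  have nbe : b ≠ e := fun h => hyz (h ▸ rfl)
  have nge : g ≠ e := fun h => hzu (h ▸ rfl)
  refine abs_ptolemy_of_between ?_
  have seg : ∀ p q : ℝ, (p ≤ b ∧ b ≤ q) → (p ≤ g ∧ g ≤ q) → ¬ (p ≤ a ∧ a ≤ q) → ¬ (p ≤ e ∧ e ≤ q) → False :=
    fun p q h1 h2 h3 h4 => sep _ (hseg p q) (sub1 _) (fun h => h3 (mem1.1 h)) (fun h => h4 (mem1.1 h))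
      (mem1.2 h1) (mem1.2 h2)
  have ray : ∀ p q : ℝ, (b ≤ p ∨ q ≤ b) → (g ≤ p ∨ q ≤ g) → ¬ (a ≤ p ∨ q ≤ a) → ¬ (e ≤ p ∨ q ≤ e) → False := by
    intro p q h1 h2 h3 h4
    refine sep _ (hLR p q) (Set.union_subset (sub2 _) (sub2 _)) ?_ ?_ ?_ ?_
    · rw [Set.mem_union, mem2, mem2]; exact h3
    · rw [Set.mem_union, mem2, mem2]; exact h4
    · rw [Set.mem_union, mem2, mem2]; exact h1
    · rw [Set.mem_union, mem2, mem2]; exact h2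
  have hne : (b - a) * (b - e) * ((g - a) * (g - e)) ≠ 0 := by
    refine mul_ne_zero (mul_ne_zero ?_ ?_) (mul_ne_zero ?_ ?_) <;> rwa [sub_ne_zero]
  refine lt_of_le_of_ne (not_lt.1 fun hpos => ?_) hne
  rcases pos_and_pos_or_neg_and_neg_of_mul_pos hpos with ⟨h1, h2⟩ | ⟨h1, h2⟩
  · rcases pos_and_pos_or_neg_and_neg_of_mul_pos h1 with ⟨h3, h4⟩ | ⟨h3, h4⟩ <;>
    rcases pos_and_pos_or_neg_and_neg_of_mul_pos h2 with ⟨h5, h6⟩ | ⟨h5, h6⟩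
    · exact seg (min b g) (max b g) (by simp) (by simp) (by
        rintro ⟨h, -⟩; exact absurd h (not_le.2 (lt_min (by linarith) (by linarith))))
        (by rintro ⟨h, -⟩; exact absurd h (not_le.2 (lt_min (by linarith) (by linarith))))
    · exact ray g b (by simp) (by simp) (by simp; constructor <;> linarith) (by simp; constructor <;> linarith)
    · exact ray b g (by simp) (by simp) (by simp; constructor <;> linarith) (by simp; constructor <;> linarith)
    · exact seg (min b g) (max b g) (by simp) (by simp) (by
        rintro ⟨-, h⟩; exact absurd h (not_le.2 (max_lt (by linarith) (by linarith))))
        (by rintro ⟨-, h⟩; exact absurd h (not_le.2 (max_lt (by linarith) (by linarith))))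
  · rcases lt_or_gt_of_ne nae with h | h
    · have b1 : a < b := by nlinarith
      have b2 : b < e := by nlinarith
      have g1 : a < g := by nlinarith
      have g2 : g < e := by nlinarith
      exact seg (min b g) (max b g) (by simp) (by simp)
        (by rintro ⟨h, -⟩; exact absurd h (not_le.2 (lt_min b1 g1)))
        (by rintro ⟨-, h⟩; exact absurd h (not_le.2 (max_lt b2 g2)))
    · have b1 : b < a := by nlinarith
      have b2 : e < b := by nlinarith
      have g1 : g < a := by nlinarith
      have g2 : e < g := by nlinarith
      exact seg (min b g) (max b g) (by simp) (by simp)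
        (by rintro ⟨-, h⟩; exact absurd h (not_le.2 (max_lt b1 g1)))
        (by rintro ⟨h, -⟩; exact absurd h (not_le.2 (lt_min b2 g2)))


theorem isPtolemyCircle_of_line {ω : X} {c : ℝ → P.Aff ω} (hc : Isometry c) :
    IsPtolemyCircle S (insert ω (Set.range (P.val ω ∘ c))) := by
  refine ⟨homeoToCircle_of_line M hc, ?_⟩
  intro d' hd' x hx y hy z hz u hu hxy hxz hxu hyz hyu hzu hs
  have h := fd_eq_of_separates M hc hx hy hz hu hxy hxz hxu hyz hyu hzu hs
  obtain ⟨l, hl, e⟩ := S.compat _ (M.mem ω) d' hd' x y z u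
    ⟨fun h => hxy h.1, fun h => hxy h.1, fun h => hxz h.1, fun h => hyz h.1⟩
  simp only [crtVec, Prod.smul_mk, smul_eq_mul, Prod.mk.injEq] at e
  have hfd : d'.fd x z * d'.fd y u = d'.fd x y * d'.fd z u + d'.fd x u * d'.fd y z := by
    rw [e.1, e.2.1, e.2.2, h]; ring
  have p := fun a b (hab : a ≠ b) => (d'.pos a b hab).ne'
  have htop := fun a b (hab : a ≠ b) (hr : d'.rem = some a ∨ d'.rem = some b) => (d'.d_eq_top_iff a b).2 ⟨hab, hr⟩
  by_cases h1 : d'.rem = some x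
  · rw [htop x z hxz (.inl h1), htop x y hxy (.inl h1), ENNReal.top_mul (p _ _ hyu),
      ENNReal.top_mul (p _ _ hzu), top_add]
  by_cases h2 : d'.rem = some y
  · rw [htop y u hyu (.inl h2), htop x y hxy (.inr h2), ENNReal.mul_top (p _ _ hxz),
      ENNReal.top_mul (p _ _ hzu), top_add]
  by_cases h3 : d'.rem = some z
  · rw [htop x z hxz (.inr h3), htop z u hzu (.inl h3), ENNReal.top_mul (p _ _ hyu),
      ENNReal.mul_top (p _ _ hxy), top_add]
  by_cases h4 : d'.rem = some u
  · rw [htop y u hyu (.inr h4), htop z u hzu (.inr h4), ENNReal.mul_top (p _ _ hxz),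
      ENNReal.mul_top (p _ _ hxy), top_add]
  have hq : ∀ a b, a ≠ b → d'.rem ≠ some a → d'.rem ≠ some b → d'.d a b = ENNReal.ofReal (d'.fd a b) := by
    intro a b hab ha hb
    have : d'.d a b ≠ ⊤ := fun e => ((d'.d_eq_top_iff a b).1 e).2.elim ha hb
    unfold ExtMetric.fd
    rw [if_neg this, ENNReal.ofReal_toReal this]
  have pp := fun a b hab => (d'.fd_pos a b hab).le
  rw [hq _ _ hxz h1 h3, hq _ _ hyu h2 h4, hq _ _ hxy h1 h2, hq _ _ hzu h3 h4, hq _ _ hxu h1 h4,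
    hq _ _ hyz h2 h3, ← ENNReal.ofReal_mul (pp _ _ hxz), ← ENNReal.ofReal_mul (pp _ _ hxy),
    ← ENNReal.ofReal_mul (pp _ _ hxu), ← ENNReal.ofReal_add, hfd]
  · exact mul_nonneg (pp _ _ hxy) (pp _ _ hzu)
  · exact mul_nonneg (pp _ _ hxu) (pp _ _ hyz)

/-- Along a Ptolemy circle through `ω` the metric with remote point `ω` is additive. -/
theorem exists_additive_param {ω : X} {σ : Set X} (hσ : IsPtolemyCircle S σ) (hω : ω ∈ σ) :
    ∃ γ : ℝ → P.Aff ω, IsClosedEmbedding γ ∧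
      ∀ s t u, s < t → t < u → dist (γ s) (γ u) = dist (γ s) (γ t) + dist (γ t) (γ u) := by
  obtain ⟨h⟩ := hσ.1
  rw [← M.top] at h
  obtain ⟨f, hf, hfr⟩ := exists_circle_param (h ⟨ω, hω⟩)
  set g : ℝ → X := fun t => (h.symm (f t)).1
  have hg : IsEmbedding g := IsEmbedding.subtypeVal.comp (h.symm.isEmbedding.comp hf)
  have hgσ : ∀ t, g t ∈ σ := fun t => (h.symm (f t)).2
  have hgω : ∀ t, g t ≠ ω := fun t e => by
    have h1 : f t ∈ ({h ⟨ω, hω⟩}ᶜ : Set _) := hfr ▸ ⟨t, rfl⟩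
    apply h1
    have : h.symm (f t) = ⟨ω, hω⟩ := Subtype.ext e
    rw [Set.mem_singleton_iff, ← this, h.apply_symm_apply]
  have hgr : ∀ x ∈ σ, x ≠ ω → ∃ t, g t = x := fun x hx hne => by
    have : h ⟨x, hx⟩ ∈ Set.range f := by
      rw [hfr]
      intro e
      exact hne (congrArg Subtype.val (h.injective e))
    obtain ⟨t, ht⟩ := this
    exact ⟨t, by simp only [g]; rw [ht, h.symm_apply_apply]⟩
  have hσc : IsCompact σ := by
    rw [isCompact_iff_compactSpace]
    haveI : CompactSpace (Metric.sphere (0 : ℂ) 1) := isCompact_iff_compactSpace.1 (isCompact_sphere _ _)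
    exact h.symm.compactSpace
  set γ : ℝ → P.Aff ω := fun t => ⟨g t, hgω t⟩
  have hγ : IsEmbedding γ := by
    have : IsEmbedding (P.val ω ∘ γ) := hg
    exact (M.emb ω).isEmbedding.of_comp_iff.1 this
  have hrange : Set.range γ = P.val ω ⁻¹' σ := by
    ext x; constructor
    · rintro ⟨t, rfl⟩; exact hgσ t
    · intro hx
      obtain ⟨t, ht⟩ := hgr x.1 hx x.2
      exact ⟨t, Subtype.ext ht⟩
  refine ⟨γ, ⟨hγ, hrange ▸ hσc.isClosed.preimage (M.emb ω).continuous⟩, ?_⟩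
  intro s t u hst htu
  have hne : ∀ {a b}, a ≠ b → g a ≠ g b := fun hab e => hab (hg.injective e)
  have hsep : SeparatesIn S σ (g t) ω (g s) (g u) := by
    unfold SeparatesIn mobiusCCIn
    rw [← M.top]
    intro hmem
    set C := connectedComponentIn (σ \ {g t, ω}) (g s)
    have hs : g s ∈ C := mem_connectedComponentIn
      ⟨hgσ s, by rintro (e | e); exacts [hne hst.ne e, hgω s e]⟩
    have hsub : C ⊆ σ \ {g t, ω} := connectedComponentIn_subset _ _
    have hC : g '' (g ⁻¹' C) = C := Set.image_preimage_eq_of_subset fun x hx =>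
      hgr x (hsub hx).1 fun e => (hsub hx).2 (Or.inr e)
    have hpre : IsPreconnected (g ⁻¹' C) := by
      rw [← hg.isInducing.isPreconnected_image, hC]; exact isPreconnected_connectedComponentIn
    have := hpre.ordConnected.out (show s ∈ g ⁻¹' C from hs) (show u ∈ g ⁻¹' C from hmem) ⟨hst.le, htu.le⟩
    exact (hsub this).2 (Or.inl rfl)
  set b := g (u + 1)
  have hub : u < u + 1 := lt_add_one u
  have e := hσ.2 _ (M.mem b) (g t) (hgσ t) (g s) (hgσ s) ω hω (g u) (hgσ u) (hne hst.ne') (hgω t) (hne htu.ne)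
    (hgω s) (hne (hst.trans htu).ne) (hgω u).symm hsep
  have nb1 : g t ≠ b := hne (by linarith)
  have nb2 : g s ≠ b := hne (by linarith)
  have nb3 : g u ≠ b := hne (by linarith)
  have nb4 : ω ≠ b := (hgω _).symm
  have hnn : ∀ {x y}, x ≠ b → y ≠ b → 0 ≤ affDist P.q b x y := fun {x y} hx hy =>
    dist_nonneg (α := P.Aff b) (x := ⟨x, hx⟩) (y := ⟨y, hy⟩)
  rw [affExt_d P nb1 nb4, affExt_d P nb2 nb3, affExt_d P nb1 nb2, affExt_d P nb4 nb3, affExt_d P nb1 nb3,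
    affExt_d P nb2 nb4, ← ENNReal.ofReal_mul (hnn nb1 nb4), ← ENNReal.ofReal_mul (hnn nb1 nb2),
    ← ENNReal.ofReal_mul (hnn nb1 nb3), ← ENNReal.ofReal_add (mul_nonneg (hnn nb1 nb2) (hnn nb4 nb3))
    (mul_nonneg (hnn nb1 nb3) (hnn nb2 nb4)), ENNReal.ofReal_eq_ofReal_iff (mul_nonneg (hnn nb1 nb4) (hnn nb2 nb3))
    (add_nonneg (mul_nonneg (hnn nb1 nb2) (hnn nb4 nb3)) (mul_nonneg (hnn nb1 nb3) (hnn nb2 nb4)))] at e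
  show affDist P.q ω (g s) (g u) = affDist P.q ω (g s) (g t) + affDist P.q ω (g t) (g u)
  have p1 := P.pos _ _ nb1
  have p2 := P.pos _ _ nb2
  have p3 := P.pos _ _ nb3
  have p4 := P.pos _ _ nb4
  have p5 := P.pos _ _ (hgω t)
  have p6 := P.pos _ _ (hgω s)
  have p7 := P.pos _ _ (hgω u)
  unfold affDist at e ⊢
  rw [P.symm ω (g u), P.symm (g t) (g s)] at e
  field_simp at e ⊢
  linear_combination e

theorem exists_line_of_circle {ω : X} {σ : Set X} (hσ : IsPtolemyCircle S σ) (hω : ω ∈ σ) :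
    ∃ c : ℝ → P.Aff ω, Isometry c := by
  obtain ⟨γ, hγ, hadd⟩ := exists_additive_param M hσ hω
  haveI := M.proper ω
  set L : ℝ → ℝ := fun t => if 0 ≤ t then dist (γ 0) (γ t) else -dist (γ 0) (γ t)
  have hL : ∀ s t, s < t → L t - L s = dist (γ s) (γ t) := by
    intro s t hst
    simp only [L]
    rcases lt_trichotomy 0 s with h | rfl | h
    · rw [if_pos (h.trans hst).le, if_pos h.le, hadd 0 s t h hst]; ring
    · rw [if_pos hst.le, if_pos le_rfl, dist_self, sub_zero]
    · rw [if_neg (not_le.2 h)]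
      rcases lt_trichotomy 0 t with h' | rfl | h'
      · rw [if_pos h'.le, hadd s 0 t h h', dist_comm (γ s)]; ring
      · rw [if_pos le_rfl, dist_self, dist_comm (γ s)]; ring
      · rw [if_neg (not_le.2 h'), dist_comm (γ 0) (γ s), hadd s t 0 hst h', dist_comm (γ 0) (γ t)]; ring
  have hLabs : ∀ s t, |L s - L t| = dist (γ s) (γ t) := by
    intro s t
    rcases lt_trichotomy s t with h | rfl | h
    · rw [abs_sub_comm, hL s t h, abs_of_nonneg dist_nonneg]
    · simp
    · rw [hL t s h, abs_of_nonneg dist_nonneg, dist_comm]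
  have hmono : StrictMono L := fun s t h => by
    have := hL s t h
    have := dist_pos.2 (fun e => h.ne (hγ.injective e) : γ s ≠ γ t)
    linarith
  have hcont : Continuous L := by
    rw [continuous_iff_continuousAt]
    intro t
    rw [ContinuousAt, tendsto_iff_dist_tendsto_zero]
    have : ∀ s, dist (L s) (L t) = dist (γ s) (γ t) := fun s => hLabs s t
    simp only [this]
    exact tendsto_iff_dist_tendsto_zero.1 (hγ.continuous.tendsto t)
  have hco : Tendsto (fun t => dist (γ t) (γ 0)) (cocompact ℝ) atTop :=
    (tendsto_dist_right_cocompact_atTop _).comp hγ.tendsto_cocompact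
  rw [cocompact_eq_atBot_atTop, tendsto_sup] at hco
  have htop : Tendsto L atTop atTop := by
    refine hco.2.congr' ?_
    filter_upwards [eventually_ge_atTop 0] with t ht
    simp only [L]; rw [if_pos ht, dist_comm]
  have hbot : Tendsto L atBot atBot := by
    refine (tendsto_neg_atTop_atBot.comp hco.1).congr' ?_
    filter_upwards [eventually_lt_atBot 0] with t ht
    simp only [L, Function.comp]; rw [if_neg (not_le.2 ht), dist_comm]
  have hsurj := hcont.surjective htop hbot
  choose r hr using hsurj
  refine ⟨γ ∘ r, Isometry.of_dist_eq fun a b => ?_⟩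
  rw [Function.comp, Function.comp, ← hLabs, hr, hr, Real.dist_eq]

end top

end

/-- An inversion of a metric space with center `o` and power `κ`, reversing the lines through `o`. -/
structure IsInv {E : Type*} [MetricSpace E] (o : E) (κ : ℝ) (φ : E → E) : Prop where
  invol : Function.Involutive φ
  center : φ o = o
  dist_center : ∀ x, x ≠ o → dist (φ x) o = κ / dist x o
  dist_eq : ∀ x y, x ≠ o → y ≠ o → dist (φ x) (φ y) = κ * (dist x y / (dist x o * dist y o))
  line : ∀ c : ℝ → E, Isometry c → c 0 = o → ∀ t, t ≠ 0 → φ (c t) = c (-(κ / t))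

theorem IsInv.ne {E : Type*} [MetricSpace E] {o : E} {κ : ℝ} {φ : E → E} (h : IsInv o κ φ) {x : E}
    (hx : x ≠ o) : φ x ≠ o := fun e => hx (by rw [← h.invol x, e, h.center])

theorem IsInv.comp_dist {E : Type*} [MetricSpace E] {o : E} {κ κ' : ℝ} {φ φ' : E → E} (hκ : 0 < κ)
    (h : IsInv o κ φ) (h' : IsInv o κ' φ') (x y : E) : dist (φ' (φ x)) (φ' (φ y)) = κ' / κ * dist x y := by
  have aux : ∀ x, x ≠ o → dist (φ' (φ x)) o = κ' / κ * dist x o := fun x hx => by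
    have := dist_pos.2 hx
    rw [h'.dist_center _ (h.ne hx), h.dist_center x hx]; field_simp
  by_cases hx : x = o
  · subst hx
    by_cases hy : y = x
    · subst hy; simp
    · rw [h.center, h'.center, dist_comm, aux y hy, dist_comm]
  by_cases hy : y = o
  · subst hy; rw [h.center, h'.center, aux x hx]
  · have := dist_pos.2 hx
    have := dist_pos.2 hy
    rw [h'.dist_eq _ _ (h.ne hx) (h.ne hy), h.dist_eq x y hx hy, h.dist_center x hx, h.dist_center y hy]
    field_simp

/-- Existence of enough inversions makes an `InvSpace`. -/
theorem invSpace_of_isInv {E : Type*} [MetricSpace E]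
    (ptol : ∀ x y z u : E, dist x z * dist y u ≤ dist x y * dist z u + dist x u * dist y z)
    (hline : ∃ c : ℝ → E, Isometry c)
    (hinv : ∀ (o : E) (r : ℝ), 0 < r → (∃ x, dist x o = r) → ∃ φ : E → E, IsInv o (r ^ 2) φ) : InvSpace E := by
  obtain ⟨c, hc⟩ := hline
  have hom : ∀ (o : E) (r : ℝ), 0 < r → ∃ h : E ≃ E, (∀ z w, dist (h z) (h w) = r * dist z w) ∧ h o = o ∧
      ∀ c : ℝ → E, Isometry c → c 0 = o → ∀ t, h (c t) = c (r * t) := by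
    intro o l hl
    have big : ∀ r, dist (c 0) o < r → ∃ x, dist x o = r := by
      intro r hr
      have hcont : Continuous fun t => dist (c t) o := hc.continuous.dist continuous_const
      have h2 : r ≤ dist (c (2 * r)) o := by
        have h3 := dist_triangle (c (2 * r)) o (c 0)
        have h5 : dist (c 0) o = dist o (c 0) := dist_comm _ _
        have h4 : 0 < r := lt_of_le_of_lt dist_nonneg hr
        rw [hc.dist_eq, Real.dist_eq, sub_zero, abs_of_pos (by linarith)] at h3
        linarith
      have h4 : 0 < r := lt_of_le_of_lt dist_nonneg hr
      obtain ⟨t, -, ht⟩ := intermediate_value_Icc (by linarith : (0:ℝ) ≤ 2 * r) hcont.continuousOn ⟨hr.le, h2⟩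
      exact ⟨_, ht⟩
    set R := dist (c 0) o + 1
    have hR : 0 < R := by positivity
    have hs : 0 < √l := Real.sqrt_pos.2 hl
    have h1 : R ≤ R * (1 + 1 / √l) := by
      have : 0 < R * (1 / √l) := by positivity
      linarith
    have h2 : R ≤ R * (1 + √l) := by nlinarith
    obtain ⟨φ, hφ⟩ := hinv o (R * (1 + 1 / √l)) (by positivity) (big _ (by linarith [h1, lt_add_one (dist (c 0) o)]))
    obtain ⟨φ', hφ'⟩ := hinv o (R * (1 + √l)) (by positivity) (big _ (by linarith [h2, lt_add_one (dist (c 0) o)]))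
    have hratio : (R * (1 + √l)) ^ 2 / (R * (1 + 1 / √l)) ^ 2 = l := by
      have hl' : √l * √l = l := Real.mul_self_sqrt hl.le
      have : R * (1 + √l) = √l * (R * (1 + 1 / √l)) := by field_simp; ring
      rw [this, mul_pow, pow_two, hl', mul_div_assoc, div_self (by positivity), mul_one]
    refine ⟨hφ.invol.toPerm.trans hφ'.invol.toPerm, fun z w => ?_, ?_, fun m hm hm0 t => ?_⟩
    · have := hφ.comp_dist (by positivity) hφ' z w
      rw [hratio] at this
      exact this
    · show φ' (φ o) = o
      rw [hφ.center, hφ'.center]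
    · show φ' (φ (m t)) = _
      rcases eq_or_ne t 0 with rfl | ht
      · rw [hm0, hφ.center, hφ'.center, mul_zero, hm0]
      · rw [hφ.line m hm hm0 t ht, hφ'.line m hm hm0]
        · congr 1
          have aux : ∀ κ κ' : ℝ, 0 < κ → -(κ' / -(κ / t)) = κ' / κ * t := fun κ κ' hκ => by field_simp
          rw [aux _ _ (by positivity), hratio]
        · rw [neg_ne_zero]; positivity
  refine ⟨ptol, hom, ⟨c, hc⟩, fun o => ?_⟩
  have hx : ∃ x, dist x o = 1 := by
    have : ∃ x, x ≠ o := by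
      by_contra hcon
      push Not at hcon
      exact zero_ne_one (hc.injective ((hcon (c 0)).trans (hcon (c 1)).symm))
    obtain ⟨x, hx⟩ := this
    have hp := dist_pos.2 hx
    obtain ⟨h, h1, h2, -⟩ := hom o (dist x o)⁻¹ (inv_pos.2 hp)
    refine ⟨h x, ?_⟩
    have := h1 x o
    rwa [h2, inv_mul_cancel₀ hp.ne'] at this
  obtain ⟨φ, hφ⟩ := hinv o 1 one_pos hx
  refine ⟨φ, fun x hx => ⟨hφ.ne hx, hφ.invol x, ?_⟩, fun x y hx hy => ?_, fun c hc h0 t ht => ?_⟩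
  · rw [hφ.dist_center x hx]; simp
  · rw [hφ.dist_eq x y hx hy]; simp
  · rw [hφ.line c hc h0 t ht]; simp

section

variable {X : Type*} {S : MobiusStructure X} {P : PtData X}
  [T : TopologicalSpace X] (M : Model S P)

include M

theorem Model.exists_similarity {f : X → X} (hf : IsMobiusAuto S f) {a b : X} (hab : f a = b) :
    ∃ k : ℝ, 0 < k ∧ ∃ h : P.Aff a ≃ P.Aff b, (∀ x, (h x).1 = f x.1) ∧ ∀ x y, dist (h x) (h y) = k * dist x y := by
  subst hab
  obtain ⟨k, hk, e⟩ := (M.auto f hf).affDist P.self (fun _ => P.self _) P.symm (fun _ _ => P.symm _ _) P.pos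
    (fun x y h => P.pos _ _ fun e => h (hf.1.1 e)) a
  have hb : Function.Bijective (fun x : P.Aff a => (⟨f x.1, fun e => x.2 (hf.1.1 e)⟩ : P.Aff (f a))) := by
    constructor
    · intro x y hxy
      exact Subtype.ext (hf.1.1 (congrArg Subtype.val hxy))
    · rintro ⟨y, hy⟩
      obtain ⟨x, rfl⟩ := hf.1.2 y
      exact ⟨⟨x, fun e => hy (e ▸ rfl)⟩, rfl⟩
  exact ⟨k, hk, Equiv.ofBijective _ hb, fun _ => rfl, fun x y => e _ _ x.2 y.2⟩

omit M in
theorem metricSphere_affExt (M : Model S P) {o ω : X} (ho : o ≠ ω) {r : ℝ} (hr : 0 < r) :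
    IsMetricSphere S o ω {x | (affExt P ω).d x o = ENNReal.ofReal r} :=
  ⟨affExt P ω, M.mem ω, rfl, ENNReal.ofReal r, ENNReal.ofReal_pos.2 hr, ENNReal.ofReal_ne_top, rfl⟩

theorem Model.exists_swap (hI : PropertyI S) (a b : X) : ∃ f : X → X, IsMobiusAuto S f ∧ f a = b := by
  by_cases hab : a = b
  · subst hab
    exact ⟨id, ⟨Function.bijective_id, fun d hd x y z u ha => ProjEq.refl _⟩, rfl⟩
  obtain ⟨φ, hφ, -⟩ := hI a b hab _ (metricSphere_affExt M hab one_pos)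
  exact ⟨φ, hφ.1, hφ.2.2.2.1⟩

theorem Model.exists_line [CompactSpace X] [T2Space X] (hE : PropertyE S) (hI : PropertyI S) (ω : X) :
    ∃ c : ℝ → P.Aff ω, Isometry c := by
  obtain ⟨σ, hσ⟩ := hE
  have h := hσ.1
  unfold HomeoToCircle at h
  rw [← M.top] at h
  obtain ⟨h⟩ := h
  have p : Metric.sphere (0 : ℂ) 1 := ⟨1, by simp⟩
  obtain ⟨c, hc⟩ := exists_line_of_circle M hσ (h.symm p).2
  obtain ⟨f, hf, e⟩ := M.exists_swap hI (h.symm p).1 ω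
  obtain ⟨k, hk, g, -, hg⟩ := M.exists_similarity hf e
  refine ⟨fun t => g (c (k⁻¹ * t)), Isometry.of_dist_eq fun s t => ?_⟩
  rw [hg, hc.dist_eq, Real.dist_eq, Real.dist_eq, ← mul_sub, abs_mul, abs_of_pos (inv_pos.2 hk),
    ← mul_assoc, mul_inv_cancel₀ hk.ne', one_mul]

theorem Model.exists_isInv [CompactSpace X] [T2Space X] (hI : PropertyI S) {ω : X} (o : P.Aff ω) {r : ℝ}
    (hr : 0 < r) (hne : ∃ x, dist x o = r) : ∃ φ : P.Aff ω → P.Aff ω, IsInv o (r ^ 2) φ := by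
  classical
  obtain ⟨f, ⟨hf, hinv, hfix, hfo, hsph, hcirc⟩, -⟩ := hI o.1 ω o.2 _ (metricSphere_affExt M o.2 hr)
  have hfω : f ω = o.1 := (congrArg f hfo).symm.trans (hinv o.1)
  obtain ⟨k, hk, e⟩ := (M.auto f hf).affDist P.self (fun _ => P.self _) P.symm (fun _ _ => P.symm _ _) P.pos
    (fun x y h => P.pos _ _ fun e => h (hf.1.1 e)) o.1
  have hfne : ∀ x : P.Aff ω, x ≠ o → f x.1 ≠ ω := fun x hx e => hx (Subtype.ext (hf.1.1 (e.trans hfo.symm)))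
  set φ : P.Aff ω → P.Aff ω := fun x => if h : x = o then o else ⟨f x.1, hfne x h⟩
  have hφ : ∀ x, x ≠ o → (φ x).1 = f x.1 := fun x hx => congrArg Subtype.val (dif_neg hx : φ x = _)
  have hφo : φ o = o := dif_pos rfl
  have hφne : ∀ x, x ≠ o → φ x ≠ o := fun x hx h => by
    have : f x.1 = f ω := by rw [← hφ x hx, h, hfω]
    exact x.2 (hf.1.1 this)
  have hφi : Function.Involutive φ := fun x => by
    by_cases hx : x = o
    · subst hx; rw [hφo, hφo]
    · apply Subtype.ext; rw [hφ _ (hφne x hx), hφ x hx, hinv]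
  set κ := k * (P.q o.1 ω ^ 2)⁻¹
  have h1 : ∀ x, x ≠ o → dist (φ x) o = κ / dist x o := by
    intro x hx
    have hx' : x.1 ≠ o.1 := fun h => hx (Subtype.ext h)
    have := e x.1 ω hx' o.2.symm
    beta_reduce at this
    simp only [P.dist_def, hφ x hx]
    unfold affDist at this ⊢
    beta_reduce at this
    rw [hfo, hfω] at this
    rw [this]
    have p1 := P.pos _ _ hx'
    have p2 := P.pos _ _ x.2
    have p3 := P.pos _ _ o.2
    rw [P.symm ω o.1]
    simp only [κ]
    field_simp
  have h2 : ∀ x y, x ≠ o → y ≠ o → dist (φ x) (φ y) = κ * (dist x y / (dist x o * dist y o)) := by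
    intro x y hx hy
    have hx' : x.1 ≠ o.1 := fun h => hx (Subtype.ext h)
    have hy' : y.1 ≠ o.1 := fun h => hy (Subtype.ext h)
    have := e x.1 y.1 hx' hy'
    beta_reduce at this
    simp only [P.dist_def, hφ x hx, hφ y hy]
    rw [P.affDist_change x.2 y.2 o.2 hx' hy'] at this
    simp only [κ]
    rw [mul_assoc, ← this]
    unfold affDist
    beta_reduce
    rw [hfo]
  have hmem : ∀ x : P.Aff ω, dist x o = r ↔ (affExt P ω).d x.1 o.1 = ENNReal.ofReal r := fun x => by
    rw [affExt_d P x.2 o.2, ENNReal.ofReal_eq_ofReal_iff (show 0 ≤ affDist P.q ω x.1 o.1 from dist_nonneg (x := x) (y := o)) hr.le]; rfl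
  have hκ : κ = r ^ 2 := by
    obtain ⟨x, hx⟩ := hne
    have hxo : x ≠ o := fun h => by rw [h, dist_self] at hx; exact hr.ne hx
    have : f x.1 ∈ {x | (affExt P ω).d x o.1 = ENNReal.ofReal r} := by
      rw [← hsph]; exact ⟨x.1, (hmem x).1 hx, rfl⟩
    rw [← hφ x hxo] at this
    have h3 := (hmem (φ x)).2 this
    rw [h1 x hxo, hx] at h3
    field_simp at h3
    exact h3
  rw [hκ] at h1 h2
  refine ⟨φ, hφi, hφo, h1, h2, ?_⟩
  intro c hc hc0 t ht
  have hcne : ∀ t, t ≠ 0 → c t ≠ o := fun t ht h => ht (hc.injective (h.trans hc0.symm))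
  have hdo : ∀ t, dist (c t) o = |t| := fun t => by rw [← hc0, hc.dist_eq, Real.dist_eq, sub_zero]
  have hex : ∀ t, t ≠ 0 → ∃ s, φ (c t) = c s := by
    intro t ht
    have h3 := hcirc _ (isPtolemyCircle_of_line M hc) (Or.inr ⟨0, congrArg Subtype.val hc0⟩) (Or.inl rfl)
    have : f (c t).1 ∈ insert ω (Set.range (P.val ω ∘ c)) := by
      rw [← h3]; exact ⟨_, Or.inr ⟨t, rfl⟩, rfl⟩
    rcases this with h4 | ⟨s, h4⟩
    · exact absurd h4 (hfne _ (hcne t ht))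
    · exact ⟨s, Subtype.ext ((hφ _ (hcne t ht)).trans h4.symm)⟩
  have hr1 : φ (c r) = c (-r) := by
    obtain ⟨s, hs⟩ := hex r hr.ne'
    have h3 := h1 _ (hcne r hr.ne')
    rw [hs, hdo, hdo, abs_of_pos hr] at h3
    have h4 : |s| = |r| := by rw [h3, abs_of_pos hr]; field_simp
    rcases abs_eq_abs.1 h4 with rfl | rfl
    · exfalso
      have := hφ _ (hcne s hr.ne')
      rw [hs] at this
      exact hfix _ this.symm
    · exact hs
  obtain ⟨s, hs⟩ := hex t ht
  have h3 := h1 _ (hcne t ht)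
  have h4 := h2 _ _ (hcne t ht) (hcne r hr.ne')
  rw [hs, hdo, hdo] at h3
  rw [hs, hr1, hdo, hdo, hc.dist_eq, hc.dist_eq, Real.dist_eq, Real.dist_eq, abs_of_pos hr] at h4
  rw [hs]
  congr 1
  have h5 : |s| = |r ^ 2 / t| := by rw [h3, abs_div, abs_of_pos (by positivity : 0 < r ^ 2)]
  rcases abs_eq_abs.1 h5 with h6 | h6
  · exfalso
    have h7 : |s - -r| = |s - r| := by
      rw [h4, h6]
      have : r ^ 2 / t - r = (r ^ 2 * -(t - r)) / (t * r) := by field_simp; ring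
      rw [this, abs_div, abs_mul, abs_mul, abs_neg, abs_of_pos hr, abs_of_pos (by positivity : 0 < r ^ 2)]
      ring
    have h8 := sq_eq_sq_iff_abs_eq_abs _ _ |>.2 h7
    have h9 : s * r = 0 := by nlinarith
    rcases mul_eq_zero.1 h9 with h | h
    · rw [h] at h6
      have : r ^ 2 / t ≠ 0 := by positivity
      exact this h6.symm
    · exact hr.ne' h
  · exact h6

theorem Model.invSpace [CompactSpace X] [T2Space X] (hE : PropertyE S) (hI : PropertyI S) (ω : X) :
    InvSpace (P.Aff ω) := by
  refine invSpace_of_isInv ?_ (M.exists_line hE hI ω) fun o r hr hne => M.exists_isInv hI o hr hne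
  intro x y z u
  simp only [P.dist_def]
  unfold affDist
  have p1 := P.pos _ _ x.2
  have p2 := P.pos _ _ y.2
  have p3 := P.pos _ _ z.2
  have p4 := P.pos _ _ u.2
  have h := P.ptolemy x.1 y.1 z.1 u.1
  have e : P.q x.1 z.1 / (P.q x.1 ω * P.q z.1 ω) * (P.q y.1 u.1 / (P.q y.1 ω * P.q u.1 ω)) =
    (P.q x.1 z.1 * P.q y.1 u.1) / (P.q x.1 ω * P.q y.1 ω * P.q z.1 ω * P.q u.1 ω) := by field_simp
  have e' : P.q x.1 y.1 / (P.q x.1 ω * P.q y.1 ω) * (P.q z.1 u.1 / (P.q z.1 ω * P.q u.1 ω)) +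
    P.q x.1 u.1 / (P.q x.1 ω * P.q u.1 ω) * (P.q y.1 z.1 / (P.q y.1 ω * P.q z.1 ω)) =
    (P.q x.1 y.1 * P.q z.1 u.1 + P.q x.1 u.1 * P.q y.1 z.1) / (P.q x.1 ω * P.q y.1 ω * P.q z.1 ω * P.q u.1 ω) := by
    field_simp
  rw [e, e']
  gcongr

end

section

variable {X : Type*} {P : PtData X}

theorem PtData.dist_remote (P : PtData X) {a b : X} (hab : a ≠ b) {x : X} (hxa : x ≠ a) (hxb : x ≠ b) :
    affDist P.q a x b = (P.q b a ^ 2)⁻¹ / affDist P.q b x a := by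
  have := P.pos _ _ hxa
  have := P.pos _ _ hxb
  have := P.pos _ _ hab
  unfold affDist
  rw [P.symm a b] at *
  field_simp

theorem exists_line_swap {a b : X} (hab : a ≠ b) {c : ℝ → P.Aff a} (hc : Isometry c) (h0 : (c 0).1 = b) :
    ∃ l : ℝ → P.Aff b, Isometry l ∧ (l 0).1 = a ∧ ∀ s, s ≠ 0 → (l s).1 = (c ((P.q b a ^ 2)⁻¹ / s)).1 := by
  classical
  set k := (P.q b a ^ 2)⁻¹ with hk
  have hkp : 0 < k := by have := P.pos _ _ hab.symm; positivity
  have hne : ∀ s, s ≠ 0 → (c s).1 ≠ b := fun s hs e =>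
    hs (hc.injective (Subtype.ext (e.trans h0.symm)))
  have hne' : ∀ s, s ≠ 0 → (c (k / s)).1 ≠ b := fun s hs => hne _ (by positivity)
  have hcb : ∀ s, affDist P.q a (c s).1 b = |s| := fun s => by
    have : dist (c s) (c 0) = |s| := by rw [hc.dist_eq, Real.dist_eq, sub_zero]
    rw [← this, P.dist_def, h0]
  set l : ℝ → P.Aff b := fun s => if h : s = 0 then ⟨a, hab⟩ else ⟨(c (k / s)).1, hne' s h⟩
  have l0 : l 0 = ⟨a, hab⟩ := dif_pos rfl
  have ls : ∀ s, s ≠ 0 → (l s).1 = (c (k / s)).1 := fun s hs => congrArg Subtype.val (dif_neg hs : l s = _)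
  have dl : ∀ s, s ≠ 0 → dist (l s) (l 0) = |s| := fun s hs => by
    rw [P.dist_def, ls s hs, l0, P.dist_remote hab.symm (hne' s hs) (c _).2, hcb, P.symm a b, ← hk, abs_div,
      abs_of_pos hkp]
    field_simp
  refine ⟨l, Isometry.of_dist_eq fun s t => ?_, congrArg Subtype.val l0, ls⟩
  by_cases hs : s = 0
  · by_cases ht : t = 0
    · rw [hs, ht]; simp
    · rw [hs, dist_comm, dl t ht, dist_comm, Real.dist_eq, sub_zero]
  by_cases ht : t = 0
  · rw [ht, dl s hs, Real.dist_eq, sub_zero]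
  · rw [P.dist_def, ls s hs, ls t ht, P.affDist_change (c _).2 (c _).2 hab.symm (hne' s hs) (hne' t ht), hcb, hcb,
      ← P.dist_def, hc.dist_eq, Real.dist_eq, Real.dist_eq, ← hk, abs_div, abs_div, abs_of_pos hkp]
    have : k / s - k / t = -(k / (s * t) * (s - t)) := by field_simp; ring
    rw [this, abs_neg, abs_mul, abs_div, abs_mul, abs_of_pos hkp]
    have := abs_pos.2 hs
    have := abs_pos.2 ht
    field_simp

variable {S : MobiusStructure X} [T : TopologicalSpace X] [CompactSpace X] [T2Space X]

/-- A set is Ptolemy-convex if it contains every Ptolemy line through two of its points. -/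
def PConvex (P : PtData X) (C : Set X) : Prop :=
  ∀ a ∈ C, ∀ a' ∈ C, a ≠ a' → ∀ τ : ℝ → P.Aff a, Isometry τ → (τ 0).1 = a' → ∀ t, (τ t).1 ∈ C

theorem eq_univ_of_pConvex (M : Model S P) (hV : ∀ a, InvSpace (P.Aff a)) {C : Set X} (hC : IsClosed C)
    (hP : PConvex P C) {a₀ a₁ : X} (h0 : a₀ ∈ C) (h1 : a₁ ∈ C) (h01 : a₀ ≠ a₁) : C = Set.univ := by
  haveI := hV
  haveI := M.proper
  by_contra hne
  obtain ⟨p, hp⟩ := (Set.ne_univ_iff_exists_notMem C).1 hne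
  have hCp : IsCompact (P.val p ⁻¹' C) := by
    rw [(M.emb p).isInducing.isCompact_preimage_iff]
    · exact hC.isCompact
    · rw [range_val]
      intro x hx e
      exact hp (e ▸ hx)
  have hnep : ∀ {x}, x ∈ C → x ≠ p := fun hx e => hp (e ▸ hx)
  obtain ⟨c, hc⟩ := InvSpace.exists_line (E := P.Aff p)
  obtain ⟨a, haC, hamin⟩ := hCp.exists_isMinOn ⟨⟨a₀, hnep h0⟩, h0⟩ (continuous_bus hc).continuousOn
  obtain ⟨l, hl, hl0, hsl⟩ := exists_parallel hc a
  have hbl : ∀ s, bus c (l s) = bus c a - s := fun s => by rw [bus_affine hc hl, hl0, hsl, mul_one]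
  obtain ⟨m, hm, hm0, hml⟩ := exists_line_swap (P := P) a.2.symm hl (congrArg Subtype.val hl0)
  set k := (P.q a.1 p ^ 2)⁻¹ with hk
  have hkp : 0 < k := by have := P.pos _ _ a.2; positivity
  obtain ⟨a', ha', haa'⟩ : ∃ a' ∈ C, a' ≠ a.1 := by
    by_cases h : a₀ = a.1
    · exact ⟨a₁, h1, fun e => h01 (h.trans e.symm)⟩
    · exact ⟨a₀, h0, h⟩
  obtain ⟨τ, hτ, hτ0, hsτ⟩ := exists_parallel hm ⟨a', haa'⟩
  have hτC : ∀ t, (τ t).1 ∈ C := hP a.1 haC a' ha' haa'.symm τ hτ (congrArg Subtype.val hτ0)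
  set r := bus m (τ 0)
  have hsh := isometry_shift hτ r
  have hb : ∀ s, bus m (τ s) = r - s := fun s => by rw [bus_affine hm hτ, hsτ, mul_one]
  have key := tendsto_parallel_dist hm hsh
    (by unfold slope; rw [hb, hb]; ring) (by rw [hb]; ring)
  set R := dist (τ r) (m 0) with hR
  have hgr : ∀ᶠ n : ℕ in UF, ((n : ℝ) + 1)⁻¹ * dist (m (n + 1)) (τ (n + 1 + r)) < 1 / 2 :=
    key.eventually (gt_mem_nhds (by norm_num))
  have hbig : ∀ᶠ n : ℕ in UF, 2 * R < (n : ℝ) + 1 :=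
    UF_le ((tendsto_natCast_atTop_atTop (R := ℝ)).eventually_gt_atTop (2 * R) |>.mono fun n hn => by
      linarith [hn])
  obtain ⟨n, hn1, hn2⟩ := (hgr.and hbig).exists
  set N : ℝ := (n : ℝ) + 1
  have hN : 0 < N := by positivity
  rw [inv_mul_lt_iff₀ hN] at hn1
  have hmN : (m N).1 ≠ p := by rw [hml N hN.ne']; exact (l _).2
  have hτN : (τ (N + r)).1 ≠ p := hnep (hτC _)
  have e1 : bus c (⟨(m N).1, hmN⟩ : P.Aff p) = bus c a - k / N := by
    rw [← hbl]; congr 1; exact Subtype.ext (hml N hN.ne')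
  have e2 : bus c a ≤ bus c (⟨(τ (N + r)).1, hτN⟩ : P.Aff p) := hamin (hτC _)
  have e3 := (abs_le.1 (abs_bus_sub_le hc (⟨(m N).1, hmN⟩ : P.Aff p) ⟨(τ (N + r)).1, hτN⟩)).1
  have e0 : dist (α := P.Aff p) ⟨(m N).1, hmN⟩ ⟨(τ (N + r)).1, hτN⟩ =
      k * (dist (m N) (τ (N + r)) / (dist (m N) (m 0) * dist (τ (N + r)) (m 0))) := by
    have := P.affDist_change (m N).2 (τ (N + r)).2 a.2.symm hmN hτN
    rw [P.symm p, ← hk] at this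
    refine this.trans ?_
    rw [P.dist_def, P.dist_def, P.dist_def, hm0]
  rw [e1, e0] at e3
  have e4 : dist (m N) (m 0) = N := by rw [hm.dist_eq, Real.dist_eq, sub_zero, abs_of_pos hN]
  have e5 : N - R ≤ dist (τ (N + r)) (m 0) := by
    have := dist_triangle (τ (N + r)) (m 0) (τ r)
    rw [hτ.dist_eq, Real.dist_eq, add_sub_cancel_right, abs_of_pos hN, dist_comm (m 0)] at this
    linarith
  rw [e4] at e3
  have e6 : k / N ≤ k * (dist (m N) (τ (N + r)) / (N * dist (τ (N + r)) (m 0))) := by linarith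
  have e7 : 0 < dist (τ (N + r)) (m 0) := by linarith
  have e8 : k / N * dist (τ (N + r)) (m 0) ≤ k / N * dist (m N) (τ (N + r)) := by
    calc _ ≤ k * (dist (m N) (τ (N + r)) / (N * dist (τ (N + r)) (m 0))) * dist (τ (N + r)) (m 0) := by gcongr
      _ = _ := by field_simp
  have e9 := le_of_mul_le_mul_left e8 (by positivity)
  linarith

theorem eq_refl_of_isShift (M : Model S P) (hV : ∀ a, InvSpace (P.Aff a)) {ω : X} (g : P.Aff ω ≃ᵢ P.Aff ω)
    (hg : IsShift g) {o : P.Aff ω} (ho : g o = o) (x : P.Aff ω) : g x = x := by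
  haveI := hV
  haveI := M.proper
  have hbg : ∀ c : ℝ → P.Aff ω, Isometry c → ∀ z, bus c (g z) = bus c z := fun c hc z => by
    have := hg c hc z o
    rw [ho, sub_self] at this
    linarith
  have hline : ∀ c : ℝ → P.Aff ω, Isometry c → g (c 0) = c 0 → ∀ t, g (c t) = c t := fun c hc h t => by
    have := parallel_unique hc (g.isometry.comp hc) (by
      unfold slope
      simp only [Function.comp_apply, hbg c hc]
      exact slope_self hc) h.symm
    exact (congrFun this t).symm
  set C : Set X := insert ω (P.val ω '' {x | g x = x}) with hCdef
  have hmem : ∀ x : P.Aff ω, x.1 ∈ C ↔ g x = x := fun x => by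
    constructor
    · rintro (h | ⟨y, hy, e⟩)
      · exact absurd h x.2
      · have : y = x := Subtype.ext e
        rw [← this]; exact hy
    · intro h; exact Or.inr ⟨x, h, rfl⟩
  have hCc : IsClosed C := by
    have : C = (P.val ω '' {x | g x = x}ᶜ)ᶜ := by
      ext y
      by_cases hy : y = ω
      · subst hy
        simp only [Set.mem_compl_iff, Set.mem_image, not_exists, not_and, hCdef, Set.mem_insert_iff, true_or, true_iff]
        intro x _ e
        exact x.2 e
      · refine (hmem ⟨y, hy⟩).trans ?_
        constructor
        · rintro h ⟨z, hz, e⟩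
          have : z = ⟨y, hy⟩ := Subtype.ext e
          exact hz (this ▸ h)
        · intro h
          by_contra h'
          exact h ⟨_, h', rfl⟩
    rw [this, isClosed_compl_iff]
    exact (M.emb ω).isOpenMap _ (isClosed_eq g.continuous continuous_id).isOpen_compl
  have hωC : ω ∈ C := Or.inl rfl
  have hPC : PConvex P C := by
    intro a ha a' ha' haa' τ hτ hτ0 t
    by_cases haω : a = ω
    · subst haω
      rw [hmem]
      exact hline τ hτ ((hmem (τ 0)).1 (by rw [hτ0]; exact ha')) t
    have hga : g ⟨a, haω⟩ = ⟨a, haω⟩ := (hmem ⟨a, haω⟩).1 ha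
    have hgne : ∀ x : P.Aff ω, x.1 ≠ a → (g x).1 ≠ a := fun x hx e => hx (by
      have : g x = g ⟨a, haω⟩ := by rw [hga]; exact Subtype.ext e
      exact congrArg Subtype.val (g.injective this))
    have hgna : ∀ x : P.Aff ω, affDist P.q ω (g x).1 a = affDist P.q ω x.1 a := fun x => by
      have := g.dist_eq x ⟨a, haω⟩
      rw [hga] at this
      exact this
    classical
    let j : P.Aff a → P.Aff a := fun x =>
      if h : x.1 = ω then x else ⟨(g ⟨x.1, h⟩).1, hgne ⟨x.1, h⟩ x.2⟩
    have jω : ∀ x : P.Aff a, x.1 = ω → j x = x := fun x hx => dif_pos hx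
    have jn : ∀ (x : P.Aff a) (h : x.1 ≠ ω), (j x).1 = (g ⟨x.1, h⟩).1 := fun x h =>
      congrArg Subtype.val (dif_neg h : j x = _)
    have jrem : ∀ x y : P.Aff a, x.1 ≠ ω → y.1 = ω → dist (j x) (j y) = dist x y := fun x y hx hy => by
      rw [jω y hy, P.dist_def, P.dist_def, jn x hx, hy]
      refine (P.dist_remote haω (hgne ⟨x.1, hx⟩ x.2) (g _).2).trans ?_
      rw [P.dist_remote haω x.2 hx]
      exact congrArg _ (hgna ⟨x.1, hx⟩)
    have jiso : Isometry j := Isometry.of_dist_eq fun x y => by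
      by_cases hx : x.1 = ω
      · by_cases hy : y.1 = ω
        · rw [jω x hx, jω y hy]
        · rw [dist_comm, jrem y x hy hx, dist_comm]
      by_cases hy : y.1 = ω
      · exact jrem x y hx hy
      rw [P.dist_def, P.dist_def, jn x hx, jn y hy]
      refine (P.affDist_change (g _).2 (g _).2 haω (hgne ⟨x.1, hx⟩ x.2) (hgne ⟨y.1, hy⟩ y.2)).trans ?_
      rw [P.affDist_change hx hy haω x.2 y.2]
      exact congrArg _ (congrArg₂ _ (g.dist_eq ⟨x.1, hx⟩ ⟨y.1, hy⟩)
        (congrArg₂ _ (hgna ⟨x.1, hx⟩) (hgna ⟨y.1, hy⟩)))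
    have jsurj : Function.Surjective j := fun y => by
      by_cases hy : y.1 = ω
      · exact ⟨y, jω y hy⟩
      · have hne : (g.symm ⟨y.1, hy⟩).1 ≠ a := fun e => y.2 (by
          have : g.symm ⟨y.1, hy⟩ = ⟨a, haω⟩ := Subtype.ext e
          exact congrArg Subtype.val ((g.symm_apply_eq.1 this).trans hga))
        refine ⟨⟨(g.symm ⟨y.1, hy⟩).1, hne⟩, Subtype.ext ?_⟩
        refine (jn ⟨_, hne⟩ (g.symm ⟨y.1, hy⟩).2).trans ?_
        exact congrArg Subtype.val (g.apply_symm_apply ⟨y.1, hy⟩)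
    let J : P.Aff a ≃ᵢ P.Aff a := ⟨Equiv.ofBijective j ⟨jiso.injective, jsurj⟩, jiso⟩
    have hJ : ∀ x, J x = j x := fun _ => rfl
    have hjC : ∀ x : P.Aff a, j x = x ↔ x.1 ∈ C := fun x => by
      by_cases hx : x.1 = ω
      · exact ⟨fun _ => hx ▸ hωC, fun _ => jω x hx⟩
      · have h2 := hmem ⟨x.1, hx⟩
        rw [show x.1 ∈ C ↔ g ⟨x.1, hx⟩ = ⟨x.1, hx⟩ from h2]
        constructor
        · intro e
          exact Subtype.ext ((jn x hx).symm.trans (congrArg Subtype.val e))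
        · intro e
          exact Subtype.ext ((jn x hx).trans (congrArg Subtype.val e))
    obtain ⟨m, hm, hm0, hsm⟩ := exists_parallel hτ ⟨ω, fun e => haω e.symm⟩
    obtain ⟨l, hl, hl0, hlm⟩ := exists_line_swap (P := P) haω hm (congrArg Subtype.val hm0)
    have hkp : 0 < (P.q ω a ^ 2)⁻¹ := by have := P.pos _ _ (Ne.symm haω); positivity
    have hl0' : l 0 = ⟨a, haω⟩ := Subtype.ext hl0
    have hlC : ∀ t, (l t).1 ∈ C := fun t => (hmem _).2 (hline l hl (by rw [hl0', hga]) t)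
    have hmC : ∀ t, J (m t) = m t := fun t => by
      rw [hJ, hjC]
      by_cases ht : t = 0
      · rw [ht, hm0]; exact hωC
      · have := hlm ((P.q ω a ^ 2)⁻¹ / t) (by positivity)
        rw [div_div_cancel₀ hkp.ne'] at this
        rw [← this]; exact hlC _
    have hbm : ∀ x, bus m (J x) = bus m x := fun x => by
      have := bus_isometryEquiv (c := m) J x
      simpa only [hmC] using this
    have hbτ : ∀ x, bus τ (J x) = bus τ x := fun x => by
      have h2 := hbm x
      rw [bus_parallel hτ hm hsm, bus_parallel hτ hm hsm] at h2
      linarith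
    have hJτ := parallel_unique hτ (J.isometry.comp hτ) (by
      unfold slope
      simp only [Function.comp_apply, hbτ]
      exact slope_self hτ) (by
        show τ 0 = j (τ 0)
        exact ((hjC _).2 (by rw [hτ0]; exact ha')).symm)
    exact (hjC _).1 (congrFun hJτ t).symm
  have huniv := eq_univ_of_pConvex M hV hCc hPC hωC ((hmem o).2 ho) o.2.symm
  exact (hmem x).1 (huniv ▸ Set.mem_univ _)

end

open scoped Pointwise

/-- A one-parameter group of dilations by automorphisms of a group with a left-invariant metric. -/
structure Dil (G : Type*) [Group G] [MetricSpace G] where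
  δ : ℝ → G →* G
  dist_mul_left : ∀ a b c : G, dist (a * b) (a * c) = dist b c
  dist_δ : ∀ l, 0 < l → ∀ x y, dist (δ l x) (δ l y) = l * dist x y
  δ_δ : ∀ l m, 0 < l → 0 < m → ∀ x, δ l (δ m x) = δ (l * m) x
  δ_one : ∀ x, δ 1 x = x
  cont : ∀ x, ContinuousOn (fun l => δ l x) (Set.Ioi 0)

namespace Dil

section

variable {G : Type*} [Group G] [MetricSpace G] (D : Dil G)

include D

theorem dist_one (x y : G) : dist x y = dist (x⁻¹ * y) 1 := by
  rw [← D.dist_mul_left x⁻¹ x y, inv_mul_cancel, dist_comm]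

theorem nm_inv (x : G) : dist x⁻¹ 1 = dist x 1 := by
  rw [← D.dist_mul_left x, mul_inv_cancel, mul_one, dist_comm]

theorem nm_mul_le (x y : G) : dist (x * y) 1 ≤ dist x 1 + dist y 1 := by
  have := dist_triangle (x * y) x 1
  have h : dist (x * y) x = dist y 1 := by
    conv_lhs => rw [← mul_one x]
    rw [mul_assoc, one_mul, D.dist_mul_left]
  linarith

theorem nm_δ {l : ℝ} (hl : 0 < l) (x : G) : dist (D.δ l x) 1 = l * dist x 1 := by
  rw [← D.dist_δ l hl, map_one]

theorem δ_δ_inv {l : ℝ} (hl : 0 < l) (x : G) : D.δ l (D.δ l⁻¹ x) = x := by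
  rw [D.δ_δ _ _ hl (inv_pos.2 hl), mul_inv_cancel₀ hl.ne', D.δ_one]

theorem continuous_δ {l : ℝ} (hl : 0 < l) : Continuous (D.δ l) :=
  (LipschitzWith.of_dist_le_mul (K := ⟨l, hl.le⟩) fun x y => (D.dist_δ l hl x y).le).continuous

theorem δ_closedBall {l r : ℝ} (hl : 0 < l) {x : G} (hx : x ∈ Metric.closedBall (1 : G) r) :
    D.δ l x ∈ Metric.closedBall (1 : G) (l * r) := by
  rw [Metric.mem_closedBall] at *
  rw [D.nm_δ hl]
  gcongr

theorem eq_top_of_ball [IsTopologicalGroup G] (K : Subgroup G) {r : ℝ} (hr : 0 < r)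
    (h : Metric.closedBall (1 : G) r ⊆ K) : K = ⊤ := by
  have hopen : IsOpen (K : Set G) := K.isOpen_of_mem_nhds (g := 1)
    (mem_of_superset (Metric.closedBall_mem_nhds _ hr) h)
  have hclopen : IsClopen (K : Set G) := ⟨K.isClosed_of_isOpen hopen, hopen⟩
  rw [eq_top_iff]
  intro x _
  have hpre : IsPreconnected ((fun l => D.δ l x) '' Set.Ioi 0) := isPreconnected_Ioi.image _ (D.cont x)
  have hs : 0 < r / (dist x 1 + 1) := by positivity
  refine hpre.subset_isClopen hclopen ⟨D.δ (r / (dist x 1 + 1)) x, ⟨_, hs, rfl⟩, h ?_⟩ ⟨1, Set.mem_Ioi.2 one_pos, D.δ_one x⟩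
  rw [Metric.mem_closedBall, D.nm_δ hs, div_mul_eq_mul_div, div_le_iff₀ (by positivity)]
  nlinarith

variable [ProperSpace G] [IsTopologicalGroup G]

omit D [ProperSpace G] [IsTopologicalGroup G] in
theorem one_mem_closedBall : (1 : G) ∈ Metric.closedBall (1 : G) 1 := Metric.mem_closedBall_self zero_le_one

omit [ProperSpace G] [IsTopologicalGroup G] in
theorem pow_subset_closedBall (m : ℕ) :
    Metric.closedBall (1 : G) 1 ^ m ⊆ Metric.closedBall (1 : G) m := by
  induction m with
  | zero => simp
  | succ n ih =>
    rw [pow_succ]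
    rintro _ ⟨x, hx, y, hy, rfl⟩
    have := ih hx
    rw [Metric.mem_closedBall] at *
    push_cast
    linarith [D.nm_mul_le x y]

omit D [ProperSpace G] [IsTopologicalGroup G] in
theorem pow_mono {m n : ℕ} (h : m ≤ n) : Metric.closedBall (1 : G) 1 ^ m ⊆ Metric.closedBall (1 : G) 1 ^ n :=
  Set.pow_subset_pow_right one_mem_closedBall h

theorem isCompact_pow (m : ℕ) : IsCompact (Metric.closedBall (1 : G) 1 ^ m) := by
  induction m with
  | zero => rw [pow_zero]; exact isCompact_singleton
  | succ n ih => rw [pow_succ]; exact ih.mul (isCompact_closedBall _ _)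

omit [ProperSpace G] [IsTopologicalGroup G] in
theorem inv_mem_pow {m : ℕ} {x : G} (hx : x ∈ Metric.closedBall (1 : G) 1 ^ m) :
    x⁻¹ ∈ Metric.closedBall (1 : G) 1 ^ m := by
  have h : (Metric.closedBall (1 : G) 1)⁻¹ = Metric.closedBall 1 1 := by
    ext y
    rw [Set.mem_inv, Metric.mem_closedBall, D.nm_inv, Metric.mem_closedBall]
  rw [← h, inv_pow, Set.mem_inv, inv_inv]
  exact hx

theorem exists_mem_pow (x : G) : ∃ m : ℕ, x ∈ Metric.closedBall (1 : G) 1 ^ m := by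
  let K : Subgroup G :=
    { carrier := {x | ∃ m : ℕ, x ∈ Metric.closedBall (1 : G) 1 ^ m}
      mul_mem' := by
        rintro a b ⟨m, hm⟩ ⟨n, hn⟩
        exact ⟨m + n, by rw [pow_add]; exact Set.mul_mem_mul hm hn⟩
      one_mem' := ⟨0, by simp⟩
      inv_mem' := by
        rintro a ⟨m, hm⟩
        exact ⟨m, D.inv_mem_pow hm⟩ }
  have : K = ⊤ := D.eq_top_of_ball K one_pos fun y hy => ⟨1, by simpa using hy⟩
  exact (this ▸ Subgroup.mem_top x : x ∈ K)

theorem isCompact_subset_pow {C : Set G} (hC : IsCompact C) : ∃ m : ℕ, C ⊆ Metric.closedBall (1 : G) 1 ^ m := by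
  have hcov : C ⊆ ⋃ m : ℕ, interior (Metric.closedBall (1 : G) 1 ^ m) := fun x _ => by
    obtain ⟨m, hm⟩ := D.exists_mem_pow x
    rw [Set.mem_iUnion]
    refine ⟨m + 1, mem_interior_iff_mem_nhds.2 ?_⟩
    rw [pow_succ]
    have : (x • Metric.closedBall (1 : G) 1) ∈ 𝓝 x := by
      have h2 := smul_mem_nhds_smul x (Metric.closedBall_mem_nhds (1 : G) one_pos)
      rwa [smul_eq_mul, mul_one] at h2
    refine mem_of_superset this ?_
    rintro _ ⟨y, hy, rfl⟩
    exact Set.mul_mem_mul hm hy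
  obtain ⟨m, hm⟩ := hC.elim_directed_cover _ (fun _ => isOpen_interior) hcov
    (directed_of_isDirected_le fun m n h => interior_mono (pow_mono h))
  exact ⟨m, hm.trans interior_subset⟩

theorem exists_growth : ∃ m : ℕ, 1 ≤ m ∧ ∀ i : ℕ,
    Metric.closedBall (1 : G) (2 ^ i) ⊆ Metric.closedBall (1 : G) 1 ^ (m ^ i) := by
  obtain ⟨m, hm⟩ := D.isCompact_subset_pow (isCompact_closedBall (1 : G) 2)
  refine ⟨m + 1, by omega, fun i => ?_⟩
  induction i with
  | zero => simp
  | succ i ih =>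
    intro x hx
    have hp : (0 : ℝ) < 2 ^ i := by positivity
    have h1 : D.δ (2 ^ i)⁻¹ x ∈ Metric.closedBall (1 : G) 1 ^ (m + 1) := by
      refine pow_mono (Nat.le_succ m) (hm ?_)
      have := D.δ_closedBall (inv_pos.2 hp) hx
      rwa [pow_succ, inv_mul_cancel_left₀ hp.ne'] at this
    have h2 : x ∈ (D.δ (2 ^ i)) '' (Metric.closedBall (1 : G) 1 ^ (m + 1)) := ⟨_, h1, D.δ_δ_inv hp x⟩
    rw [Set.image_pow] at h2
    have h3 : (D.δ (2 ^ i)) '' (Metric.closedBall (1 : G) 1) ⊆ Metric.closedBall (1 : G) 1 ^ (m + 1) ^ i := by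
      rintro _ ⟨y, hy, rfl⟩
      apply ih
      simpa using D.δ_closedBall hp hy
    have h4 := Set.pow_subset_pow_left (n := m + 1) h3 h2
    rwa [← pow_mul, ← pow_succ] at h4

theorem exists_cover : ∃ N : ℕ, 1 ≤ N ∧ ∀ i : ℕ, ∃ F : Finset G, F.card ≤ N ^ i ∧
    Metric.closedBall (1 : G) (2 ^ i) ⊆ ⋃ f ∈ F, Metric.closedBall f 1 := by
  classical
  obtain ⟨t, -, ht, hcov⟩ := (isCompact_closedBall (1 : G) 2).finite_cover_balls (e := 1) one_pos
  set F := ht.toFinset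
  have hF : Metric.closedBall (1 : G) 2 ⊆ ⋃ f ∈ F, Metric.closedBall f 1 := by
    intro x hx
    obtain ⟨f, hf, hxf⟩ := Set.mem_iUnion₂.1 (hcov hx)
    exact Set.mem_iUnion₂.2 ⟨f, by simpa [F] using hf, Metric.ball_subset_closedBall hxf⟩
  refine ⟨F.card + 1, by omega, fun i => ?_⟩
  induction i with
  | zero => exact ⟨{1}, by simp, by simp⟩
  | succ i ih =>
    obtain ⟨F', hc, hF'⟩ := ih
    have hp : (0 : ℝ) < 2 ^ i := by positivity
    refine ⟨(F ×ˢ F').image fun p => D.δ (2 ^ i) p.1 * p.2, ?_, fun x hx => ?_⟩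
    · refine Finset.card_image_le.trans ?_
      rw [Finset.card_product, pow_succ, mul_comm]
      exact Nat.mul_le_mul hc (Nat.le_succ _)
    · have h1 := D.δ_closedBall (inv_pos.2 hp) hx
      rw [pow_succ, inv_mul_cancel_left₀ hp.ne'] at h1
      obtain ⟨f, hf, hxf⟩ := Set.mem_iUnion₂.1 (hF h1)
      have h2 : (D.δ (2 ^ i) f)⁻¹ * x ∈ Metric.closedBall (1 : G) (2 ^ i) := by
        rw [Metric.mem_closedBall, ← D.dist_one, dist_comm]
        have := D.dist_δ _ hp (D.δ (2 ^ i)⁻¹ x) f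
        rw [D.δ_δ_inv hp] at this
        rw [this]
        have := Metric.mem_closedBall.1 hxf
        nlinarith
      obtain ⟨f', hf', hxf'⟩ := Set.mem_iUnion₂.1 (hF' h2)
      refine Set.mem_iUnion₂.2 ⟨D.δ (2 ^ i) f * f', Finset.mem_image.2 ⟨(f, f'), Finset.mem_product.2 ⟨hf, hf'⟩, rfl⟩, ?_⟩
      rw [Metric.mem_closedBall] at hxf' ⊢
      rw [← D.dist_mul_left (D.δ (2 ^ i) f)] at hxf'
      rwa [mul_inv_cancel_left] at hxf'

end

end Dil

namespace Dil

open MeasureTheory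

section

variable {G : Type*} [Group G] [MetricSpace G] (D : Dil G) [ProperSpace G] [IsTopologicalGroup G]

open Classical in
/-- The word length with respect to the closed unit ball. -/
noncomputable def len (x : G) : ℕ := Nat.find (D.exists_mem_pow x)

theorem len_le {x : G} {m : ℕ} : D.len x ≤ m ↔ x ∈ Metric.closedBall (1 : G) 1 ^ m := by
  classical
  unfold len
  rw [Nat.find_le_iff]
  constructor
  · rintro ⟨k, hk, h⟩
    exact pow_mono hk h
  · intro h
    exact ⟨m, le_rfl, h⟩

theorem len_mul (x y : G) : D.len (x * y) ≤ D.len x + D.len y := by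
  rw [D.len_le, pow_add]
  exact Set.mul_mem_mul (D.len_le.1 le_rfl) (D.len_le.1 le_rfl)

theorem len_inv (x : G) : D.len x⁻¹ ≤ D.len x := by
  rw [D.len_le]
  exact D.inv_mem_pow (D.len_le.1 le_rfl)

/-- The tent function of the word length. -/
noncomputable def tent (m : ℕ) (x : G) : ℝ := ((m - D.len x : ℕ) : ℝ)

theorem tent_sub {m b : ℕ} {g : G} (hg : D.len g ≤ b) (y : G) :
    |D.tent m (g⁻¹ * y) - D.tent m y| ≤ b := by
  have h1 := D.len_mul g⁻¹ y
  have h2 := D.len_mul g (g⁻¹ * y)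
  have h3 := D.len_inv g
  rw [mul_inv_cancel_left] at h2
  unfold tent
  rw [abs_le]
  constructor
  · rw [neg_le_sub_iff_le_add]; exact_mod_cast (by omega)
  · rw [sub_le_iff_le_add]; exact_mod_cast (by omega)

/-- The radial cutoff function. -/
noncomputable def cut (r : ℝ) (x : G) : ℝ := max 0 (min 1 (2 - dist x 1 / r))

omit D [ProperSpace G] [IsTopologicalGroup G] in
theorem continuous_cut (r : ℝ) : Continuous (cut r : G → ℝ) := by
  unfold cut
  fun_prop

omit D [ProperSpace G] [IsTopologicalGroup G] in
theorem cut_mem (r : ℝ) (x : G) : 0 ≤ cut r x ∧ cut r x ≤ 1 := by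
  unfold cut
  exact ⟨le_max_left _ _, max_le zero_le_one (min_le_left _ _)⟩

omit D [ProperSpace G] [IsTopologicalGroup G] in
theorem cut_sub {r : ℝ} (hr : 0 < r) (x y : G) : |cut r x - cut r y| ≤ |dist x 1 - dist y 1| / r := by
  have key : ∀ a b : ℝ, |max 0 (min 1 a) - max 0 (min 1 b)| ≤ |a - b| := fun a b => by
    have h1 := abs_max_sub_max_le_max 0 (min 1 a) 0 (min 1 b)
    have h2 := abs_min_sub_min_le_max 1 a 1 b
    rw [sub_self, abs_zero, max_eq_right (abs_nonneg (min 1 a - min 1 b))] at h1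
    rw [sub_self, abs_zero, max_eq_right (abs_nonneg (a - b))] at h2
    exact h1.trans h2
  refine (key _ _).trans ?_
  rw [sub_sub_sub_cancel_left, ← sub_div, abs_div, abs_of_pos hr, abs_sub_comm]

variable [MeasurableSpace G] [BorelSpace G] 

theorem measurable_tent (m : ℕ) : Measurable (D.tent m) := by
  have : Measurable D.len := by
    refine measurable_of_Iic fun n => ?_
    have : D.len ⁻¹' Set.Iic n = Metric.closedBall (1 : G) 1 ^ n := by
      ext x
      exact D.len_le
    rw [this]
    exact (D.isCompact_pow n).isClosed.measurableSet
  exact (Measurable.of_discrete (f := fun k : ℕ => ((m - k : ℕ) : ℝ))).comp this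

variable (μ : Measure G) [μ.IsHaarMeasure]

theorem integrable_of_bound {F : G → ℝ} (hF : Measurable F) {k : ℕ} {C : ℝ}
    (h : ∀ y, |F y| ≤ C) (h0 : ∀ y, k < D.len y → F y = 0) :
    Integrable F μ ∧ |∫ y, F y ∂μ| ≤ C * μ.real (Metric.closedBall (1 : G) 1 ^ k) := by
  have hc := D.isCompact_pow k
  have hb : ∀ y, ‖F y‖ ≤ (Metric.closedBall (1 : G) 1 ^ k).indicator (fun _ => C) y := by
    intro y
    by_cases hy : y ∈ Metric.closedBall (1 : G) 1 ^ k
    · rw [Set.indicator_of_mem hy]; exact h y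
    · rw [Set.indicator_of_notMem hy, h0 y (by rw [← not_le, D.len_le]; exact hy), norm_zero]
  have hi : Integrable ((Metric.closedBall (1 : G) 1 ^ k).indicator fun _ => C) μ :=
    (integrable_indicator_iff hc.isClosed.measurableSet).2 (integrableOn_const hc.measure_lt_top.ne)
  refine ⟨hi.mono' hF.aestronglyMeasurable (ae_of_all _ hb), ?_⟩
  have := norm_integral_le_of_norm_le hi (ae_of_all _ hb)
  rw [integral_indicator_const _ hc.isClosed.measurableSet] at this
  simpa [mul_comm] using this

/-- The convolution of the tent function with the radial cutoff. -/
noncomputable def conv (m : ℕ) (r : ℝ) (x : G) : ℝ := ∫ y, D.tent m y * cut r (y⁻¹ * x) ∂μ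

theorem measurable_cut_inv (r : ℝ) (x : G) : Measurable fun y : G => cut r (y⁻¹ * x) :=
  ((continuous_cut r).comp (by fun_prop)).measurable

theorem tent_eq_zero {m : ℕ} {y : G} (h : m < D.len y) : D.tent m y = 0 := by
  unfold tent
  rw [Nat.sub_eq_zero_of_le h.le, Nat.cast_zero]

theorem integrable_conv (m : ℕ) (r : ℝ) (x : G) :
    Integrable (fun y => D.tent m y * cut r (y⁻¹ * x)) μ := by
  refine (D.integrable_of_bound μ ((D.measurable_tent m).mul (measurable_cut_inv r x)) (k := m) (C := m) ?_ ?_).1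
  · intro y
    have := cut_mem r (y⁻¹ * x)
    have h0 : (0 : ℝ) ≤ D.tent m y := Nat.cast_nonneg _
    have h1 : D.tent m y ≤ m := Nat.cast_le.2 (Nat.sub_le _ _)
    simp only [Pi.mul_apply]
    rw [abs_of_nonneg (mul_nonneg h0 this.1)]
    nlinarith
  · intro y hy
    simp only [Pi.mul_apply]
    rw [D.tent_eq_zero hy, zero_mul]

theorem conv_sub (m : ℕ) (r : ℝ) (g x : G) :
    D.conv μ m r (g⁻¹ * x) - D.conv μ m r x =
      ∫ y, (D.tent m (g⁻¹ * y) - D.tent m y) * cut r (y⁻¹ * x) ∂μ ∧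
    Integrable (fun y => (D.tent m (g⁻¹ * y) - D.tent m y) * cut r (y⁻¹ * x)) μ := by
  have h1 : D.conv μ m r (g⁻¹ * x) = ∫ y, D.tent m (g⁻¹ * y) * cut r (y⁻¹ * x) ∂μ := by
    unfold conv
    rw [← integral_mul_left_eq_self _ g⁻¹]
    simp only [mul_inv_rev, inv_inv, mul_assoc, mul_inv_cancel_left]
  have h2 : Integrable (fun y => D.tent m (g⁻¹ * y) * cut r (y⁻¹ * x)) μ := by
    have := (D.integrable_conv μ m r (g⁻¹ * x)).comp_mul_left g⁻¹
    simpa only [mul_inv_rev, inv_inv, mul_assoc, mul_inv_cancel_left] using this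
  simp only [sub_mul]
  rw [h1]
  exact ⟨(integral_sub h2 (D.integrable_conv μ m r x)).symm, h2.sub (D.integrable_conv μ m r x)⟩

theorem conv_sub_sub {m b : ℕ} {r s : ℝ} (hr : 0 < r) {g h : G} (hg : D.len g ≤ b)
    (hs : ∀ y : G, D.len y ≤ m + b → dist (y⁻¹ * h * y) 1 ≤ s * r) (x : G) :
    |(D.conv μ m r (g⁻¹ * (h⁻¹ * x)) - D.conv μ m r (h⁻¹ * x)) - (D.conv μ m r (g⁻¹ * x) - D.conv μ m r x)|
      ≤ b * s * μ.real (Metric.closedBall (1 : G) 1 ^ (m + b)) := by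
  have hs0 : 0 ≤ s := by
    have := hs 1 (D.len_le.2 (pow_mono (Nat.zero_le _) (by simp)))
    nlinarith [this.trans' dist_nonneg]
  rw [(D.conv_sub μ m r g (h⁻¹ * x)).1, (D.conv_sub μ m r g x).1,
    ← integral_sub (D.conv_sub μ m r g (h⁻¹ * x)).2 (D.conv_sub μ m r g x).2]
  have key : ∀ y, m + b < D.len y → D.tent m (g⁻¹ * y) - D.tent m y = 0 := by
    intro y hy
    have h2 := D.len_mul g (g⁻¹ * y)
    rw [mul_inv_cancel_left] at h2
    rw [D.tent_eq_zero (by omega), D.tent_eq_zero (by omega), sub_zero]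
  refine (D.integrable_of_bound μ ?_ (k := m + b) ?_ ?_).2
  · exact ((((D.measurable_tent m).comp (measurable_const_mul _)).sub (D.measurable_tent m)).mul
      (measurable_cut_inv r _)).sub ((((D.measurable_tent m).comp (measurable_const_mul _)).sub
      (D.measurable_tent m)).mul (measurable_cut_inv r x))
  · intro y
    rw [← mul_sub, abs_mul]
    by_cases hy : m + b < D.len y
    · rw [key y hy, abs_zero, zero_mul]
      positivity
    · refine mul_le_mul (D.tent_sub hg y) ?_ (abs_nonneg _) (Nat.cast_nonneg _)
      refine (cut_sub hr _ _).trans ?_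
      rw [div_le_iff₀ hr]
      have h0 := hs y (not_lt.1 hy)
      have h1 := D.nm_mul_le (y⁻¹ * h * y) (y⁻¹ * (h⁻¹ * x))
      have h2 := D.nm_mul_le (y⁻¹ * h * y)⁻¹ (y⁻¹ * x)
      have e1 : y⁻¹ * h * y * (y⁻¹ * (h⁻¹ * x)) = y⁻¹ * x := by group
      have e2 : (y⁻¹ * h * y)⁻¹ * (y⁻¹ * x) = y⁻¹ * (h⁻¹ * x) := by group
      rw [e1] at h1
      rw [e2, D.nm_inv] at h2
      rw [abs_le]
      constructor <;> linarith
  · intro y hy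
    rw [key y hy]
    simp

theorem exists_almost_hom {n c : ℕ} (hn : 1 ≤ n) (hc : 4 ≤ c) {r C : ℝ} (hr : 0 < r)
    (hU : ∀ x : G, D.len x ≤ 2 * n → dist x 1 ≤ r) {x₁ : G} (hx : D.len x₁ ≤ c * n) (hx' : 3 * r ≤ dist x₁ 1)
    (hv : μ.real (Metric.closedBall (1 : G) 1 ^ (c * n)) ≤ C * μ.real (Metric.closedBall (1 : G) 1 ^ n)) :
    ∃ β : G → ℝ, (∀ g, |β g| ≤ D.len g) ∧
      (∀ b ≤ 2 * n, ∀ g h, D.len h ≤ b → ∀ s, (∀ y : G, D.len y ≤ 4 * n → dist (y⁻¹ * g * y) 1 ≤ s * r) →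
        |β (g * h) - β g - β h| ≤ b * C * c * s) ∧
      ∃ g, D.len g ≤ 1 ∧ 1 / 2 ≤ |β g| := by
  set f := D.conv μ (2 * n) r with hf
  set v := μ.real (Metric.closedBall (1 : G) 1 ^ n) with hv'
  have hvpos : 0 < v := by
    refine ENNReal.toReal_pos ?_ (D.isCompact_pow n).measure_lt_top.ne
    refine (lt_of_lt_of_le ?_ (measure_mono (pow_mono hn))).ne'
    rw [pow_one]
    exact Metric.measure_closedBall_pos μ 1 one_pos
  have hbd : ∀ x, |f x| ≤ (2 * n : ℕ) * μ.real (Metric.closedBall (1 : G) 1 ^ (2 * n)) := fun x => by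
    refine (D.integrable_of_bound μ ((D.measurable_tent _).mul (measurable_cut_inv r x)) ?_ ?_).2
    · intro y
      have := cut_mem r (y⁻¹ * x)
      have h0 : (0 : ℝ) ≤ D.tent (2 * n) y := Nat.cast_nonneg _
      have h1 : D.tent (2 * n) y ≤ (2 * n : ℕ) := Nat.cast_le.2 (Nat.sub_le _ _)
      simp only [Pi.mul_apply]
      rw [abs_of_nonneg (mul_nonneg h0 this.1)]
      nlinarith
    · intro y hy
      simp only [Pi.mul_apply]
      rw [D.tent_eq_zero hy, zero_mul]
  set M := (2 * n : ℕ) * μ.real (Metric.closedBall (1 : G) 1 ^ (2 * n)) with hM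
  set T : Set ℝ := {t | ∃ g x, D.len g ≤ 1 ∧ t = |f (g⁻¹ * x) - f x|} with hT
  have hTne : T.Nonempty := ⟨_, 1, 1, D.len_le.2 (by rw [pow_one]; exact one_mem_closedBall), rfl⟩
  have hTb : BddAbove T := by
    refine ⟨M + M, ?_⟩
    rintro _ ⟨g, x, -, rfl⟩
    exact (abs_sub _ _).trans (add_le_add (hbd _) (hbd _))
  set e := sSup T with he
  have he1 : ∀ g x, D.len g ≤ 1 → |f (g⁻¹ * x) - f x| ≤ e := fun g x hg => le_csSup hTb ⟨g, x, hg, rfl⟩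
  have he2 : ∀ b : ℕ, ∀ g x, D.len g ≤ b → |f (g⁻¹ * x) - f x| ≤ b * e := by
    intro b
    induction b with
    | zero =>
      intro g x hg
      have : g = 1 := by simpa using D.len_le.1 hg
      simp [this]
    | succ b ih =>
      intro g x hg
      have h1 := D.len_le.1 hg
      rw [pow_succ] at h1
      obtain ⟨g', hg', u, hu, rfl⟩ := h1
      have h2 := ih g' x (D.len_le.2 hg')
      have h3 := he1 u (g'⁻¹ * x) (D.len_le.2 (by rwa [pow_one]))
      have h4 : (g' * u)⁻¹ * x = u⁻¹ * (g'⁻¹ * x) := by group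
      simp only
      rw [h4]
      push_cast
      have := abs_sub_le (f (u⁻¹ * (g'⁻¹ * x))) (f (g'⁻¹ * x)) (f x)
      linarith
  have hf1 : n * v ≤ f 1 := by
    have hc := D.isCompact_pow n
    have hi : Integrable ((Metric.closedBall (1 : G) 1 ^ n).indicator fun _ => (n : ℝ)) μ :=
      (integrable_indicator_iff hc.isClosed.measurableSet).2 (integrableOn_const hc.measure_lt_top.ne)
    have := integral_mono hi (D.integrable_conv μ (2 * n) r 1) ?_
    · rwa [integral_indicator_const _ hc.isClosed.measurableSet, smul_eq_mul, mul_comm] at this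
    · intro y
      simp only [mul_one]
      have h0 : (0 : ℝ) ≤ D.tent (2 * n) y := Nat.cast_nonneg _
      by_cases hy : y ∈ Metric.closedBall (1 : G) 1 ^ n
      · rw [Set.indicator_of_mem hy]
        have h1 := D.len_le.2 hy
        have h2 : cut r y⁻¹ = 1 := by
          have : dist y⁻¹ 1 / r ≤ 1 := by
            rw [div_le_one hr, D.nm_inv]
            exact hU y (by omega)
          unfold cut
          rw [min_eq_left (by linarith), max_eq_right zero_le_one]
        rw [h2, mul_one]
        exact Nat.cast_le.2 (by omega)
      · rw [Set.indicator_of_notMem hy]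
        exact mul_nonneg h0 (cut_mem _ _).1
  have hf2 : f x₁ = 0 := by
    have : ∀ y, D.tent (2 * n) y * cut r (y⁻¹ * x₁) = 0 := by
      intro y
      by_cases hy : 2 * n < D.len y
      · rw [D.tent_eq_zero hy, zero_mul]
      · have h1 := D.nm_mul_le y (y⁻¹ * x₁)
        have h2 := hU y (not_lt.1 hy)
        rw [mul_inv_cancel_left] at h1
        have h3 : 2 ≤ dist (y⁻¹ * x₁) 1 / r := by
          rw [le_div_iff₀ hr]
          linarith
        have h4 : cut r (y⁻¹ * x₁) = 0 := by
          unfold cut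
          exact max_eq_left ((min_le_right _ _).trans (by linarith))
        rw [h4, mul_zero]
    rw [hf]
    simp only [conv, this, integral_zero]
  have hn' : (0 : ℝ) < n := by exact_mod_cast hn
  have hc' : (0 : ℝ) < c := by exact_mod_cast (by omega : 0 < c)
  have hve : v ≤ c * e := by
    have h1 := he2 (c * n) x₁⁻¹ 1 ((D.len_inv _).trans hx)
    rw [inv_inv, mul_one, hf2, zero_sub, abs_neg] at h1
    have h2 := hf1.trans ((le_abs_self _).trans h1)
    push_cast at h2
    refine le_of_mul_le_mul_left ?_ hn'
    linarith
  have hepos : 0 < e := by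
    by_contra h
    nlinarith
  obtain ⟨_, ⟨g₀, x₀, hg₀, rfl⟩, ht⟩ := exists_lt_of_lt_csSup hTne (half_lt_self hepos)
  have hC : 0 ≤ C := by
    have h1 : 0 ≤ C * v := le_trans measureReal_nonneg hv
    exact nonneg_of_mul_nonneg_left h1 hvpos
  refine ⟨fun g => (f (g⁻¹ * x₀) - f x₀) / e, fun g => ?_, ?_, g₀, hg₀, ?_⟩
  · rw [abs_div, abs_of_pos hepos, div_le_iff₀ hepos]
    exact he2 _ g x₀ le_rfl
  · intro b hb g h hh s hs
    have h1 := D.conv_sub_sub μ (m := 2 * n) (b := b) hr hh (s := s) (fun y hy => hs y (by omega)) x₀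
    rw [← hf] at h1
    have hs0 : 0 ≤ s := by
      have := hs 1 (D.len_le.2 (pow_mono (Nat.zero_le _) (by simp)))
      nlinarith [this.trans' dist_nonneg]
    have e1 : (g * h)⁻¹ * x₀ = h⁻¹ * (g⁻¹ * x₀) := by group
    simp only
    rw [e1, ← sub_div, ← sub_div, abs_div, abs_of_pos hepos, div_le_iff₀ hepos]
    have e2 : f (h⁻¹ * (g⁻¹ * x₀)) - f x₀ - (f (g⁻¹ * x₀) - f x₀) - (f (h⁻¹ * x₀) - f x₀) =
      f (h⁻¹ * (g⁻¹ * x₀)) - f (g⁻¹ * x₀) - (f (h⁻¹ * x₀) - f x₀) := by ring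
    rw [e2]
    refine h1.trans ?_
    have h2 : μ.real (Metric.closedBall (1 : G) 1 ^ (2 * n + b)) ≤ C * (c * e) := by
      refine (measureReal_mono (pow_mono ?_) (D.isCompact_pow _).measure_lt_top.ne).trans (hv.trans ?_)
      · nlinarith
      · gcongr
    calc _ ≤ b * s * (C * (c * e)) := by gcongr
      _ = _ := by ring
  · rw [abs_div, abs_of_pos hepos, le_div_iff₀ hepos]
    linarith

end

end Dil

theorem exists_jump {ρ v : ℕ → ℝ} {c v₀ : ℝ} {L : ℕ} (hc : 1 ≤ c) (hL : 1 ≤ L) (hρ : ∀ j, 32 ^ j ≤ ρ j)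
    (hρ' : ∀ j, ρ (j + 1) ≤ c * ρ j) (hv0 : ∀ j, 0 < v j) (hv : ∀ j, v j ≤ v₀ * (2 ^ L) ^ j)
    (hvm : ∀ j, v j ≤ v (j + 1)) (J : ℕ) :
    ∃ j ≥ J, 8 * ρ j ≤ ρ (j + 1) ∧ v (j + 1) ≤ c ^ L * v j := by
  by_contra! hcon
  have hρ0 : ∀ j, 0 < ρ j := fun j => lt_of_lt_of_le (by positivity) (hρ j)
  have hv₀ : 0 < v₀ := by simpa using (hv0 0).trans_le (hv 0)
  have hstep : ∀ j ≥ J, ρ (j + 1) ^ L * v j ≤ 8 ^ L * (ρ j ^ L * v (j + 1)) := by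
    intro j hj
    rcases le_or_gt (8 * ρ j) (ρ (j + 1)) with h | h
    · have h1 := hcon j hj h
      have h2 : ρ (j + 1) ^ L ≤ (c * ρ j) ^ L := pow_le_pow_left₀ (hρ0 _).le (hρ' j) L
      have h3 : (1 : ℝ) ≤ 8 ^ L := one_le_pow₀ (by norm_num)
      have h4 : 0 < ρ j ^ L := pow_pos (hρ0 j) L
      calc ρ (j + 1) ^ L * v j ≤ (c * ρ j) ^ L * v j := by have := (hv0 j).le; gcongr
        _ = ρ j ^ L * (c ^ L * v j) := by rw [mul_pow]; ring
        _ ≤ ρ j ^ L * v (j + 1) := by gcongr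
        _ ≤ _ := le_mul_of_one_le_left (mul_pos h4 (hv0 _)).le h3
    · have h2 : ρ (j + 1) ^ L ≤ (8 * ρ j) ^ L := pow_le_pow_left₀ (hρ0 _).le h.le L
      calc ρ (j + 1) ^ L * v j ≤ (8 * ρ j) ^ L * v (j + 1) :=
            mul_le_mul h2 (hvm j) (hv0 j).le (by have := hρ0 j; positivity)
        _ = _ := by rw [mul_pow]; ring
  have hiter : ∀ i, ρ (J + i) ^ L * v J ≤ (8 ^ L) ^ i * (ρ J ^ L * v (J + i)) := by
    intro i
    induction i with
    | zero => simp
    | succ i ih =>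
      have h1 := hstep (J + i) (by omega)
      have h2 := hv0 (J + i)
      refine le_of_mul_le_mul_right ?_ h2
      calc ρ (J + (i + 1)) ^ L * v J * v (J + i) = (ρ (J + i + 1) ^ L * v (J + i)) * v J := by
            rw [← add_assoc]; ring
        _ ≤ 8 ^ L * (ρ (J + i) ^ L * v (J + i + 1)) * v J := by
            have := (hv0 J).le; gcongr
        _ = 8 ^ L * v (J + i + 1) * (ρ (J + i) ^ L * v J) := by ring
        _ ≤ 8 ^ L * v (J + i + 1) * ((8 ^ L) ^ i * (ρ J ^ L * v (J + i))) := by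
            have := (hv0 (J + i + 1)).le; gcongr
        _ = _ := by rw [← add_assoc]; ring
  have hfin : ∀ i : ℕ, (2 : ℝ) ^ i ≤ ρ J ^ L * v₀ * (2 ^ L) ^ J / v J := by
    intro i
    rw [le_div_iff₀ (hv0 J)]
    have h1 := hiter i
    have h2 : ((32 : ℝ) ^ (J + i)) ^ L ≤ ρ (J + i) ^ L := pow_le_pow_left₀ (by positivity) (hρ _) L
    have h3 := hv (J + i)
    have h4 : (2 : ℝ) ^ i ≤ (2 ^ L) ^ i := pow_le_pow_left₀ (by norm_num) (by
      calc (2 : ℝ) = 2 ^ 1 := by norm_num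
        _ ≤ 2 ^ L := pow_le_pow_right₀ (by norm_num) hL) i
    have hJ := hv0 J
    have hρJ := pow_pos (hρ0 J) L
    have h5 : ((8 : ℝ) ^ L) ^ i * ((2 ^ L) ^ i * (2 ^ i * v J)) ≤ (8 ^ L) ^ i * ((2 ^ L) ^ i * (ρ J ^ L * v₀ * (2 ^ L) ^ J)) := by
      calc ((8 : ℝ) ^ L) ^ i * ((2 ^ L) ^ i * (2 ^ i * v J)) ≤ ((8 : ℝ) ^ L) ^ i * ((2 ^ L) ^ i * ((2 ^ L) ^ i * v J)) := by gcongr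
        _ = ((32 : ℝ) ^ i) ^ L * v J := by
            rw [show (32 : ℝ) = 8 * 2 * 2 by norm_num, mul_pow, mul_pow, mul_pow, mul_pow]
            simp only [← pow_mul, mul_comm L i]
            ring
        _ ≤ ((32 : ℝ) ^ (J + i)) ^ L * v J := by
            gcongr
            · norm_num
            · omega
        _ ≤ _ := by gcongr
        _ ≤ _ := h1
        _ ≤ (8 ^ L) ^ i * (ρ J ^ L * (v₀ * (2 ^ L) ^ (J + i))) := by gcongr
        _ = _ := by rw [pow_add]; ring
    refine le_of_mul_le_mul_left (le_of_mul_le_mul_left h5 (by positivity)) (by positivity)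
  obtain ⟨i, hi⟩ := pow_unbounded_of_one_lt (ρ J ^ L * v₀ * (2 ^ L) ^ J / v J) (one_lt_two (α := ℝ))
  exact absurd (hfin i) (not_le.2 hi)

namespace Dil

open MeasureTheory

section

variable {G : Type*} [Group G] [MetricSpace G] (D : Dil G) [ProperSpace G] [IsTopologicalGroup G]

include D in
theorem exists_dist_eq [Nontrivial G] {r : ℝ} (hr : 0 < r) : ∃ x : G, dist x 1 = r := by
  obtain ⟨x, hx⟩ := exists_ne (1 : G)
  have h := dist_pos.2 hx
  refine ⟨D.δ (r / dist x 1) x, ?_⟩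
  rw [D.nm_δ (div_pos hr h), div_mul_cancel₀ _ h.ne']

variable [MeasurableSpace G] [BorelSpace G] (μ : Measure G) [μ.IsHaarMeasure]

theorem exists_scale [Nontrivial G] : ∃ c : ℕ, ∃ C : ℝ, 4 ≤ c ∧ ∀ J : ℕ, ∃ n : ℕ, 1 ≤ n ∧ J ≤ n ∧ ∃ r : ℝ, J ≤ r ∧ 0 < r ∧
    (∀ x : G, D.len x ≤ 2 * n → dist x 1 ≤ r) ∧ (∃ x₁ : G, D.len x₁ ≤ c * n ∧ 3 * r ≤ dist x₁ 1) ∧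
    μ.real (Metric.closedBall (1 : G) 1 ^ (c * n)) ≤ C * μ.real (Metric.closedBall (1 : G) 1 ^ n) := by
  obtain ⟨m, hm, hgr⟩ := D.exists_growth
  obtain ⟨N, hN, hcov⟩ := D.exists_cover
  set c := (m + 1) ^ 5 with hc
  have hc4 : 32 ≤ c := by
    calc 32 = 2 ^ 5 := by norm_num
      _ ≤ (m + 1) ^ 5 := Nat.pow_le_pow_left (by omega) 5
  obtain ⟨b, hb⟩ : ∃ b, c ≤ 2 ^ b := ⟨c, Nat.lt_two_pow_self.le⟩
  set L := N ^ b + 1 with hL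
  have hNL : N ^ b ≤ 2 ^ L := (Nat.lt_two_pow_self (n := N ^ b)).le.trans (Nat.pow_le_pow_right (by norm_num) (by omega))
  have hex : ∀ k : ℕ, ∃ x : G, D.len x ≤ k ∧ ∀ y, D.len y ≤ k → dist y 1 ≤ dist x 1 := by
    intro k
    obtain ⟨x, hx, hmax⟩ := (D.isCompact_pow k).exists_isMaxOn (f := fun x => dist x 1)
      ⟨1, pow_mono (Nat.zero_le k) (by simp)⟩ (by fun_prop)
    exact ⟨x, D.len_le.2 hx, fun y hy => hmax (D.len_le.1 hy)⟩
  choose x hx hxm using hex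
  have hmul : ∀ a k : ℕ, dist (x (a * k)) 1 ≤ a * dist (x k) 1 := by
    intro a k
    have : ∀ a : ℕ, ∀ y : G, D.len y ≤ a * k → dist y 1 ≤ a * dist (x k) 1 := by
      intro a
      induction a with
      | zero =>
        intro y hy
        have : y = 1 := by simpa using D.len_le.1 hy
        simp [this]
      | succ a ih =>
        intro y hy
        have h1 := D.len_le.1 hy
        rw [add_mul, one_mul, pow_add] at h1
        obtain ⟨z, hz, u, hu, rfl⟩ := h1
        have h2 := ih z (D.len_le.2 hz)
        have h3 := hxm k u (D.len_le.2 hu)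
        have := D.nm_mul_le z u
        push_cast
        linarith
    exact this a _ (hx _)
  have hgrow : ∀ i : ℕ, (2 : ℝ) ^ i ≤ dist (x ((m + 1) ^ i)) 1 := by
    intro i
    obtain ⟨y, hy⟩ := D.exists_dist_eq (r := 2 ^ i) (by positivity)
    rw [← hy]
    exact hxm _ _ (D.len_le.2 (pow_mono (Nat.pow_le_pow_left (Nat.le_succ m) i) (hgr i hy.le)))
  have hvol : ∀ j, μ.real (Metric.closedBall (1 : G) 1 ^ (c ^ j)) ≤
      μ.real (Metric.closedBall (1 : G) 1) * (2 ^ L) ^ j := by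
    intro j
    obtain ⟨F, hF, hcF⟩ := hcov (b * j)
    have h1 : Metric.closedBall (1 : G) 1 ^ (c ^ j) ⊆ ⋃ f ∈ F, Metric.closedBall f 1 := by
      refine (D.pow_subset_closedBall _).trans ((Metric.closedBall_subset_closedBall ?_).trans hcF)
      rw [pow_mul]
      exact_mod_cast Nat.pow_le_pow_left hb j
    have h2 : ∀ f : G, μ.real (Metric.closedBall f 1) = μ.real (Metric.closedBall (1 : G) 1) := by
      intro f
      have : (fun y => f * y) ⁻¹' Metric.closedBall f 1 = Metric.closedBall 1 1 := by
        ext y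
        rw [Set.mem_preimage, Metric.mem_closedBall, Metric.mem_closedBall, ← D.dist_mul_left f y 1, mul_one]
      rw [← this, measureReal_def, measureReal_def, measure_preimage_mul]
    have hfin : μ (⋃ f ∈ F, Metric.closedBall f 1) ≠ ⊤ :=
      (F.isCompact_biUnion fun f _ => isCompact_closedBall f 1).measure_lt_top.ne
    refine (measureReal_mono h1 hfin).trans ((measureReal_biUnion_finset_le _ _).trans ?_)
    rw [Finset.sum_congr rfl fun f _ => h2 f, Finset.sum_const, nsmul_eq_mul, mul_comm]
    refine mul_le_mul_of_nonneg_left ?_ measureReal_nonneg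
    rw [pow_mul] at hF
    calc (F.card : ℝ) ≤ ((N ^ b) ^ j : ℕ) := by exact_mod_cast hF
      _ ≤ ((2 ^ L) ^ j : ℕ) := by exact_mod_cast Nat.pow_le_pow_left hNL j
      _ = _ := by push_cast; rfl
  have hvpos : ∀ k : ℕ, 1 ≤ k → 0 < μ.real (Metric.closedBall (1 : G) 1 ^ k) := by
    intro k hk
    refine ENNReal.toReal_pos ?_ (D.isCompact_pow k).measure_lt_top.ne
    refine (lt_of_lt_of_le ?_ (measure_mono (pow_mono hk))).ne'
    rw [pow_one]
    exact Metric.measure_closedBall_pos μ 1 one_pos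
  have h32 : ∀ j : ℕ, (32 : ℝ) ^ j ≤ dist (x (c ^ j)) 1 := by
    intro j
    have := hgrow (5 * j)
    rw [pow_mul, pow_mul] at this
    norm_num at this ⊢
    exact this
  refine ⟨c, (c : ℝ) ^ L, by omega, fun J => ?_⟩
  obtain ⟨j, hj, h8, hv⟩ := exists_jump (ρ := fun j => dist (x (c ^ j)) 1)
    (v := fun j => μ.real (Metric.closedBall (1 : G) 1 ^ (c ^ j))) (c := c) (L := L)
    (by exact_mod_cast (by omega : 1 ≤ c)) (by omega) h32 (fun j => by
      rw [pow_succ, mul_comm]; exact hmul c (c ^ j)) (fun j => hvpos _ (Nat.one_le_pow _ _ (by omega))) hvol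
    (fun j => measureReal_mono (pow_mono (Nat.pow_le_pow_right (by omega) (Nat.le_succ j)))
      (D.isCompact_pow _).measure_lt_top.ne) J
  simp only [pow_succ c j, mul_comm _ c] at h8 hv
  have hlow := hxm (2 * c ^ j) (x (c ^ j)) ((hx _).trans (by omega))
  have h2 := hmul 2 (c ^ j)
  push_cast at h2
  have hJ : (J : ℝ) ≤ 32 ^ j := by
    have : j < 32 ^ j := Nat.lt_pow_self (by norm_num)
    exact_mod_cast (by omega : J ≤ 32 ^ j)
  have hJ' : J ≤ c ^ j := by
    have : j < c ^ j := Nat.lt_pow_self (by omega)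
    omega
  have hp : (0 : ℝ) < 32 ^ j := by positivity
  have := h32 j
  exact ⟨c ^ j, Nat.one_le_pow _ _ (by omega), hJ', dist (x (2 * c ^ j)) 1, by linarith, by linarith,
    fun y hy => hxm _ y hy, ⟨_, hx (c * c ^ j), by linarith⟩, hv⟩

end

section

variable {G : Type*} [Group G] [MetricSpace G] (D : Dil G) [ProperSpace G] [IsTopologicalGroup G]

omit [ProperSpace G] in
theorem continuous_of_bounded_hom {β : G → ℝ} (h : ∀ x y, β (x * y) = β x + β y)
    (h1 : ∀ x, dist x 1 ≤ 1 → |β x| ≤ 1) : Continuous β := by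
  let f : G →* Multiplicative ℝ :=
    { toFun := fun x => Multiplicative.ofAdd (β x)
      map_one' := by
        have := h 1 1
        rw [mul_one] at this
        rw [show β 1 = 0 by linarith]
        rfl
      map_mul' := fun x y => by rw [h]; rfl }
  have hpow : ∀ (n : ℕ) x, β (x ^ n) = n * β x := by
    intro n x
    have := congrArg Multiplicative.toAdd (map_pow f x n)
    simpa [f] using this
  have hcont : Continuous f := by
    refine continuous_of_continuousAt_one f ?_
    have h2 : Tendsto β (𝓝 1) (𝓝 (β 1)) := by
      rw [Metric.tendsto_nhds]
      intro ε hε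
      obtain ⟨n, hn⟩ := exists_nat_gt (1 / ε)
      have hn0 : (0 : ℝ) < n := lt_trans (by positivity) hn
      have h3 : Tendsto (fun x : G => dist (x ^ n) 1) (𝓝 1) (𝓝 0) := by
        have : Continuous fun x : G => dist (x ^ n) 1 := by fun_prop
        have h4 := this.tendsto 1
        simpa using h4
      filter_upwards [h3.eventually (gt_mem_nhds one_pos)] with x hx
      have h5 := h1 _ hx.le
      rw [hpow, abs_mul, abs_of_pos hn0] at h5
      have h6 : β 1 = 0 := by have := h 1 1; rw [mul_one] at this; linarith
      rw [h6, Real.dist_eq, sub_zero]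
      rw [div_lt_iff₀ hε] at hn
      by_contra hcon
      rw [not_lt] at hcon
      nlinarith
    exact h2
  exact hcont

include D in
theorem conj_small {s : ℝ} (hs : 0 < s) (i : ℕ) : ∃ R : ℝ, 0 < R ∧ ∀ r ≥ R, ∀ y g : G, dist y 1 ≤ 2 * r → dist g 1 ≤ i →
    dist (y⁻¹ * g * y) 1 ≤ s * r := by
  have hopen : IsOpen {p : G × G | dist (p.1⁻¹ * p.2 * p.1) 1 < s} :=
    isOpen_lt (by fun_prop) continuous_const
  obtain ⟨u, v, -, hv, hu, h1v, huv⟩ := generalized_tube_lemma (isCompact_closedBall (1 : G) 2)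
    (isCompact_singleton (x := (1 : G))) hopen (by
      rintro ⟨z, w⟩ ⟨-, hw⟩
      simp only [Set.mem_singleton_iff] at hw
      simpa [hw] using hs)
  obtain ⟨η, hη, hball⟩ := Metric.isOpen_iff.1 hv 1 (h1v rfl)
  refine ⟨(i + 1) / η, by positivity, fun r hr y g hy hg => ?_⟩
  have hr0 : 0 < r := lt_of_lt_of_le (by positivity) hr
  have hri := inv_pos.2 hr0
  have h1 := huv (Set.mk_mem_prod (a := D.δ r⁻¹ y) (b := D.δ r⁻¹ g) (hu ?_) (hball ?_))
  · simp only [Set.mem_setOf_eq, ← map_inv, ← map_mul] at h1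
    rw [D.nm_δ hri, inv_mul_lt_iff₀ hr0] at h1
    linarith
  · rw [Metric.mem_closedBall, D.nm_δ hri, inv_mul_le_iff₀ hr0]
    linarith
  · rw [Metric.mem_ball, D.nm_δ hri, inv_mul_lt_iff₀ hr0]
    rw [ge_iff_le, div_le_iff₀ hη] at hr
    linarith

include D in
/-- A nontrivial proper group with dilations has a nonzero homomorphism to the reals. -/
theorem exists_hom [Nontrivial G] :
    ∃ β : G → ℝ, Continuous β ∧ (∀ x y, β (x * y) = β x + β y) ∧ ∃ x, β x ≠ 0 := by
  letI : MeasurableSpace G := borel G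
  haveI : BorelSpace G := ⟨rfl⟩
  obtain ⟨c, C, hc, hsc⟩ := D.exists_scale (Measure.haar : Measure G)
  choose n hn hJn r hJr hr hU x₁ hv using hsc
  choose x₁ hx₁ hx₁' using x₁
  have hah := fun J => D.exists_almost_hom (Measure.haar : Measure G) (hn J) hc (hr J) (hU J) (hx₁ J) (hx₁' J) (hv J)
  choose β hβ hβadd g hg hβg using hah
  have hadd : ∀ i : ℕ, ∀ ε > 0, ∀ᶠ J in atTop, ∀ g h, D.len g ≤ i → D.len h ≤ i →
      |β J (g * h) - β J g - β J h| ≤ ε := by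
    intro i ε hε
    have hden : 0 < |i * C * c| + 1 := by positivity
    obtain ⟨R, hR, hconj⟩ := D.conj_small (div_pos hε hden) i
    filter_upwards [eventually_ge_atTop ⌈R⌉₊, eventually_ge_atTop i] with J hJ hJi g h hg hh
    have hrJ : R ≤ r J := (Nat.ceil_le.1 hJ).trans (hJr J)
    refine (hβadd J i (by have := hJn J; omega) g h hh _ fun y hy => hconj (r J) hrJ y g ?_ ?_).trans ?_
    · have h1 := D.len_le.1 hy
      rw [show 4 * n J = 2 * n J + 2 * n J by ring, pow_add] at h1
      obtain ⟨a, ha, b, hb, rfl⟩ := h1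
      have h2 := hU J a (D.len_le.2 ha)
      have h3 := hU J b (D.len_le.2 hb)
      have := D.nm_mul_le a b
      simp only
      linarith
    · exact D.pow_subset_closedBall i (D.len_le.1 hg)
    · rw [mul_div_assoc', div_le_iff₀ hden]
      have := le_abs_self (i * C * c)
      nlinarith
  have hlim : ∀ x, ∃ y, Tendsto (fun J => β J x) UF (𝓝 y) := fun x => by
    obtain ⟨y, -, hy⟩ := exists_UF_lim_of_isCompact (isCompact_Icc (a := -(D.len x : ℝ)) (b := D.len x))
      (x := fun J => β J x) (Eventually.of_forall fun J => abs_le.1 (hβ J x))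
    exact ⟨y, hy⟩
  choose b hb using hlim
  have hlen1 : ∀ x, dist x 1 ≤ 1 → D.len x ≤ 1 := fun x hx => D.len_le.2 (by rwa [pow_one])
  have hbadd : ∀ x y, b (x * y) = b x + b y := by
    intro x y
    have h1 := ((hb (x * y)).sub (hb x)).sub (hb y)
    have h2 : Tendsto (fun J => β J (x * y) - β J x - β J y) UF (𝓝 0) := by
      rw [Metric.tendsto_nhds]
      intro ε hε
      filter_upwards [UF_le (hadd (max (D.len x) (D.len y)) (ε / 2) (half_pos hε))] with J hJ
      rw [Real.dist_eq, sub_zero]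
      have := hJ x y (le_max_left _ _) (le_max_right _ _)
      linarith
    have := tendsto_nhds_unique h1 h2
    linarith
  have hb1 : ∀ x, dist x 1 ≤ 1 → |b x| ≤ 1 := fun x hx =>
    le_of_tendsto (hb x).abs (Eventually.of_forall fun J => (hβ J x).trans (by exact_mod_cast hlen1 x hx))
  refine ⟨b, continuous_of_bounded_hom hbadd hb1, hbadd, ?_⟩
  obtain ⟨g₀, hg₀, hgl⟩ := exists_UF_lim_of_isCompact (isCompact_closedBall (1 : G) 1) (x := g)
    (Eventually.of_forall fun J => by have := D.len_le.1 (hg J); rwa [pow_one] at this)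
  refine ⟨g₀, fun h0 => ?_⟩
  have hg₀' := hlen1 g₀ hg₀
  have hu : Tendsto (fun J => g₀⁻¹ * g J) UF (𝓝 1) := by
    have := hgl.const_mul g₀⁻¹
    rwa [inv_mul_cancel] at this
  have hpw : ∀ᶠ J in UF, ∀ i : ℕ, i ≤ 16 → dist ((g₀⁻¹ * g J) ^ i) 1 ≤ 1 := by
    have : ∀ i ∈ Finset.range 17, ∀ᶠ J in UF, dist ((g₀⁻¹ * g J) ^ i) 1 ≤ 1 := by
      intro i _
      have h1 : Tendsto (fun J => dist ((g₀⁻¹ * g J) ^ i) 1) UF (𝓝 0) := by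
        have := (hu.pow i).dist (tendsto_const_nhds (x := (1 : G)))
        simpa using this
      exact (h1.eventually (gt_mem_nhds one_pos)).mono fun _ h => le_of_lt h
    filter_upwards [(Filter.eventually_all_finset _).2 this] with J hJ i hi
    exact hJ i (Finset.mem_range.2 (by omega))
  have hsmall := (hb g₀).eventually (Metric.ball_mem_nhds _ (show (0 : ℝ) < 1 / 8 by norm_num))
  obtain ⟨J, hJ1, hJ2, hJ3⟩ := (hpw.and (((hadd 1 (1 / 16) (by norm_num)).filter_mono UF_le).and hsmall)).exists
  set u := g₀⁻¹ * g J with hu'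
  have hu1 : D.len u ≤ 1 := hlen1 u (by simpa using hJ1 1 (by norm_num))
  have key : ∀ i : ℕ, i ≤ 16 → |β J (u ^ i) - i * β J u| ≤ i / 16 := by
    intro i hi
    induction i with
    | zero =>
      have h1 := hβ J 1
      have h2 : D.len (1 : G) = 0 := Nat.le_zero.1 (D.len_le.2 (by simp))
      rw [h2] at h1
      simpa using h1
    | succ i ih =>
      have h1 := ih (by omega)
      have h2 := hJ2 (u ^ i) u (hlen1 _ (hJ1 i (by omega))) hu1
      rw [← pow_succ, abs_le] at h2
      rw [abs_le] at h1 ⊢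
      push_cast
      constructor <;> linarith [h1.1, h1.2, h2.1, h2.2]
  have h1 := key 16 le_rfl
  have h2 := (hβ J (u ^ 16)).trans (Nat.cast_le.2 (hlen1 _ (hJ1 16 le_rfl)))
  have h3 := hJ2 g₀ u hg₀' hu1
  rw [hu', mul_inv_cancel_left, ← hu'] at h3
  have h4 := hβg J
  simp only [h0, Metric.mem_ball, Real.dist_eq, sub_zero] at hJ3
  push_cast at h1 h2
  rw [abs_le] at h1 h2 h3
  rw [abs_lt] at hJ3
  rcases le_abs.1 h4 with h | h <;> linarith [h1.1, h1.2, h2.1, h2.2, h3.1, h3.2, hJ3.1, hJ3.2]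

end

end Dil

theorem exists_generator {A : Type*} [NormedRing A] [NormedAlgebra ℝ A] [CompleteSpace A] {T : ℝ → A}
    (hT : Continuous T) (hadd : ∀ s t, T (s + t) = T s * T t) (h0 : T 0 = 1) :
    ∃ a : A, ∀ s, HasStrictDerivAt T (T s * a) s := by
  set F : ℝ → A := fun s => ∫ t in (0 : ℝ)..s, T t with hF
  have hF' : ∀ s, HasStrictDerivAt F (T s) s := fun s => hT.integral_hasStrictDerivAt 0 s
  obtain ⟨ε, hε, hu⟩ : ∃ ε : ℝ, ε ≠ 0 ∧ IsUnit (ε⁻¹ • F ε) := by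
    have h1 := (hF' 0).hasDerivAt.tendsto_slope_zero
    have h2 : F 0 = 0 := by simp [hF]
    simp only [zero_add, h2, sub_zero, h0] at h1
    have h3 : {x : A | IsUnit x} ∈ 𝓝 (1 : A) := Units.isOpen.mem_nhds isUnit_one
    obtain ⟨ε, h4, h5⟩ := ((h1.eventually h3).and self_mem_nhdsWithin).exists
    exact ⟨ε, h5, h4⟩
  obtain ⟨u, hu⟩ := hu
  have hFε : F ε = ε • (u : A) := by rw [hu, smul_inv_smul₀ hε]
  have key : ∀ s, T s = (ε⁻¹ • (F (s + ε) - F s)) * (↑u⁻¹ : A) := by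
    intro s
    have h1 : F (s + ε) - F s = T s * F ε := by
      simp only [hF]
      rw [intervalIntegral.integral_interval_sub_left (hT.intervalIntegrable _ _) (hT.intervalIntegrable _ _),
        ← ContinuousLinearMap.mul_apply' ℝ A (T s), ← ContinuousLinearMap.intervalIntegral_comp_comm _ (hT.intervalIntegrable _ _)]
      simp only [ContinuousLinearMap.mul_apply', ← hadd]
      rw [intervalIntegral.integral_comp_add_left (fun x => T x), add_zero]
    rw [h1, hFε, mul_smul_comm, inv_smul_smul₀ hε, mul_assoc, Units.mul_inv, mul_one]
  refine ⟨ε⁻¹ • (T ε - 1) * (↑u⁻¹ : A), fun s => ?_⟩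
  have h1 : HasStrictDerivAt (fun s => (ε⁻¹ • (F (s + ε) - F s)) * (↑u⁻¹ : A))
      ((ε⁻¹ • (T (s + ε) - T s)) * (↑u⁻¹ : A)) s := by
    have h2 : HasStrictDerivAt (fun s => F (s + ε)) (T (s + ε)) s := by
      have := (hF' (s + ε)).scomp s ((hasStrictDerivAt_id s).add_const ε)
      simpa [Function.comp_def] using this
    exact ((h2.sub (hF' s)).const_smul ε⁻¹).mul_const _
  refine (h1.congr_of_eventuallyEq (Eventually.of_forall fun x => (key x).symm)).congr_deriv ?_
  rw [hadd, ← mul_assoc, mul_smul_comm, mul_sub, mul_one]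

/-- A subgroup of a finite-dimensional space which spans, and is invariant under a contracting
one-parameter group, is a neighbourhood of one of its points. -/
theorem exists_mem_nhds_of_flow {V : Type*} [NormedAddCommGroup V] [NormedSpace ℝ V] [FiniteDimensional ℝ V]
    (I : AddSubgroup V) (hspan : Submodule.span ℝ (I : Set V) = ⊤) {T : ℝ → V →L[ℝ] V}
    (hadd : ∀ s t, T (s + t) = T s * T t) (h0 : T 0 = 1) (hT : ∀ v ∈ I, Continuous fun s => T s v)
    (hlim : ∀ v ∈ I, Tendsto (fun s => T s v) atBot (𝓝 0)) (hI : ∀ s, ∀ v ∈ I, T s v ∈ I) :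
    ∃ v, (I : Set V) ∈ 𝓝 v := by
  have hall : ∀ v : V, v ∈ Submodule.span ℝ (I : Set V) := fun v => hspan ▸ Submodule.mem_top
  have hcont : Continuous T := by
    rw [continuous_clm_apply]
    intro v
    induction hall v using Submodule.span_induction with
    | mem v hv => exact hT v hv
    | zero => simpa using continuous_const
    | add a b _ _ ha hb => simpa using! ha.add hb
    | smul c a _ ha => simpa using! ha.const_smul c
  have hzero : ∀ v, Tendsto (fun s => T s v) atBot (𝓝 0) := by
    intro v
    induction hall v using Submodule.span_induction with
    | mem v hv => exact hlim v hv
    | zero => simpa using tendsto_const_nhds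
    | add a b _ _ ha hb => simpa using! ha.add hb
    | smul c a _ ha => simpa using! ha.const_smul c
  obtain ⟨a, ha⟩ := exists_generator hcont hadd h0
  have hder : ∀ s v, HasStrictDerivAt (fun s => T s v) (T s (a v)) s := fun s v => by
    have := (ha s).clm_apply (hasStrictDerivAt_const s v)
    simpa using this
  have hinj : Function.Injective a := by
    rw [injective_iff_map_eq_zero]
    intro v hv
    have h1 : ∀ s, T s v = T 0 v := fun s =>
      is_const_of_deriv_eq_zero (fun s => (hder s v).hasDerivAt.differentiableAt)
        (fun s => by rw [(hder s v).hasDerivAt.deriv, hv, map_zero]) s 0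
    have h2 := hzero v
    simp only [h1, h0] at h2
    exact tendsto_nhds_unique tendsto_const_nhds h2
  have hsurj : Function.Surjective a := LinearMap.surjective_of_injective (f := (a : V →ₗ[ℝ] V)) hinj
  obtain ⟨ι, _, b, hbI⟩ : ∃ (ι : Type _) (_ : Fintype ι) (b : Module.Basis ι ℝ V), ∀ i, b i ∈ I := by
    let b := Module.Basis.ofSpan hspan.ge
    exact ⟨_, FiniteDimensional.fintypeBasisIndex b, b, fun i => Module.Basis.ofSpan_subset hspan.ge ⟨i, rfl⟩⟩
  have hΦ : HasStrictFDerivAt (fun t : ι → ℝ => ∑ i, T (t i) (b i))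
      (∑ i, (ContinuousLinearMap.toSpanSingleton ℝ (T 0 (a (b i)))).comp (ContinuousLinearMap.proj i)) 0 := by
    refine HasStrictFDerivAt.fun_sum fun i _ => ?_
    exact HasStrictFDerivAt.comp (g := fun s => T s (b i)) (0 : ι → ℝ) (hder 0 (b i)).hasStrictFDerivAt
      (ContinuousLinearMap.proj (R := ℝ) (φ := fun _ : ι => ℝ) i).hasStrictFDerivAt
  have hr : (∑ i, (ContinuousLinearMap.toSpanSingleton ℝ (T 0 (a (b i)))).comp
      (ContinuousLinearMap.proj (R := ℝ) (φ := fun _ : ι => ℝ) i)).range = ⊤ := by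
    refine LinearMap.range_eq_top.2 fun w => ?_
    obtain ⟨u, rfl⟩ := hsurj w
    refine ⟨b.repr u, ?_⟩
    simp only [ContinuousLinearMap.coe_coe, ContinuousLinearMap.sum_apply, ContinuousLinearMap.comp_apply, ContinuousLinearMap.proj_apply,
      ContinuousLinearMap.toSpanSingleton_apply, h0, ContinuousLinearMap.one_apply]
    conv_rhs => rw [← b.sum_repr u, map_sum]
    simp only [map_smul]
  have hm := hΦ.map_nhds_eq_of_surj hr
  refine ⟨_, hm ▸ mem_map.2 (univ_mem' fun t => I.sum_mem fun i _ => hI _ _ (hbI i))⟩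

/-- The space of continuous homomorphisms to the reals. -/
def homSpace (G : Type*) [Group G] [TopologicalSpace G] : Submodule ℝ (G → ℝ) where
  carrier := {β | Continuous β ∧ ∀ x y, β (x * y) = β x + β y}
  add_mem' := fun {a b} ha hb => ⟨ha.1.add hb.1, fun x y => by
    simp only [Pi.add_apply, ha.2, hb.2]; ring⟩
  zero_mem' := ⟨continuous_const, fun x y => by simp⟩
  smul_mem' := fun c a ha => ⟨ha.1.const_smul c, fun x y => by
    simp only [Pi.smul_apply, ha.2, smul_add]⟩

namespace Dil

section

variable {G : Type*} [Group G] [MetricSpace G] (D : Dil G) [ProperSpace G] [IsTopologicalGroup G]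

omit [ProperSpace G] [IsTopologicalGroup G] in
theorem tendsto_δ_one (x : G) : Tendsto (fun s : ℝ => D.δ (Real.exp s) x) atBot (𝓝 1) := by
  rw [tendsto_iff_dist_tendsto_zero]
  simp only [D.nm_δ (Real.exp_pos _)]
  simpa using Real.tendsto_exp_atBot.mul_const (dist x 1)

include D in
theorem finite_homSpace : Module.Finite ℝ (homSpace G) := by
  classical
  obtain ⟨t, -, ht, hcov⟩ := (isCompact_closedBall (1 : G) 2).finite_cover_balls (e := 1) one_pos
  haveI : Fintype t := ht.fintype
  let R : homSpace G →ₗ[ℝ] (t → ℝ) :=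
    { toFun := fun β f => β.1 f.1
      map_add' := fun _ _ => rfl
      map_smul' := fun _ _ => rfl }
  refine Module.Finite.of_injective R ((injective_iff_map_eq_zero R).2 fun β hβ => ?_)
  have h0 : ∀ f ∈ t, β.1 f = 0 := fun f hf => congrFun hβ ⟨f, hf⟩
  have hmul := β.2.2
  obtain ⟨x, hx, hmax⟩ := (isCompact_closedBall (1 : G) 1).exists_isMaxOn (f := fun x => |β.1 x|)
    ⟨1, one_mem_closedBall⟩ β.2.1.abs.continuousOn
  have hx2 : x * x ∈ Metric.closedBall (1 : G) 2 := by
    have := D.nm_mul_le x x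
    rw [Metric.mem_closedBall] at *
    linarith
  obtain ⟨f, hf, hxf⟩ := Set.mem_iUnion₂.1 (hcov hx2)
  have h1 : |β.1 (f⁻¹ * (x * x))| ≤ |β.1 x| := hmax (by
    rw [Metric.mem_closedBall, ← D.dist_one, dist_comm]
    exact (Metric.mem_ball.1 hxf).le)
  have h2 := hmul f (f⁻¹ * (x * x))
  rw [mul_inv_cancel_left, h0 f hf, zero_add, hmul] at h2
  rw [← h2, ← two_mul, abs_mul, abs_two] at h1
  have h3 : |β.1 x| = 0 := by linarith [abs_nonneg (β.1 x)]
  have h4 : ∀ y ∈ Metric.closedBall (1 : G) 1, β.1 y = 0 := fun y hy => by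
    have : |β.1 y| ≤ |β.1 x| := hmax hy
    exact abs_eq_zero.1 (le_antisymm (this.trans h3.le) (abs_nonneg _))
  let K : Subgroup G :=
    { carrier := {y | β.1 y = 0}
      mul_mem' := fun {a b} ha hb => by
        simp only [Set.mem_setOf_eq] at *
        rw [hmul, ha, hb, add_zero]
      one_mem' := h4 1 one_mem_closedBall
      inv_mem' := fun {a} ha => by
        have := hmul a a⁻¹
        simp only [Set.mem_setOf_eq] at *
        rw [mul_inv_cancel, h4 1 one_mem_closedBall, ha, zero_add] at this
        exact this.symm }
  have hK : K = ⊤ := D.eq_top_of_ball K one_pos h4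
  ext y
  exact (hK ▸ Subgroup.mem_top y : y ∈ K)

/-- Precomposition with a dilation. -/
noncomputable def precomp {l : ℝ} (hl : 0 < l) : homSpace G →ₗ[ℝ] homSpace G where
  toFun β := ⟨fun x => β.1 (D.δ l x), β.2.1.comp (D.continuous_δ hl), fun x y =>
    (congrArg β.1 (map_mul _ x y)).trans (β.2.2 _ _)⟩
  map_add' _ _ := rfl
  map_smul' _ _ := rfl

theorem exists_surjective_hom [Nontrivial G] : ∃ q : ℕ, 1 ≤ q ∧ ∃ h : G → (Fin q → ℝ), Continuous h ∧
    (∀ x y, h (x * y) = h x + h y) ∧ Function.Surjective h ∧ ∀ l > 0, ∀ x, h x = 0 → h (D.δ l x) = 0 := by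
  haveI := D.finite_homSpace
  let b := Module.finBasis ℝ (homSpace G)
  set q := Module.finrank ℝ (homSpace G) with hq
  let h : G → (Fin q → ℝ) := fun x i => (b i).1 x
  have hcont : Continuous h := continuous_pi fun i => (b i).2.1
  have hmul : ∀ x y, h (x * y) = h x + h y := fun x y => funext fun i => (b i).2.2 x y
  have h1 : h 1 = 0 := by
    have := hmul 1 1
    rwa [mul_one, left_eq_add] at this
  let I : AddSubgroup (Fin q → ℝ) :=
    { carrier := Set.range h
      add_mem' := by
        rintro _ _ ⟨x, rfl⟩ ⟨y, rfl⟩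
        exact ⟨x * y, hmul x y⟩
      zero_mem' := ⟨1, h1⟩
      neg_mem' := by
        rintro _ ⟨x, rfl⟩
        refine ⟨x⁻¹, ?_⟩
        have := hmul x⁻¹ x
        rw [inv_mul_cancel, h1] at this
        exact eq_neg_of_add_eq_zero_left this.symm }
  have hspan : Submodule.span ℝ (I : Set (Fin q → ℝ)) = ⊤ := by
    by_contra hne
    obtain ⟨f, hf, hker⟩ := Submodule.exists_le_ker_of_lt_top _ (lt_top_iff_ne_top.2 hne)
    apply hf
    have hli := Fintype.linearIndependent_iff.1 b.linearIndependent
      (fun i => f (fun j => if i = j then 1 else 0)) (by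
        ext x
        have h2 : f (h x) = 0 := hker (Submodule.subset_span ⟨x, rfl⟩)
        rw [LinearMap.pi_apply_eq_sum_univ f (h x)] at h2
        have h3 : ((∑ i, f (fun j => if i = j then 1 else 0) • b i : homSpace G) : G → ℝ) x =
            ∑ i, f (fun j => if i = j then 1 else 0) * (b i).1 x := by
          rw [Submodule.coe_sum, Finset.sum_apply]
          rfl
        rw [h3]
        simpa [h, mul_comm] using h2)
    refine LinearMap.ext fun v => ?_
    rw [LinearMap.pi_apply_eq_sum_univ f v]
    simp [hli]
  let T : ℝ → (Fin q → ℝ) →L[ℝ] (Fin q → ℝ) := fun s => LinearMap.toContinuousLinearMap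
    (Matrix.mulVecLin (Matrix.of fun i j => b.repr (D.precomp (Real.exp_pos s) (b i)) j))
  have hTh : ∀ s x, T s (h x) = h (D.δ (Real.exp s) x) := by
    intro s x
    ext i
    have h2 := b.sum_repr (D.precomp (Real.exp_pos s) (b i))
    have h3 := congrFun (congrArg Subtype.val h2) x
    rw [Submodule.coe_sum, Finset.sum_apply] at h3
    exact h3
  have hext : ∀ A B : (Fin q → ℝ) →L[ℝ] (Fin q → ℝ), (∀ x, A (h x) = B (h x)) → A = B := by
    intro A B hAB
    have : (A : (Fin q → ℝ) →ₗ[ℝ] (Fin q → ℝ)) = B := LinearMap.ext_on hspan (by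
      rintro _ ⟨x, rfl⟩
      exact hAB x)
    exact ContinuousLinearMap.coe_injective this
  obtain ⟨v, hv⟩ := exists_mem_nhds_of_flow I hspan (T := T)
    (fun s t => hext _ _ fun x => by
      rw [ContinuousLinearMap.mul_apply, hTh, hTh, hTh, D.δ_δ _ _ (Real.exp_pos _) (Real.exp_pos _), Real.exp_add])
    (hext _ _ fun x => by rw [hTh, Real.exp_zero, D.δ_one, ContinuousLinearMap.one_apply])
    (by
      rintro _ ⟨x, rfl⟩
      simp only [hTh]
      refine hcont.comp ?_
      exact (D.cont x).comp_continuous Real.continuous_exp fun s => Real.exp_pos s)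
    (by
      rintro _ ⟨x, rfl⟩
      simp only [hTh]
      rw [← h1]
      exact (hcont.tendsto 1).comp (D.tendsto_δ_one x))
    (by
      rintro s _ ⟨x, rfl⟩
      exact ⟨_, (hTh s x).symm⟩)
  have hopen : IsOpen (I : Set (Fin q → ℝ)) := I.isOpen_of_mem_nhds hv
  have hclosed : IsClosed (I : Set (Fin q → ℝ)) := I.isClosed_of_isOpen hopen
  have huniv : (I : Set (Fin q → ℝ)) = Set.univ := IsClopen.eq_univ ⟨hclosed, hopen⟩ ⟨0, I.zero_mem⟩
  refine ⟨q, ?_, h, hcont, hmul, fun v => (huniv ▸ Set.mem_univ v : v ∈ (I : Set (Fin q → ℝ))), ?_⟩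
  · obtain ⟨β, hβ, hβm, x, hx⟩ := D.exists_hom
    haveI : Nontrivial (homSpace G) := ⟨⟨⟨β, hβ, hβm⟩, 0, fun h => hx (congrFun (congrArg Subtype.val h) x)⟩⟩
    exact Module.finrank_pos
  · intro l hl x hx
    have := hTh (Real.log l) x
    rw [Real.exp_log hl, hx, map_zero] at this
    exact this.symm

end

end Dil

namespace Dil

section

variable {G : Type*} [Group G] [MetricSpace G] (D : Dil G)

open Classical in
/-- The restriction of the dilations to an invariant subgroup. -/
noncomputable def restrict (B : Subgroup G) (hB : ∀ l > 0, ∀ x ∈ B, D.δ l x ∈ B) : Dil B where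
  δ l := if h : 0 < l then ((D.δ l).comp B.subtype).codRestrict B fun x => hB l h _ x.2 else MonoidHom.id B
  dist_mul_left a b c := D.dist_mul_left a b c
  dist_δ l hl x y := by
    rw [dif_pos hl]
    exact D.dist_δ l hl x y
  δ_δ l m hl hm x := by
    rw [dif_pos hl, dif_pos hm, dif_pos (mul_pos hl hm)]
    exact Subtype.ext (D.δ_δ l m hl hm x)
  δ_one x := by
    rw [dif_pos one_pos]
    exact Subtype.ext (D.δ_one x)
  cont x := by
    rw [Topology.IsInducing.subtypeVal.continuousOn_iff]
    refine (D.cont x).congr fun l hl => ?_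
    have hl' : 0 < l := hl
    simp only [Function.comp, dif_pos hl']
    rfl

theorem restrict_δ (B : Subgroup G) (hB : ∀ l > 0, ∀ x ∈ B, D.δ l x ∈ B) {l : ℝ} (hl : 0 < l) (x : B) :
    ((D.restrict B hB).δ l x : G) = D.δ l x := by
  simp only [restrict, dif_pos hl]
  rfl

/-- A subgroup contains `n` points of the unit ball with pairwise distances at least one. -/
def Sep (B : Subgroup G) (n : ℕ) : Prop :=
  ∃ S : Finset G, S.card = n ∧ (∀ x ∈ S, x ∈ B ∧ dist x 1 ≤ 1) ∧ ∀ x ∈ S, ∀ y ∈ S, x ≠ y → 1 ≤ dist x y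

theorem sep_succ [ProperSpace G] {B B' : Subgroup G} (hB : ∀ l > 0, ∀ x ∈ B, D.δ l x ∈ B)
    (hB' : ∀ l > 0, ∀ x ∈ B', D.δ l x ∈ B') (hcl : IsClosed (B' : Set G)) (hle : B' ≤ B) (hne : B' ≠ B)
    {n : ℕ} (h : Sep B' n) : Sep B (n + 1) := by
  classical
  obtain ⟨S, hS, hSB, hSd⟩ := h
  obtain ⟨b, hb, hb'⟩ := SetLike.exists_of_lt (lt_of_le_of_ne hle hne)
  obtain ⟨c, hc, hbc⟩ := hcl.exists_infDist_eq_dist ⟨1, B'.one_mem⟩ b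
  set e₀ := c⁻¹ * b with he₀
  have he₀B : e₀ ∈ B := B.mul_mem (B.inv_mem (hle hc)) hb
  have he₀' : e₀ ∉ B' := fun h => hb' (by
    have := B'.mul_mem hc h
    rwa [he₀, mul_inv_cancel_left] at this)
  have hmin : ∀ z ∈ B', dist e₀ 1 ≤ dist e₀ z := fun z hz => by
    have h1 : dist e₀ 1 = dist b c := by rw [he₀, ← D.dist_mul_left c, mul_inv_cancel_left, mul_one]
    have h2 : dist e₀ z = dist b (c * z) := by rw [he₀, ← D.dist_mul_left c, mul_inv_cancel_left]
    rw [h1, h2, ← hbc]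
    exact Metric.infDist_le_dist_of_mem (B'.mul_mem hc hz)
  have hpos : 0 < dist e₀ 1 := dist_pos.2 fun h => he₀' (h ▸ B'.one_mem)
  set l := (dist e₀ 1)⁻¹
  have hl : 0 < l := inv_pos.2 hpos
  have hl1 : l * dist e₀ 1 = 1 := inv_mul_cancel₀ hpos.ne'
  have hfar : ∀ z ∈ B', 1 ≤ dist (D.δ l e₀) z := fun z hz => by
    rw [← D.δ_δ_inv hl z, D.dist_δ l hl, ← hl1]
    have := hmin _ (hB' l⁻¹ (inv_pos.2 hl) z hz)
    gcongr
  have hnot : D.δ l e₀ ∉ S := fun h => by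
    have := hfar _ (hSB _ h).1
    rw [dist_self] at this
    linarith
  refine ⟨insert (D.δ l e₀) S, by rw [Finset.card_insert_of_notMem hnot, hS], ?_, ?_⟩
  · intro x hx
    rcases Finset.mem_insert.1 hx with rfl | hx
    · exact ⟨hB l hl _ he₀B, by rw [D.nm_δ hl, hl1]⟩
    · exact ⟨hle (hSB x hx).1, (hSB x hx).2⟩
  · intro x hx y hy hxy
    rcases Finset.mem_insert.1 hx with rfl | hx <;> rcases Finset.mem_insert.1 hy with rfl | hy
    · exact absurd rfl hxy
    · exact hfar y (hSB y hy).1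
    · rw [dist_comm]
      exact hfar x (hSB x hx).1
    · exact hSd x hx y hy hxy

theorem exists_not_sep [ProperSpace G] : ∃ n : ℕ, ∀ B : Subgroup G, ¬ Sep B n := by
  classical
  obtain ⟨t, -, ht, hcov⟩ := (isCompact_closedBall (1 : G) 1).finite_cover_balls (e := 1 / 2) (by norm_num)
  refine ⟨ht.toFinset.card + 1, fun B ⟨S, hS, hSB, hSd⟩ => ?_⟩
  have hex : ∀ x ∈ S, ∃ f ∈ ht.toFinset, dist x f < 1 / 2 := fun x hx => by
    obtain ⟨f, hf, hxf⟩ := Set.mem_iUnion₂.1 (hcov (Metric.mem_closedBall.2 (hSB x hx).2))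
    exact ⟨f, ht.mem_toFinset.2 hf, hxf⟩
  choose! f hf hxf using hex
  obtain ⟨x, hx, y, hy, hxy, he⟩ := Finset.exists_ne_map_eq_of_card_lt_of_maps_to (by omega) hf
  have h1 := hSd x hx y hy hxy
  have h2 := dist_triangle_right x y (f x)
  have h3 := hxf x hx
  have h4 := hxf y hy
  rw [← he] at h4
  linarith

variable [ProperSpace G] [IsTopologicalGroup G]

omit [ProperSpace G] in
theorem continuous_integral_smul {B : Subgroup G} [MeasurableSpace B] [BorelSpace B] (μ : MeasureTheory.Measure B)
    [MeasureTheory.IsFiniteMeasureOnCompacts μ] {φ : G → ℝ} (hφ : Continuous φ)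
    (hsupp : ∀ x₀ : G, ∃ K : Set B, IsCompact K ∧ ∀ p ∈ Metric.ball x₀ 1, ∀ b : B, b ∉ K → φ (p * b) = 0)
    {W : Type*} [NormedAddCommGroup W] [NormedSpace ℝ W] {k : B → W} (hk : Continuous k) :
    Continuous fun x : G => ∫ b : B, φ (x * b) • k b ∂μ := by
  refine continuous_iff_continuousAt.2 fun x₀ => ?_
  obtain ⟨K, hK, hKφ⟩ := hsupp x₀
  refine (continuousOn_integral_of_compact_support (s := Metric.ball x₀ 1) hK (f := fun x (b : B) => φ (x * b) • k b)
    ?_ ?_).continuousAt (Metric.ball_mem_nhds _ one_pos)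
  · exact Continuous.continuousOn (by simp only [Function.uncurry_def]; fun_prop)
  · intro p b hp hb
    rw [hKφ p hp b hb, zero_smul]

include D in
/-- Averaging over a closed subgroup extends a homomorphism to an equivariant map. -/
theorem exists_equivariant {V : Type*} [NormedAddCommGroup V] [NormedSpace ℝ V] [CompleteSpace V]
    {B : Subgroup G} (hcl : IsClosed (B : Set G)) (h : B → V) (hcont : Continuous h)
    (hmul : ∀ x y, h (x * y) = h x + h y) :
    ∃ r : G → V, Continuous r ∧ ∀ x, ∀ b : B, r (x * b) = r x + h b := by
  haveI : ProperSpace B := ProperSpace.of_isClosed hcl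
  letI : MeasurableSpace B := borel B
  haveI : BorelSpace B := ⟨rfl⟩
  let μ : MeasureTheory.Measure B := MeasureTheory.Measure.haar
  let q : G → ℝ := fun x => Metric.infDist x⁻¹ (B : Set G)
  have hqc : Continuous q := (Metric.continuous_infDist_pt _).comp continuous_inv
  have hq1 : ∀ x, q x ≤ dist x 1 := fun x => by
    rw [← D.nm_inv]
    exact Metric.infDist_le_dist_of_mem B.one_mem
  have hqB' : ∀ x, ∀ b : B, q (x * b) ≤ q x := fun x b => by
    refine (Metric.le_infDist ⟨1, B.one_mem⟩).2 fun {y} hy => ?_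
    have : dist x⁻¹ y = dist (x * b)⁻¹ ((b : G)⁻¹ * y) := by rw [mul_inv_rev, D.dist_mul_left]
    rw [this]
    exact Metric.infDist_le_dist_of_mem (B.mul_mem (B.inv_mem b.2) hy)
  have hqB : ∀ x, ∀ b : B, q (x * b) = q x := fun x b => by
    refine le_antisymm (hqB' x b) ?_
    have := hqB' (x * b) b⁻¹
    rwa [Subgroup.coe_inv, mul_inv_cancel_right] at this
  let φ : G → ℝ := fun x => max 0 (q x + 1 - dist x 1)
  have hφc : Continuous φ := by fun_prop
  have hφ0 : ∀ x, 0 ≤ φ x := fun x => le_max_left _ _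
  have hsupp : ∀ x₀ : G, ∃ K : Set B, IsCompact K ∧ ∀ p ∈ Metric.ball x₀ 1, ∀ b : B, b ∉ K → φ (p * b) = 0 := by
    intro x₀
    refine ⟨Metric.closedBall 1 (2 * (dist x₀ 1 + 1) + 1), isCompact_closedBall _ _, fun p hp b hb => ?_⟩
    rw [Metric.mem_closedBall, not_le, Subtype.dist_eq, Subgroup.coe_one] at hb
    rw [Metric.mem_ball] at hp
    refine max_eq_left ?_
    rw [hqB]
    have h1 := hq1 p
    have h2 : dist (b : G) 1 ≤ dist p 1 + dist (p * b) 1 := by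
      have := D.nm_mul_le p⁻¹ (p * b)
      rwa [inv_mul_cancel_left, D.nm_inv] at this
    have h3 := dist_triangle p x₀ 1
    linarith
  have hcs : ∀ x : G, HasCompactSupport fun b : B => φ (x * b) := fun x => by
    obtain ⟨K, hK, hKφ⟩ := hsupp x
    exact HasCompactSupport.intro hK fun b hb => hKφ x (Metric.mem_ball_self one_pos) b hb
  have hφcb : ∀ x : G, Continuous fun b : B => φ (x * b) := fun x => by fun_prop
  have hpos : ∀ x : G, 0 < ∫ b : B, φ (x * b) ∂μ := fun x => by
    obtain ⟨b, hb, hxb⟩ := hcl.exists_infDist_eq_dist ⟨1, B.one_mem⟩ x⁻¹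
    refine (hφcb x).integral_pos_of_hasCompactSupport_nonneg_nonzero (hcs x) (fun b => hφ0 _) (x := ⟨b, hb⟩) ?_
    have h1 : dist (x * b) 1 = q x := by
      change _ = Metric.infDist _ _
      rw [hxb, ← D.dist_mul_left x x⁻¹, mul_inv_cancel, dist_comm]
    have h2 := hqB x ⟨b, hb⟩
    refine (lt_max_of_lt_right ?_).ne'
    simp only at h2 ⊢
    linarith
  have h_integrable : ∀ k : B → V, Continuous k → ∀ x : G, MeasureTheory.Integrable (fun b : B => φ (x * b) • k b) μ :=
    fun k hk x => ((hφcb x).smul hk).integrable_of_hasCompactSupport (hcs x).smul_right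
  have hc1 := continuous_integral_smul μ hφc hsupp (W := ℝ) (k := fun _ => 1) continuous_const
  simp only [smul_eq_mul, mul_one] at hc1
  have hh1 : h 1 = 0 := by
    have := hmul 1 1
    rwa [mul_one, left_eq_add] at this
  refine ⟨fun x => -((∫ b : B, φ (x * b) ∂μ)⁻¹ • ∫ b : B, φ (x * b) • h b ∂μ),
    ((hc1.inv₀ fun x => (hpos x).ne').smul (continuous_integral_smul μ hφc hsupp hcont)).neg, fun x c => ?_⟩
  have e1 : ∫ b : B, φ (x * c * b) ∂μ = ∫ b : B, φ (x * b) ∂μ := by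
    rw [← MeasureTheory.integral_mul_left_eq_self (fun b : B => φ (x * b)) c]
    simp only [Subgroup.coe_mul, mul_assoc]
  have e2 : ∫ b : B, φ (x * c * b) • h b ∂μ = (∫ b : B, φ (x * b) • h b ∂μ) - (∫ b : B, φ (x * b) ∂μ) • h c := by
    have h1 : ∫ b : B, φ (x * c * b) • h b ∂μ = ∫ b : B, φ (x * b) • (h b - h c) ∂μ := by
      rw [← MeasureTheory.integral_mul_left_eq_self (fun b : B => φ (x * b) • (h b - h c)) c]
      simp only [Subgroup.coe_mul, mul_assoc, hmul, add_sub_cancel_left]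
    rw [h1]
    simp only [smul_sub]
    rw [MeasureTheory.integral_sub (h_integrable h hcont x) (h_integrable (fun _ => h c) continuous_const x), integral_smul_const]
  simp only
  rw [e1, e2, smul_sub, smul_smul, inv_mul_cancel₀ (hpos x).ne', one_smul]
  abel

end

end Dil

/-- A continuous map restricting to a homeomorphism on every coset of `B`, uniformly along convergent
families of cosets. -/
def Triv {G : Type*} [Group G] [TopologicalSpace G] (B : Subgroup G) (V : Type) [TopologicalSpace V] : Prop :=
  ∃ r : G → V, Continuous r ∧ (∀ x v, ∃ b ∈ B, r (x * b) = v) ∧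
    ∀ (ι : Type) (l : Filter ι) (y : ι → G) (b : ι → G) (x : G), Tendsto y l (𝓝 x) → (∀ i, b i ∈ B) →
      Tendsto (fun i => r (y i * b i)) l (𝓝 (r x)) → Tendsto b l (𝓝 1)

theorem Triv.congr {G : Type*} [Group G] [TopologicalSpace G] {B : Subgroup G} {V W : Type}
    [TopologicalSpace V] [TopologicalSpace W] (h : Triv B V) (e : V ≃ₜ W) : Triv B W := by
  obtain ⟨r, hr, hs, hu⟩ := h
  refine ⟨e ∘ r, e.continuous.comp hr, fun x v => ?_, fun ι l y b x hy hb ht => hu ι l y b x hy hb ?_⟩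
  · obtain ⟨b, hb, hv⟩ := hs x (e.symm v)
    exact ⟨b, hb, by rw [Function.comp, hv, e.apply_symm_apply]⟩
  · have := (e.symm.continuous.tendsto _).comp ht
    simpa [Function.comp_def] using this

theorem Triv.nonempty_homeo {G : Type*} [Group G] [TopologicalSpace G] [IsTopologicalGroup G] [T2Space G]
    {B : Subgroup G} {V : Type} [TopologicalSpace V] (h : Triv B V) (x : G) :
    Nonempty ({y : G | x⁻¹ * y ∈ B} ≃ₜ V) := by
  obtain ⟨r, hr, hs, hu⟩ := h
  have hinj : ∀ y ∈ {y : G | x⁻¹ * y ∈ B}, ∀ z ∈ {y : G | x⁻¹ * y ∈ B}, r y = r z → y = z := by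
    intro y hy z hz hyz
    have hb : y⁻¹ * z ∈ B := by
      have := B.mul_mem (B.inv_mem hy) hz
      rwa [mul_inv_rev, inv_inv, mul_assoc, mul_inv_cancel_left] at this
    have h1 := hu ℕ atTop (fun _ => y) (fun _ => y⁻¹ * z) y tendsto_const_nhds (fun _ => hb)
      (by simp only [mul_inv_cancel_left, hyz]; exact tendsto_const_nhds)
    have h2 := tendsto_nhds_unique h1 tendsto_const_nhds
    exact (inv_mul_eq_one.1 h2.symm)
  choose s hsB hs using hs x
  refine ⟨{ toFun := fun y => r y.1
            invFun := fun v => ⟨x * s v, by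
              rw [Set.mem_setOf_eq, inv_mul_cancel_left]
              exact hsB v⟩
            left_inv := fun y => Subtype.ext (hinj _ (by
              rw [Set.mem_setOf_eq, inv_mul_cancel_left]
              exact hsB _) _ y.2 (hs _))
            right_inv := fun v => hs v
            continuous_toFun := hr.comp continuous_subtype_val
            continuous_invFun := ?_ }⟩
  refine Continuous.subtype_mk (continuous_iff_continuousAt.2 fun v => ?_) _
  have h1 := hu V (𝓝 v) (fun _ => x * s v) (fun w => (s v)⁻¹ * s w) (x * s v) tendsto_const_nhds
    (fun w => B.mul_mem (B.inv_mem (hsB v)) (hsB w))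
    (by simp only [mul_assoc, mul_inv_cancel_left, hs]; exact tendsto_id)
  have h2 := h1.const_mul (x * s v)
  simp only [mul_assoc, mul_inv_cancel_left, mul_one] at h2
  exact h2

namespace Dil

section

variable {G : Type*} [Group G] [MetricSpace G] (D : Dil G) [ProperSpace G] [IsTopologicalGroup G]

omit D in
theorem triv_bot : Triv (⊥ : Subgroup G) (Fin 0 → ℝ) :=
  ⟨fun _ => 0, continuous_const, fun _ _ => ⟨1, Subgroup.mem_bot.2 rfl, Subsingleton.elim _ _⟩,
    fun _ _ _ b _ _ hb _ => by
      rw [show b = fun _ => 1 from funext fun i => Subgroup.mem_bot.1 (hb i)]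
      exact tendsto_const_nhds⟩

omit D in
theorem exists_section {q : ℕ} (h : G → (Fin q → ℝ)) (hcont : Continuous h)
    (hmul : ∀ x y, h (x * y) = h x + h y) (hsurj : Function.Surjective h) :
    ∃ s : (Fin q → ℝ) → G, (∀ v, h (s v) = v) ∧ Tendsto s (𝓝 0) (𝓝 1) := by
  let H : G →* Multiplicative (Fin q → ℝ) := MonoidHom.mk' (fun x => Multiplicative.ofAdd (h x)) fun x y => by
    rw [hmul, ofAdd_add]
  haveI : BaireSpace (Multiplicative (Fin q → ℝ)) := inferInstanceAs (BaireSpace (Fin q → ℝ))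
  haveI : T2Space (Multiplicative (Fin q → ℝ)) := inferInstanceAs (T2Space (Fin q → ℝ))
  have hopen : IsOpenMap h := H.isOpenMap_of_sigmaCompact hsurj hcont
  have hh1 : h 1 = 0 := by
    have := hmul 1 1
    rwa [mul_one, left_eq_add] at this
  have hex : ∀ v, ∃ x, h x = v ∧ ∀ y, h y = v → dist x 1 ≤ dist y 1 := fun v => by
    obtain ⟨x, hx, hd⟩ := (isClosed_singleton.preimage hcont : IsClosed (h ⁻¹' {v})).exists_infDist_eq_dist
      (hsurj v) 1
    refine ⟨x, hx, fun y hy => ?_⟩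
    rw [dist_comm x, ← hd, dist_comm]
    exact Metric.infDist_le_dist_of_mem hy
  choose s hs hmin using hex
  refine ⟨s, hs, Metric.tendsto_nhds.2 fun ε hε => ?_⟩
  have h1 := (hopen _ Metric.isOpen_ball).mem_nhds (Set.mem_image_of_mem h (Metric.mem_ball_self (x := (1 : G)) hε))
  rw [hh1] at h1
  filter_upwards [h1] with v hv
  obtain ⟨y, hy, rfl⟩ := hv
  exact (hmin _ y rfl).trans_lt hy

include D in
theorem triv_step {B B' : Subgroup G} (hcl : IsClosed (B : Set G)) {q : ℕ} (h : B → (Fin q → ℝ)) (hcont : Continuous h)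
    (hmul : ∀ x y, h (x * y) = h x + h y) (hsurj : Function.Surjective h) (hle : B' ≤ B)
    (hB' : ∀ b : B, (b : G) ∈ B' ↔ h b = 0) {V : Type} [TopologicalSpace V] (hV : Triv B' V) :
    Triv B ((Fin q → ℝ) × V) := by
  obtain ⟨r', hr', hs', hu'⟩ := hV
  obtain ⟨r, hr, hre⟩ := D.exists_equivariant hcl h hcont hmul
  haveI : ProperSpace B := ProperSpace.of_isClosed hcl
  obtain ⟨s, hs, hs1⟩ := exists_section h hcont hmul hsurj
  refine ⟨fun x => (r x, r' x), hr.prodMk hr', fun x v => ?_, fun ι l y b x hy hb ht => ?_⟩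
  · obtain ⟨b, hb⟩ := hsurj (v.1 - r x)
    obtain ⟨b', hb', hv⟩ := hs' (x * b) v.2
    have h0 := (hB' ⟨b', hle hb'⟩).1 hb'
    refine ⟨b * b', B.mul_mem b.2 (hle hb'), Prod.ext ?_ ?_⟩
    · have h1 := hre (x * b) ⟨b', hle hb'⟩
      simp only at h1 ⊢
      rw [← mul_assoc, h1, hre, hb, h0]
      abel
    · simp only
      rw [← mul_assoc, hv]
  · rw [nhds_prod_eq] at ht
    have ht1 : Tendsto (fun i => r (y i * b i)) l (𝓝 (r x)) := tendsto_fst.comp ht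
    have ht2 : Tendsto (fun i => r' (y i * b i)) l (𝓝 (r' x)) := tendsto_snd.comp ht
    let β : ι → B := fun i => ⟨b i, hb i⟩
    have hβ : Tendsto (fun i => h (β i)) l (𝓝 0) := by
      have h1 := ht1.sub ((hr.tendsto x).comp hy)
      rw [sub_self] at h1
      refine h1.congr fun i => ?_
      have := hre (y i) (β i)
      simp only [Function.comp]
      rw [show b i = (β i : G) from rfl, this, add_sub_cancel_left]
    have hσ : Tendsto (fun i => (s (h (β i)) : G)) l (𝓝 1) :=
      ((continuous_subtype_val.tendsto (1 : B)).comp hs1).comp hβ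
    have h2 := hu' ι l (fun i => y i * s (h (β i))) (fun i => (s (h (β i)) : G)⁻¹ * b i) x
      (by simpa using hy.mul hσ)
      (fun i => by
        refine (hB' ((s (h (β i)))⁻¹ * β i)).2 ?_
        have h3 := hmul (s (h (β i))) ((s (h (β i)))⁻¹ * β i)
        rw [mul_inv_cancel_left, hs, left_eq_add] at h3
        exact h3)
      (by simpa only [mul_assoc, mul_inv_cancel_left] using ht2)
    have h3 := hσ.mul h2
    simpa using h3

theorem triv_aux (m : ℕ) : ∀ B : Subgroup G, IsClosed (B : Set G) → (∀ l > 0, ∀ x ∈ B, D.δ l x ∈ B) →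
    ¬ Sep B m → ∃ p : ℕ, Triv B (Fin p → ℝ) := by
  induction m with
  | zero => exact fun B _ _ h => absurd ⟨∅, rfl, by simp, by simp⟩ h
  | succ m ih =>
    intro B hcl hB hm
    rcases eq_or_ne B ⊥ with rfl | hne
    · exact ⟨0, triv_bot⟩
    haveI : ProperSpace B := ProperSpace.of_isClosed hcl
    haveI : Nontrivial B := B.nontrivial_iff_ne_bot.2 hne
    obtain ⟨q, hq, h, hcont, hmul, hsurj, hδ⟩ := (D.restrict B hB).exists_surjective_hom
    have hh1 : h 1 = 0 := by
      have := hmul 1 1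
      rwa [mul_one, left_eq_add] at this
    let K : Subgroup B :=
      { carrier := {x | h x = 0}
        mul_mem' := fun {a b} ha hb => by
          simp only [Set.mem_setOf_eq] at *
          rw [hmul, ha, hb, add_zero]
        one_mem' := hh1
        inv_mem' := fun {a} ha => by
          have := hmul a a⁻¹
          simp only [Set.mem_setOf_eq] at *
          rw [mul_inv_cancel, hh1, ha, zero_add] at this
          exact this.symm }
    have hKmem : ∀ b : B, (b : G) ∈ K.map B.subtype ↔ h b = 0 := fun b =>
      ⟨fun ⟨c, hc, hcb⟩ => by
        rw [show b = c from Subtype.ext hcb.symm]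
        exact hc, fun hb => ⟨b, hb, rfl⟩⟩
    have hKle : K.map B.subtype ≤ B := by
      rintro _ ⟨c, -, rfl⟩
      exact c.2
    have hKcl : IsClosed (K.map B.subtype : Set G) := by
      rw [Subgroup.coe_map]
      exact hcl.isClosedEmbedding_subtypeVal.isClosedMap _
        ((isClosed_singleton (x := (0 : Fin q → ℝ))).preimage hcont)
    have hKδ : ∀ l > 0, ∀ x ∈ K.map B.subtype, D.δ l x ∈ K.map B.subtype := by
      rintro l hl _ ⟨c, hc, rfl⟩
      exact ⟨(D.restrict B hB).δ l c, hδ l hl c hc, D.restrict_δ B hB hl c⟩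
    have hKne : K.map B.subtype ≠ B := fun heq => by
      obtain ⟨b, hb⟩ := hsurj fun _ => 1
      have := (hKmem b).1 (heq.symm ▸ b.2)
      rw [hb] at this
      exact one_ne_zero (congrFun this ⟨0, hq⟩)
    obtain ⟨p, hp⟩ := ih _ hKcl hKδ fun hs => hm (D.sep_succ hB hKδ hKcl hKle hKne hs)
    exact ⟨q + p, (D.triv_step hcl h hcont hmul hsurj hKle hKmem hp).congr (Fin.appendHomeomorph q p)⟩

theorem exists_triv {B : Subgroup G} (hcl : IsClosed (B : Set G)) (hB : ∀ l > 0, ∀ x ∈ B, D.δ l x ∈ B) :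
    ∃ p : ℕ, Triv B (Fin p → ℝ) := by
  obtain ⟨m, hm⟩ := exists_not_sep (G := G)
  exact D.triv_aux m B hcl hB (hm B)

/-- The cosets of the kernel of a surjective homomorphism with invariant kernel are cells, as is the group. -/
theorem exists_homeo {k : ℕ} (h : G → (Fin k → ℝ)) (hcont : Continuous h) (hmul : ∀ x y, h (x * y) = h x + h y)
    (hsurj : Function.Surjective h) (hδ : ∀ l > 0, ∀ x, h x = 0 → h (D.δ l x) = 0) :
    ∃ p : ℕ, (∀ x, Nonempty ({y | h y = h x} ≃ₜ (Fin p → ℝ))) ∧ Nonempty (G ≃ₜ (Fin (k + p) → ℝ)) := by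
  have hh1 : h 1 = 0 := by
    have := hmul 1 1
    rwa [mul_one, left_eq_add] at this
  have hinv : ∀ x, h x⁻¹ = - h x := fun x => by
    have := hmul x x⁻¹
    rw [mul_inv_cancel, hh1] at this
    exact eq_neg_of_add_eq_zero_right this.symm
  let K : Subgroup G :=
    { carrier := {x | h x = 0}
      mul_mem' := fun {a b} ha hb => by
        simp only [Set.mem_setOf_eq] at *
        rw [hmul, ha, hb, add_zero]
      one_mem' := hh1
      inv_mem' := fun {a} ha => by
        simp only [Set.mem_setOf_eq] at *
        rw [hinv, ha, neg_zero] }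
  obtain ⟨p, hp⟩ := D.exists_triv (B := K) ((isClosed_singleton (x := (0 : Fin k → ℝ))).preimage hcont) hδ
  refine ⟨p, fun x => ?_, ?_⟩
  · have hset : {y | h y = h x} = {y | x⁻¹ * y ∈ K} := by
      ext y
      change h y = h x ↔ h (x⁻¹ * y) = 0
      rw [hmul, hinv, neg_add_eq_zero, eq_comm]
    rw [hset]
    exact hp.nonempty_homeo x
  · have h1 : Triv (⊤ : Subgroup G) ((Fin k → ℝ) × (Fin p → ℝ)) :=
      D.triv_step isClosed_univ (fun x => h x.1) (hcont.comp continuous_subtype_val) (fun x y => hmul x.1 y.1)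
        (fun v => by
          obtain ⟨x, hx⟩ := hsurj v
          exact ⟨⟨x, trivial⟩, hx⟩) le_top (fun b => Iff.rfl) hp
    obtain ⟨e⟩ := (h1.congr (Fin.appendHomeomorph k p)).nonempty_homeo 1
    have hset : {y : G | (1 : G)⁻¹ * y ∈ (⊤ : Subgroup G)} = Set.univ := Set.eq_univ_of_forall fun _ => trivial
    rw [hset] at e
    exact ⟨(Homeomorph.Set.univ G).symm.trans e⟩

end

end Dil

theorem tendsto_of_subseq_UF {E : Type*} [PseudoMetricSpace E] {u : ℕ → E} {y : E}
    (h : ∀ φ : ℕ → ℕ, StrictMono φ → Tendsto (fun n => u (φ n)) UF (𝓝 y)) : Tendsto u atTop (𝓝 y) := by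
  by_contra hne
  rw [Metric.tendsto_nhds] at hne
  push Not at hne
  obtain ⟨ε, hε, hf⟩ := hne
  obtain ⟨φ, hφ, hd⟩ := extraction_of_frequently_atTop hf
  obtain ⟨n, hn⟩ := ((Metric.tendsto_nhds.1 (h φ hφ)) ε hε).exists
  exact absurd hn (not_lt.2 (hd n))

section

variable {E : Type*} [MetricSpace E]

theorem IsShift.one : IsShift (1 : E ≃ᵢ E) := fun c _ z w => by simp

theorem IsShift.mul {g h : E ≃ᵢ E} (hg : IsShift g) (hh : IsShift h) : IsShift (g * h) := fun c hc z w => by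
  have h1 := hg c hc (h z) (h w)
  have h2 := hh c hc z w
  rw [IsometryEquiv.mul_apply, IsometryEquiv.mul_apply]
  linarith

theorem IsShift.inv {g : E ≃ᵢ E} (hg : IsShift g) : IsShift g⁻¹ := fun c hc z w => by
  have h1 := hg c hc (g⁻¹ z) (g⁻¹ w)
  rw [IsometryEquiv.apply_inv_self, IsometryEquiv.apply_inv_self] at h1
  linarith

/-- Shifts with a fixed point are trivial. -/
class RigidSpace (E : Type*) [MetricSpace E] : Prop where
  eq_self : ∀ g : E ≃ᵢ E, IsShift g → ∀ o, g o = o → ∀ x, g x = x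

theorem IsShift.ext [RigidSpace E] {g h : E ≃ᵢ E} (hg : IsShift g) (hh : IsShift h) {o : E} (ho : g o = h o) : g = h := by
  ext x
  have := RigidSpace.eq_self (h⁻¹ * g) (hh.inv.mul hg) o (by
    rw [IsometryEquiv.mul_apply, ho, IsometryEquiv.inv_apply_self]) x
  rw [IsometryEquiv.mul_apply] at this
  rw [← IsometryEquiv.apply_inv_self h (g x), this]

theorem IsShift.of_tendsto {u : ℕ → E ≃ᵢ E} (hu : ∀ n, IsShift (u n)) {G : E ≃ᵢ E}
    (hG : ∀ z, Tendsto (fun n => u n z) UF (𝓝 (G z))) : IsShift G := fun c hc z w => by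
  have h1 : ∀ z, Tendsto (fun n => bus c (u n z) - bus c z) UF (𝓝 (bus c (G z) - bus c z)) := fun z =>
    (((continuous_bus hc).tendsto _).comp (hG z)).sub_const _
  refine tendsto_nhds_unique (h1 z) ((h1 w).congr fun n => ?_)
  exact (hu n c hc z w).symm

theorem IsShift.tendsto_apply [ProperSpace E] [RigidSpace E] {u : ℕ → E ≃ᵢ E} (hu : ∀ n, IsShift (u n))
    {g : E ≃ᵢ E} (hg : IsShift g) {o : E} (ho : Tendsto (fun n => u n o) atTop (𝓝 (g o))) (x : E) :
    Tendsto (fun n => u n x) atTop (𝓝 (g x)) := by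
  refine tendsto_of_subseq_UF fun φ hφ => ?_
  have h1 : Tendsto (fun n => u (φ n) o) UF (𝓝 (g o)) := (ho.comp hφ.tendsto_atTop).mono_left UF_le
  obtain ⟨G, hG, -⟩ := exists_isometryEquiv_ulim (fun n => u (φ n)) o (g o) h1
  have hGg : G = g := (IsShift.of_tendsto (fun n => hu (φ n)) hG).ext hg (tendsto_nhds_unique (hG o) h1)
  rw [← hGg]
  exact hG x

/-- The group of shifts. -/
def shiftSubgroup (E : Type*) [MetricSpace E] : Subgroup (E ≃ᵢ E) where
  carrier := {g | IsShift g}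
  mul_mem' := IsShift.mul
  one_mem' := IsShift.one
  inv_mem' := IsShift.inv

/-- The group of shifts with the metric of an orbit. -/
def Shifts {E : Type*} [MetricSpace E] (_ : E) : Type _ := shiftSubgroup E

namespace Shifts

variable {o : E}

instance : Group (Shifts o) := inferInstanceAs (Group (shiftSubgroup E))

/-- The underlying isometry of a shift. -/
def iso (g : Shifts o) : E ≃ᵢ E := g.1

theorem isShift (g : Shifts o) : IsShift g.iso := g.2

/-- A shift as an element of the group of shifts. -/
def mk (g : E ≃ᵢ E) (hg : IsShift g) : Shifts o := ⟨g, hg⟩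

theorem iso_mk (g : E ≃ᵢ E) (hg : IsShift g) : (mk g hg : Shifts o).iso = g := rfl

theorem iso_injective : Function.Injective (iso : Shifts o → E ≃ᵢ E) := Subtype.val_injective

theorem mul_apply (g h : Shifts o) (x : E) : (g * h).iso x = g.iso (h.iso x) := rfl

theorem one_apply (x : E) : (1 : Shifts o).iso x = x := rfl

theorem apply_inv (g : Shifts o) (x : E) : g.iso ((g⁻¹).iso x) = x := IsometryEquiv.apply_inv_self g.iso x

section

variable [RigidSpace E]

theorem ext {g h : Shifts o} (hgh : g.iso o = h.iso o) : g = h :=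
  iso_injective (g.isShift.ext h.isShift hgh)

noncomputable instance : MetricSpace (Shifts o) :=
  MetricSpace.induced (fun g => g.iso o) (fun _ _ h => ext h) inferInstance

theorem dist_def (g h : Shifts o) : dist g h = dist (g.iso o) (h.iso o) := rfl

theorem isometry_orbit : Isometry fun g : Shifts o => g.iso o := Isometry.of_dist_eq fun _ _ => rfl

variable [ProperSpace E]

theorem tendsto_apply {u : ℕ → Shifts o} {g : Shifts o} (h : Tendsto u atTop (𝓝 g)) (x : E) :
    Tendsto (fun n => (u n).iso x) atTop (𝓝 (g.iso x)) :=
  IsShift.tendsto_apply (fun n => (u n).isShift) g.isShift ((isometry_orbit.continuous.tendsto g).comp h) x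

instance : IsTopologicalGroup (Shifts o) where
  continuous_mul := by
    rw [continuous_iff_seqContinuous]
    intro u x hu
    have h1 : Tendsto (fun n => (u n).1) atTop (𝓝 x.1) := (continuous_fst.tendsto x).comp hu
    have h2 : Tendsto (fun n => (u n).2) atTop (𝓝 x.2) := (continuous_snd.tendsto x).comp hu
    rw [tendsto_iff_dist_tendsto_zero]
    have h3 := tendsto_iff_dist_tendsto_zero.1 (tendsto_apply h1 (x.2.iso o))
    have h4 := (tendsto_iff_dist_tendsto_zero.1 h2).add h3
    rw [add_zero] at h4
    refine squeeze_zero (fun _ => dist_nonneg) (fun n => ?_) h4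
    simp only [Function.comp, dist_def, mul_apply]
    refine (dist_triangle _ ((u n).1.iso (x.2.iso o)) _).trans ?_
    rw [IsometryEquiv.dist_eq]
  continuous_inv := by
    rw [continuous_iff_seqContinuous]
    intro u g hu
    rw [tendsto_iff_dist_tendsto_zero]
    have h3 := tendsto_iff_dist_tendsto_zero.1 (tendsto_apply hu ((g⁻¹).iso o))
    refine h3.congr fun n => ?_
    simp only [Function.comp, dist_def]
    rw [← (u n).iso.dist_eq ((u n)⁻¹.iso o), apply_inv, apply_inv, dist_comm]

variable [InvSpace E]

variable (o) in
theorem exists_apply_eq (x : E) : ∃ g : Shifts o, g.iso o = x := by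
  obtain ⟨g, hg, hs⟩ := exists_isShift o x
  exact ⟨mk g hs, hg⟩

variable (o) in
/-- The orbit map as an isometry. -/
noncomputable def orbit : Shifts o ≃ᵢ E :=
  IsometryEquiv.mk (Equiv.ofBijective _ ⟨isometry_orbit.injective, exists_apply_eq o⟩) isometry_orbit

instance : ProperSpace (Shifts o) :=
  (orbit o).symm.isometry.antilipschitz.properSpace (orbit o).symm.continuous (orbit o).symm.surjective

end

end Shifts

section

variable [ProperSpace E] [InvSpace E]

/-- Conjugation by a homothety. -/
noncomputable def conjHom (o : E) {l : ℝ} (hl : 0 < l) (g : E ≃ᵢ E) : E ≃ᵢ E where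
  toEquiv := (hom o l).symm.trans (g.toEquiv.trans (hom o l))
  isometry_toFun := Isometry.of_dist_eq fun a b => by
    change dist (hom o l (g ((hom o l).symm a))) (hom o l (g ((hom o l).symm b))) = _
    rw [hom_dist o hl, g.dist_eq, dist_hom_symm o hl, mul_inv_cancel_left₀ hl.ne']

theorem conjHom_apply (o : E) {l : ℝ} (hl : 0 < l) (g : E ≃ᵢ E) (x : E) :
    conjHom o hl g (hom o l x) = hom o l (g x) := by
  change hom o l (g ((hom o l).symm (hom o l x))) = _
  rw [Equiv.symm_apply_apply]

theorem IsShift.conjHom {o : E} {l : ℝ} (hl : 0 < l) {g : E ≃ᵢ E} (hg : IsShift g) : IsShift (conjHom o hl g) := by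
  intro c hc z w
  obtain ⟨z, rfl⟩ := (hom o l).surjective z
  obtain ⟨w, rfl⟩ := (hom o l).surjective w
  rw [conjHom_apply, conjHom_apply, bus_hom hc o hl, bus_hom hc o hl, bus_hom hc o hl, bus_hom hc o hl]
  have := hg c hc z w
  linear_combination l * this

variable [RigidSpace E]

/-- An isometry preserving the Busemann functions and fixing a point is trivial. -/
theorem eq_self_of_bus {f : E ≃ E} (hf : ∀ a b, dist (f a) (f b) = dist a b) {o : E} (ho : f o = o)
    (hb : ∀ c : ℝ → E, Isometry c → ∀ z, bus c (f z) = bus c z) (x : E) : f x = x :=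
  RigidSpace.eq_self (IsometryEquiv.mk f (Isometry.of_dist_eq hf)) (fun c hc z w => by
    have h1 := hb c hc z
    have h2 := hb c hc w
    change bus c (f z) - bus c z = bus c (f w) - bus c w
    linarith) o ho x

theorem hom_hom (o : E) {l m : ℝ} (hl : 0 < l) (hm : 0 < m) (x : E) : hom o l (hom o m x) = hom o (l * m) x := by
  have hlm := mul_pos hl hm
  have := eq_self_of_bus (f := (hom o m).trans ((hom o l).trans (hom o (l * m)).symm)) (o := o)
    (fun a b => by
      change dist ((hom o (l * m)).symm (hom o l (hom o m a))) ((hom o (l * m)).symm (hom o l (hom o m b))) = _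
      rw [dist_hom_symm o hlm, hom_dist o hl, hom_dist o hm]
      field_simp)
    (by
      change (hom o (l * m)).symm (hom o l (hom o m o)) = o
      rw [hom_self o hm, hom_self o hl, Equiv.symm_apply_eq, hom_self o hlm])
    (fun c hc z => by
      change bus c ((hom o (l * m)).symm (hom o l (hom o m z))) = _
      have h1 := bus_hom hc o hlm ((hom o (l * m)).symm (hom o l (hom o m z)))
      rw [Equiv.apply_symm_apply, bus_hom hc o hl, bus_hom hc o hm] at h1
      have h2 : l * m * (bus c ((hom o (l * m)).symm (hom o l (hom o m z))) - bus c z) = 0 := by linear_combination -h1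
      rcases mul_eq_zero.1 h2 with h | h
      · exact absurd h hlm.ne'
      · linarith) x
  exact (Equiv.symm_apply_eq _).1 this

theorem hom_one (o x : E) : hom o 1 x = x := by
  refine (hom o 1).injective ?_
  rw [hom_hom o one_pos one_pos, mul_one]

theorem tendsto_hom_one (o x : E) {r : ℕ → ℝ} (hr0 : ∀ n, 0 < r n) (hr : Tendsto r UF (𝓝 1)) :
    Tendsto (fun n => hom o (r n) x) UF (𝓝 x) := by
  haveI : Nonempty E := ⟨o⟩
  have key : ∀ {f : ℕ → E → E} {s : ℕ → ℝ}, (∀ n a b, dist (f n a) (f n b) = s n * dist a b) → (∀ n, f n o = o) →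
      Tendsto s UF (𝓝 1) → ∀ z, Tendsto (fun n => f n z) UF (𝓝 (ulim fun n => f n z)) := by
    intro f s hf ho hs z
    refine tendsto_ulim o (2 * dist z o) ?_
    filter_upwards [hs.eventually (gt_mem_nhds (show (1 : ℝ) < 2 by norm_num))] with n hn
    have := hf n z o
    rw [ho n] at this
    rw [this]
    gcongr
  have hri : Tendsto (fun n => (r n)⁻¹) UF (𝓝 1) := by simpa using hr.inv₀ one_ne_zero
  have h1 := key (f := fun n => hom o (r n)) (fun n a b => hom_dist o (hr0 n) a b) (fun n => hom_self o (hr0 n)) hr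
  have h2 := key (f := fun n => (hom o (r n)).symm) (fun n a b => dist_hom_symm o (hr0 n) a b)
    (fun n => (Equiv.symm_apply_eq _).2 (hom_self o (hr0 n)).symm) hri
  have lim : ∀ {f g : ℕ → E → E} {s : ℕ → ℝ}, (∀ n a b, dist (f n a) (f n b) = s n * dist a b) →
      Tendsto s UF (𝓝 1) → (∀ n z, f n (g n z) = z) → ∀ {y z}, Tendsto (fun n => g n z) UF (𝓝 y) →
      Tendsto (fun n => f n y) UF (𝓝 z) := by
    intro f g s hf hs hfg y z hg
    rw [tendsto_iff_dist_tendsto_zero] at hg ⊢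
    have := hs.mul hg
    rw [mul_zero] at this
    refine this.congr fun n => ?_
    rw [dist_comm (g n z), ← hf n, hfg]
  let F : E ≃ E :=
    { toFun := fun z => ulim fun n => hom o (r n) z
      invFun := fun z => ulim fun n => (hom o (r n)).symm z
      left_inv := fun z => tendsto_nhds_unique (h2 _)
        (lim (fun n a b => dist_hom_symm o (hr0 n) a b) hri (fun n z => Equiv.symm_apply_apply _ z) (h1 z))
      right_inv := fun z => tendsto_nhds_unique (h1 _)
        (lim (fun n a b => hom_dist o (hr0 n) a b) hr (fun n z => Equiv.apply_symm_apply _ z) (h2 z)) }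
  have hF : ∀ z, Tendsto (fun n => hom o (r n) z) UF (𝓝 (F z)) := h1
  have hx : F x = x := by
    refine eq_self_of_bus (fun a b => ?_) (o := o) ?_ (fun c hc z => ?_) x
    · refine tendsto_nhds_unique ((hF a).dist (hF b)) ?_
      simp only [hom_dist o (hr0 _)]
      simpa using hr.mul_const (dist a b)
    · refine tendsto_nhds_unique (hF o) ?_
      simp only [hom_self o (hr0 _)]
      exact tendsto_const_nhds
    · refine tendsto_nhds_unique (((continuous_bus hc).tendsto _).comp (hF z)) ?_
      simp only [Function.comp_def, bus_hom hc o (hr0 _)]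
      simpa using (hr.mul_const (bus c z - bus c o)).const_add (bus c o)
  rw [← hx]
  simpa only [hx] using hF x

theorem continuousOn_hom (o x : E) : ContinuousOn (fun l => hom o l x) (Set.Ioi 0) := by
  intro l hl
  have hl' : 0 < l := hl
  rw [ContinuousWithinAt]
  refine tendsto_of_seq_tendsto fun u hu => ?_
  have hu0 : ∀ᶠ n in atTop, 0 < u n := hu.eventually self_mem_nhdsWithin
  have hul : Tendsto u atTop (𝓝 l) := hu.mono_right nhdsWithin_le_nhds
  refine tendsto_of_subseq_UF fun φ hφ => ?_
  have hφ0 : ∀ᶠ n in UF, 0 < u (φ n) := (hφ.tendsto_atTop.eventually hu0).filter_mono UF_le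
  have hφl : Tendsto (fun n => u (φ n)) UF (𝓝 l) := (hul.comp hφ.tendsto_atTop).mono_left UF_le
  let r : ℕ → ℝ := fun n => if 0 < u (φ n) then u (φ n) / l else 1
  have hr : Tendsto r UF (𝓝 1) := by
    have := hφl.div_const l
    rw [div_self hl'.ne'] at this
    refine this.congr' ?_
    filter_upwards [hφ0] with n hn
    exact (if_pos hn).symm
  have h1 := tendsto_hom_one o (hom o l x) (r := r) (fun n => by
    simp only [r]
    split_ifs with h
    · positivity
    · exact one_pos) hr
  refine h1.congr' ?_
  filter_upwards [hφ0] with n hn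
  simp only [r, Function.comp_apply, if_pos hn]
  rw [hom_hom o (div_pos hn hl') hl', div_mul_cancel₀ _ hl'.ne']

namespace Shifts

variable {o : E}

open Classical in
/-- The dilations of the group of shifts. -/
noncomputable def dil (o : E) : Dil (Shifts o) where
  δ l := if h : 0 < l then MonoidHom.mk' (fun g => mk (conjHom o h g.iso) (g.isShift.conjHom h))
    (fun a b => iso_injective (by
      ext x
      obtain ⟨x, rfl⟩ := (hom o l).surjective x
      rw [mul_apply, iso_mk, iso_mk, iso_mk, conjHom_apply, conjHom_apply, conjHom_apply, mul_apply]))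
    else MonoidHom.id _
  dist_mul_left a b c := by
    simp only [dist_def, mul_apply, IsometryEquiv.dist_eq]
  dist_δ l hl x y := by
    rw [dif_pos hl]
    change dist (conjHom o hl x.iso o) (conjHom o hl y.iso o) = l * dist (x.iso o) (y.iso o)
    have h1 := conjHom_apply o hl x.iso o
    have h2 := conjHom_apply o hl y.iso o
    rw [hom_self o hl] at h1 h2
    rw [h1, h2, hom_dist o hl]
  δ_δ l m hl hm x := by
    rw [dif_pos hl, dif_pos hm, dif_pos (mul_pos hl hm)]
    refine ext ?_
    change conjHom o hl (conjHom o hm x.iso) o = conjHom o (mul_pos hl hm) x.iso o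
    have h1 := conjHom_apply o hl (conjHom o hm x.iso) o
    have h2 := conjHom_apply o hm x.iso o
    have h3 := conjHom_apply o (mul_pos hl hm) x.iso o
    rw [hom_self o hl] at h1
    rw [hom_self o hm] at h2
    rw [hom_self o (mul_pos hl hm)] at h3
    rw [h1, h2, h3, hom_hom o hl hm]
  δ_one x := by
    rw [dif_pos one_pos]
    refine ext ?_
    change conjHom o one_pos x.iso o = x.iso o
    have h1 := conjHom_apply o one_pos x.iso o
    rwa [hom_self o one_pos, hom_one] at h1
  cont x := by
    rw [isometry_orbit.isEmbedding.isInducing.continuousOn_iff]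
    refine (continuousOn_hom o (x.iso o)).congr fun l hl => ?_
    have hl' : 0 < l := hl
    simp only [Function.comp, dif_pos hl']
    have h1 := conjHom_apply o hl' x.iso o
    rwa [hom_self o hl'] at h1

theorem dil_apply {l : ℝ} (hl : 0 < l) (g : Shifts o) : ((dil o).δ l g).iso o = hom o l (g.iso o) := by
  simp only [dil, dif_pos hl]
  have h1 := conjHom_apply o hl g.iso o
  rwa [hom_self o hl] at h1

end Shifts

end

end

section

variable {E : Type*} [MetricSpace E] [ProperSpace E] [InvSpace E] [RigidSpace E] {o : E}

theorem bus_center {c : ℝ → E} (hc : Isometry c) (h0 : c 0 = o) : bus c o = 0 := by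
  rw [← h0, bus_line hc, neg_zero]

theorem bus_shift_mul {c : ℝ → E} (hc : Isometry c) (h0 : c 0 = o) (g h : Shifts o) :
    bus c ((g * h).iso o) = bus c (g.iso o) + bus c (h.iso o) := by
  have := g.isShift c hc (h.iso o) o
  rw [bus_center hc h0] at this
  rw [Shifts.mul_apply]
  linarith

theorem bus_shift_one {c : ℝ → E} (hc : Isometry c) (h0 : c 0 = o) : bus c ((1 : Shifts o).iso o) = 0 := by
  rw [Shifts.one_apply, bus_center hc h0]

theorem bus_shift_inv {c : ℝ → E} (hc : Isometry c) (h0 : c 0 = o) (g : Shifts o) :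
    bus c ((g⁻¹).iso o) = - bus c (g.iso o) := by
  have := bus_shift_mul hc h0 g⁻¹ g
  rw [inv_mul_cancel, bus_shift_one hc h0] at this
  linarith

theorem bus_shift_pow {c : ℝ → E} (hc : Isometry c) (h0 : c 0 = o) (g : Shifts o) (n : ℕ) :
    bus c ((g ^ n).iso o) = n * bus c (g.iso o) := by
  induction n with
  | zero => simp [bus_shift_one hc h0]
  | succ n ih => rw [pow_succ, bus_shift_mul hc h0, ih]; push_cast; ring

theorem bus_shift_zpow {c : ℝ → E} (hc : Isometry c) (h0 : c 0 = o) (g : Shifts o) (n : ℤ) :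
    bus c ((g ^ n).iso o) = n * bus c (g.iso o) := by
  cases n with
  | ofNat n => simpa using bus_shift_pow hc h0 g n
  | negSucc n =>
    rw [zpow_negSucc, bus_shift_inv hc h0, bus_shift_pow hc h0]
    push_cast
    ring

theorem bus_shift_dil {c : ℝ → E} (hc : Isometry c) (h0 : c 0 = o) {l : ℝ} (hl : 0 < l) (g : Shifts o) :
    bus c (((Shifts.dil o).δ l g).iso o) = l * bus c (g.iso o) := by
  rw [Shifts.dil_apply hl, bus_hom hc o hl, bus_center hc h0]
  ring

theorem dist_shift_pow_le (v : Shifts o) (n : ℕ) : dist (v ^ n) 1 ≤ n * dist v 1 := by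
  induction n with
  | zero => simp
  | succ n ih =>
    rw [pow_succ]
    have h1 := (Shifts.dil o).dist_mul_left (v ^ n) v 1
    rw [mul_one] at h1
    have h2 := dist_triangle (v ^ n * v) (v ^ n) 1
    push_cast
    linarith

theorem tendsto_floor_div (x : ℝ) : Tendsto (fun n : ℕ => (⌊((n : ℝ) + 1) * x⌋ : ℝ) / ((n : ℝ) + 1)) atTop (𝓝 x) := by
  rw [tendsto_iff_dist_tendsto_zero]
  refine squeeze_zero (fun _ => dist_nonneg) (fun n => ?_) tendsto_one_div_add_atTop_nhds_zero_nat
  have hn : (0 : ℝ) < (n : ℝ) + 1 := by positivity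
  have h1 := Int.floor_le (((n : ℝ) + 1) * x)
  have h2 := Int.lt_floor_add_one (((n : ℝ) + 1) * x)
  rw [Real.dist_eq, abs_le]
  constructor
  · rw [le_sub_iff_add_le, le_div_iff₀ hn]
    field_simp
    linarith
  · rw [sub_le_iff_le_add, div_le_iff₀ hn]
    field_simp
    linarith

/-- A shift moving a Busemann function can be modified, without changing the Busemann functions, to a shift of
minimal displacement along a line. -/
theorem exists_minimal_line (w : E) {c₀ : ℝ → E} (hc₀ : Isometry c₀) (h0 : c₀ 0 = o) (hw : bus c₀ w ≠ 0) :
    ∃ y : E, (∀ c : ℝ → E, Isometry c → c 0 = o → bus c y = bus c w) ∧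
      (∀ z : E, (∀ c : ℝ → E, Isometry c → c 0 = o → bus c z = bus c w) → dist y o ≤ dist z o) ∧
      0 < dist y o ∧ ∃ m : ℝ → E, Isometry m ∧ m 0 = o ∧
        ∀ c : ℝ → E, Isometry c → c 0 = o → ∀ t, bus c (m t) = t / dist y o * bus c w := by
  set A : Set E := {x | ∀ c : ℝ → E, Isometry c → c 0 = o → bus c x = bus c w} with hA
  have hAc : IsClosed A := by
    have : A = ⋂ (c : ℝ → E) (hc : Isometry c) (_ : c 0 = o), {x | bus c x = bus c w} := by
      ext x
      simp [hA]
    rw [this]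
    exact isClosed_iInter fun c => isClosed_iInter fun hc => isClosed_iInter fun _ =>
      isClosed_eq (continuous_bus hc) continuous_const
  have hAn : A.Nonempty := ⟨w, fun _ _ _ => rfl⟩
  obtain ⟨y, hy, hyd⟩ := hAc.exists_infDist_eq_dist hAn o
  have hmin : ∀ z ∈ A, dist y o ≤ dist z o := fun z hz => by
    rw [dist_comm y, dist_comm z, ← hyd]
    exact Metric.infDist_le_dist_of_mem hz
  have hs : 0 < dist y o := by
    refine dist_pos.2 fun h => hw ?_
    rw [← hy c₀ hc₀ h0, h, bus_center hc₀ h0]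
  set s := dist y o with hsdef
  refine ⟨y, hy, hmin, hs, ?_⟩
  obtain ⟨g, hg⟩ := Shifts.exists_apply_eq o y
  let v : ℕ → Shifts o := fun n => (Shifts.dil o).δ ((n : ℝ) + 1)⁻¹ g
  have hN : ∀ n : ℕ, (0 : ℝ) < (n : ℝ) + 1 := fun n => by positivity
  have hvb : ∀ n (j : ℤ) (c : ℝ → E), Isometry c → c 0 = o →
      bus c ((v n ^ j).iso o) = j / ((n : ℝ) + 1) * bus c w := fun n j c hc hc0 => by
    rw [bus_shift_zpow hc hc0, bus_shift_dil hc hc0 (inv_pos.2 (hN n)), hg, hy c hc hc0]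
    ring
  have hvs : ∀ n, dist (v n) 1 = s / ((n : ℝ) + 1) := fun n => by
    have := (Shifts.dil o).dist_δ _ (inv_pos.2 (hN n)) g 1
    rw [map_one] at this
    rw [this, Shifts.dist_def, hg, Shifts.one_apply, ← hsdef]
    ring
  have hpow : ∀ n (j : ℕ), dist (v n ^ j) 1 = j * (s / ((n : ℝ) + 1)) := fun n j => by
    rcases Nat.eq_zero_or_pos j with rfl | hj
    · simp
    have hj' : (0 : ℝ) < j := by exact_mod_cast hj
    refine le_antisymm ((dist_shift_pow_le _ _).trans_eq (by rw [hvs])) ?_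
    have hl : 0 < ((n : ℝ) + 1) / j := div_pos (hN n) hj'
    have h1 := (Shifts.dil o).dist_δ _ hl (v n ^ j) 1
    have h2 := hmin (((Shifts.dil o).δ (((n : ℝ) + 1) / j) (v n ^ j)).iso o) fun c hc hc0 => by
      have := hvb n j c hc hc0
      rw [zpow_natCast] at this
      rw [bus_shift_dil hc hc0 hl, this]
      have := (hN n).ne'
      push_cast
      field_simp
    rw [map_one, Shifts.dist_def, Shifts.one_apply] at h1
    rw [h1] at h2
    rw [div_mul_eq_mul_div, le_div_iff₀ hj'] at h2
    rw [mul_div_assoc', div_le_iff₀ (hN n)]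
    linarith
  have hzle : ∀ n (i j : ℤ), i ≤ j → dist ((v n ^ i).iso o) ((v n ^ j).iso o) = |(i : ℝ) - j| * (s / ((n : ℝ) + 1)) := by
    intro n i j hij
    obtain ⟨a, rfl⟩ := Int.le.dest hij
    rw [zpow_add, ← Shifts.dist_def]
    have h1 := (Shifts.dil o).dist_mul_left (v n ^ i) 1 (v n ^ (a : ℤ))
    rw [mul_one] at h1
    rw [h1, dist_comm, zpow_natCast, hpow]
    push_cast
    rw [show (i : ℝ) - (i + a) = -(a : ℝ) by ring, abs_neg, abs_of_nonneg (Nat.cast_nonneg a)]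
  have hzd : ∀ n (i j : ℤ), dist ((v n ^ i).iso o) ((v n ^ j).iso o) = |(i : ℝ) - j| * (s / ((n : ℝ) + 1)) := by
    intro n i j
    rcases le_total i j with h | h
    · exact hzle n i j h
    · rw [dist_comm, hzle n j i h, abs_sub_comm]
  let q : ℕ → ℝ → ℝ := fun n t => (⌊((n : ℝ) + 1) * (t / s)⌋ : ℝ) / ((n : ℝ) + 1)
  have hq : ∀ t, Tendsto (fun n => q n t) UF (𝓝 (t / s)) := fun t => (tendsto_floor_div (t / s)).mono_left UF_le
  let m' : ℕ → ℝ → E := fun n t => (v n ^ ⌊((n : ℝ) + 1) * (t / s)⌋).iso o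
  have hmd : ∀ n a b, dist (m' n a) (m' n b) = |q n a - q n b| * s := fun n a b => by
    simp only [m', q]
    rw [hzd, ← sub_div, abs_div, abs_of_pos (hN n)]
    ring
  have hm0 : ∀ n, m' n 0 = o := fun n => by simp [m', Shifts.one_apply]
  haveI : Nonempty E := ⟨o⟩
  have hm : ∀ t, Tendsto (fun n => m' n t) UF (𝓝 (ulim fun n => m' n t)) := fun t => by
    have h1 : Tendsto (fun n => dist (m' n t) o) UF (𝓝 (|t / s - 0 / s| * s)) := by
      refine ((((hq t).sub (hq 0)).abs).mul_const s).congr fun n => ?_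
      rw [← hmd, hm0]
    refine tendsto_ulim o (|t / s - 0 / s| * s + 1) ?_
    filter_upwards [h1.eventually (gt_mem_nhds (lt_add_one _))] with n hn
    exact hn.le
  refine ⟨fun t => ulim fun n => m' n t, Isometry.of_dist_eq fun a b => ?_, ?_, fun c hc hc0 t => ?_⟩
  · refine tendsto_nhds_unique ((hm a).dist (hm b)) ?_
    simp only [hmd]
    have h1 := (((hq a).sub (hq b)).abs).mul_const s
    rwa [← sub_div, abs_div, abs_of_pos hs, div_mul_cancel₀ _ hs.ne'] at h1
  · refine tendsto_nhds_unique (hm 0) ?_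
    simp only [hm0]
    exact tendsto_const_nhds
  · refine tendsto_nhds_unique (((continuous_bus hc).tendsto _).comp (hm t)) ?_
    refine ((hq t).mul_const (bus c w)).congr fun n => ?_
    exact (hvb n _ c hc hc0).symm

/-- A family of pairwise orthogonal lines through a point. -/
def Orthogonal (o : E) {k : ℕ} (c : Fin k → ℝ → E) : Prop :=
  (∀ i, Isometry (c i)) ∧ (∀ i, c i 0 = o) ∧ ∀ i j, i ≠ j → bus (c i) (c j 1) = 0

omit [InvSpace E] [RigidSpace E] in
theorem exists_not_orthogonal (o : E) : ∃ n : ℕ, ∀ c : Fin n → ℝ → E, ¬ Orthogonal o c := by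
  classical
  obtain ⟨t, -, ht, hcov⟩ := (isCompact_closedBall o 1).finite_cover_balls (e := 1 / 2) (by norm_num)
  refine ⟨ht.toFinset.card + 1, fun c ⟨hc, h0, ho⟩ => ?_⟩
  have hex : ∀ i : Fin (ht.toFinset.card + 1), ∃ f ∈ ht.toFinset, dist (c i 1) f < 1 / 2 := fun i => by
    have h1 : c i 1 ∈ Metric.closedBall o 1 := by
      rw [Metric.mem_closedBall, ← h0 i, dist_line (hc i)]
      norm_num
    obtain ⟨f, hf, hxf⟩ := Set.mem_iUnion₂.1 (hcov h1)
    exact ⟨f, ht.mem_toFinset.2 hf, hxf⟩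
  choose f hf hxf using hex
  obtain ⟨i, -, j, -, hij, he⟩ := Finset.exists_ne_map_eq_of_card_lt_of_maps_to (s := Finset.univ)
    (by rw [Finset.card_univ, Fintype.card_fin]; omega) (fun i _ => hf i)
  have h1 := abs_bus_sub_le (hc i) (c i 1) (c j 1)
  rw [ho i j hij, bus_line (hc i)] at h1
  norm_num at h1
  have h2 := dist_triangle_right (c i 1) (c j 1) (f i)
  have h3 := hxf i
  have h4 := hxf j
  rw [← he] at h4
  linarith

theorem exists_maximal_orthogonal (o : E) : ∃ k, 1 ≤ k ∧ ∃ c : Fin k → ℝ → E, Orthogonal o c ∧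
    ∀ c' : Fin (k + 1) → ℝ → E, ¬ Orthogonal o c' := by
  classical
  have hex := exists_not_orthogonal o
  have hf := Nat.find_spec hex
  have hm := fun m => Nat.find_min hex (m := m)
  generalize Nat.find hex = n at hf hm
  obtain ⟨c, hc, h0⟩ := exists_line_through o
  have h1 : Orthogonal o (fun _ : Fin 1 => c) :=
    ⟨fun _ => hc, fun _ => h0, fun i j h => absurd (Subsingleton.elim i j) h⟩
  have hn : 2 ≤ n := by
    by_contra! h
    interval_cases n
    · exact hf (fun i => i.elim0) ⟨fun i => i.elim0, fun i => i.elim0, fun i => i.elim0⟩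
    · exact hf _ h1
  obtain ⟨k, rfl⟩ : ∃ k, n = k + 1 := ⟨n - 1, by omega⟩
  have := hm k (by omega)
  push Not at this
  exact ⟨k, by omega, this.choose, this.choose_spec, hf⟩

variable {k : ℕ} {c : Fin k → ℝ → E}

theorem exists_combination (hc : Orthogonal o c) (a : Fin k → ℝ) :
    ∃ h : Shifts o, ∀ m : ℝ → E, Isometry m → m 0 = o → bus m (h.iso o) = ∑ i, a i * bus m (c i 1) := by
  classical
  have key : ∀ s : Finset (Fin k), ∃ h : Shifts o, ∀ m : ℝ → E, Isometry m → m 0 = o →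
      bus m (h.iso o) = ∑ i ∈ s, a i * bus m (c i 1) := fun s => by
    induction s using Finset.induction_on with
    | empty => exact ⟨1, fun m hm h0 => by rw [bus_shift_one hm h0, Finset.sum_empty]⟩
    | insert i s hi ih =>
      obtain ⟨h, hh⟩ := ih
      obtain ⟨g, hg⟩ := Shifts.exists_apply_eq o (c i (a i))
      refine ⟨g * h, fun m hm h0 => ?_⟩
      rw [bus_shift_mul hm h0, Finset.sum_insert hi, hh m hm h0, hg, bus_affine hm (hc.1 i), slope, hc.2.1 i,
        bus_center hm h0]
      ring
  exact key Finset.univ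

theorem bus_eq_zero_of_maximal (hc : Orthogonal o c) (hmax : ∀ c' : Fin (k + 1) → ℝ → E, ¬ Orthogonal o c')
    {x : E} (hx : ∀ i, bus (c i) x = 0) {m : ℝ → E} (hm : Isometry m) (h0 : m 0 = o) : bus m x = 0 := by
  by_contra hne
  obtain ⟨y, -, -, -, m', hm', h0', hb⟩ := exists_minimal_line x hm h0 hne
  have h1 : ∀ i, bus (c i) (m' 1) = 0 := fun i => by rw [hb _ (hc.1 i) (hc.2.1 i), hx, mul_zero]
  have h2 : ∀ i, bus m' (c i 1) = 0 := fun i => by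
    have := slope_symm (hc.1 i) hm' ((hc.2.1 i).trans h0'.symm)
    rw [slope, slope, h0', hc.2.1 i, bus_center (hc.1 i) (hc.2.1 i), bus_center hm' h0', h1] at this
    linarith
  refine hmax (Fin.cons m' c) ⟨fun i => ?_, fun i => ?_, fun i j hij => ?_⟩
  · refine Fin.cases ?_ (fun i => ?_) i
    · exact hm'
    · exact hc.1 i
  · refine Fin.cases ?_ (fun i => ?_) i
    · exact h0'
    · exact hc.2.1 i
  · revert hij
    refine Fin.cases ?_ (fun i => ?_) i
    · refine Fin.cases (fun h => absurd rfl h) (fun j _ => ?_) j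
      exact h2 j
    · refine Fin.cases (fun _ => ?_) (fun j hij => ?_) j
      · exact h1 i
      · exact hc.2.2 i j fun h => hij (congrArg _ h)

theorem bus_combination (hc : Orthogonal o c) {h : E} {a : Fin k → ℝ} (hh : ∀ m : ℝ → E, Isometry m → m 0 = o →
    bus m h = ∑ i, a i * bus m (c i 1)) (j : Fin k) : bus (c j) h = - a j := by
  rw [hh _ (hc.1 j) (hc.2.1 j), Finset.sum_eq_single j]
  · rw [bus_line (hc.1 j)]; ring
  · intro i _ hij
    rw [hc.2.2 j i hij.symm, mul_zero]
  · intro h; exact absurd (Finset.mem_univ j) h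

theorem bus_eq_sum (hc : Orthogonal o c) (hmax : ∀ c' : Fin (k + 1) → ℝ → E, ¬ Orthogonal o c')
    (x : E) {m : ℝ → E} (hm : Isometry m) (h0 : m 0 = o) :
    bus m x = - ∑ i, bus (c i) x * bus m (c i 1) := by
  obtain ⟨g, rfl⟩ := Shifts.exists_apply_eq o x
  obtain ⟨h, hh⟩ := exists_combination hc fun i => - bus (c i) (g.iso o)
  have := bus_eq_zero_of_maximal hc hmax (x := (h⁻¹ * g).iso o) (fun i => by
    rw [bus_shift_mul (hc.1 i) (hc.2.1 i), bus_shift_inv (hc.1 i) (hc.2.1 i), bus_combination hc hh]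
    ring) hm h0
  rw [bus_shift_mul hm h0, bus_shift_inv hm h0, hh m hm h0] at this
  simp only [neg_mul, Finset.sum_neg_distrib] at this
  linarith

/-- The coordinates of a point with respect to a family of lines. -/
noncomputable def coord (c : Fin k → ℝ → E) (x : E) : EuclideanSpace ℝ (Fin k) :=
  WithLp.toLp 2 fun i => - bus (c i) x

theorem coord_apply (c : Fin k → ℝ → E) (x : E) (i : Fin k) : coord c x i = - bus (c i) x := rfl

theorem coord_eq_iff (hc : Orthogonal o c) (hmax : ∀ c' : Fin (k + 1) → ℝ → E, ¬ Orthogonal o c') (x y : E) :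
    coord c x = coord c y ↔ ∀ m : ℝ → E, Isometry m → bus m x = bus m y := by
  refine ⟨fun h m hm => ?_, fun h => ?_⟩
  · have h1 : ∀ i, bus (c i) x = bus (c i) y := fun i => by
      have := congrArg (fun v : EuclideanSpace ℝ (Fin k) => v i) h
      simpa [coord_apply] using this
    obtain ⟨m', hm', h0, hs⟩ := exists_parallel hm o
    have h2 := bus_parallel hm hm' hs x
    have h3 := bus_parallel hm hm' hs y
    have h4 : bus m' x = bus m' y := by
      rw [bus_eq_sum hc hmax x hm' h0, bus_eq_sum hc hmax y hm' h0]
      simp only [h1]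
    linarith
  · ext i
    rw [coord_apply, coord_apply, h _ (hc.1 i)]

theorem coord_center (hc : Orthogonal o c) : coord c o = 0 := by
  ext i
  rw [coord_apply, bus_center (hc.1 i) (hc.2.1 i)]
  simp

theorem coord_shift (hc : Orthogonal o c) (g : Shifts o) (x : E) : coord c (g.iso x) = coord c (g.iso o) + coord c x := by
  ext i
  have := g.isShift _ (hc.1 i) x o
  rw [bus_center (hc.1 i) (hc.2.1 i)] at this
  rw [PiLp.add_apply, coord_apply, coord_apply, coord_apply]
  linarith

theorem exists_coord_eq_norm (hc : Orthogonal o c) (hmax : ∀ c' : Fin (k + 1) → ℝ → E, ¬ Orthogonal o c') (x : E) :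
    ‖coord c x‖ ≤ dist x o ∧ ∃ x', coord c x' = coord c x ∧ dist x' o = ‖coord c x‖ := by
  by_cases h : ∀ m : ℝ → E, Isometry m → m 0 = o → bus m x = 0
  · have h0 : coord c x = 0 := by
      ext i
      rw [coord_apply, h _ (hc.1 i) (hc.2.1 i)]
      simp
    rw [h0, norm_zero]
    exact ⟨dist_nonneg, o, coord_center hc, dist_self o⟩
  · push Not at h
    obtain ⟨m₀, hm₀, h₀, hne⟩ := h
    obtain ⟨y, hy, hmin, hs, m, hm, h0, hb⟩ := exists_minimal_line x hm₀ h₀ hne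
    have h1 := bus_eq_sum hc hmax (m 1) hm h0
    have h2 : ∀ i, bus m (c i 1) = bus (c i) (m 1) := fun i => by
      have := slope_symm (hc.1 i) hm ((hc.2.1 i).trans h0.symm)
      rw [slope, slope, h0, hc.2.1 i, bus_center (hc.1 i) (hc.2.1 i), bus_center hm h0] at this
      linarith
    simp only [h2] at h1
    rw [bus_line hm] at h1
    have h3 : ∀ i, coord c x i = - (dist y o * bus (c i) (m 1)) := fun i => by
      rw [coord_apply, hb _ (hc.1 i) (hc.2.1 i)]
      field_simp
    have h4 : ‖coord c x‖ = dist y o := by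
      rw [EuclideanSpace.norm_eq, Real.sqrt_eq_iff_eq_sq (by positivity) hs.le]
      simp only [h3, norm_neg, Real.norm_eq_abs, sq_abs]
      have : ∑ i, (dist y o * bus (c i) (m 1)) ^ 2 = dist y o ^ 2 * ∑ i, bus (c i) (m 1) * bus (c i) (m 1) := by
        rw [Finset.mul_sum]
        exact Finset.sum_congr rfl fun i _ => by ring
      rw [this, show ∑ i, bus (c i) (m 1) * bus (c i) (m 1) = 1 by linarith, mul_one]
    refine ⟨h4.trans_le (hmin x fun _ _ _ => rfl), y, ?_, h4.symm⟩
    ext i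
    rw [coord_apply, coord_apply, hy _ (hc.1 i) (hc.2.1 i)]

/-- The structure of the canonical fibration of an affine chart. -/
def Fibered (E : Type*) [MetricSpace E] (k p : ℕ) : Prop :=
  ∃ F : E → EuclideanSpace ℝ (Fin k), Function.Surjective F ∧
    (∀ x y, F x = F y ↔ ∀ c : ℝ → E, Isometry c → bus c x = bus c y) ∧
    (∀ x y, ∃ x', F x' = F x ∧ dist x' y = dist (F x) (F y)) ∧
    (∀ x y, dist (F x) (F y) ≤ dist x y) ∧
    ∀ x, Nonempty ({y | F y = F x} ≃ₜ EuclideanSpace ℝ (Fin p))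

variable (E) in
theorem exists_fibered [Nonempty E] :
    ∃ k p, 1 ≤ k ∧ Fibered E k p ∧ Nonempty (E ≃ₜ EuclideanSpace ℝ (Fin (k + p))) := by
  obtain ⟨o⟩ := ‹Nonempty E›
  obtain ⟨k, hk, c, hc, hmax⟩ := exists_maximal_orthogonal o
  have hcont : Continuous (coord c) :=
    (PiLp.continuous_toLp 2 _).comp (continuous_pi fun i => (continuous_bus (hc.1 i)).neg)
  have hsurj : Function.Surjective (coord c) := fun v => by
    obtain ⟨h, hh⟩ := exists_combination hc fun i => v i
    refine ⟨h.iso o, ?_⟩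
    ext i
    rw [coord_apply, bus_combination hc hh, neg_neg]
  obtain ⟨p, hfib, ⟨e⟩⟩ := (Shifts.dil o).exists_homeo (k := k) (fun g => (coord c (g.iso o)).ofLp)
    ((PiLp.continuous_ofLp 2 _).comp (hcont.comp Shifts.isometry_orbit.continuous))
    (fun x y => by rw [Shifts.mul_apply, coord_shift hc]; rfl)
    (fun v => by
      obtain ⟨x, hx⟩ := hsurj (WithLp.toLp 2 v)
      obtain ⟨g, rfl⟩ := Shifts.exists_apply_eq o x
      exact ⟨g, congrArg WithLp.ofLp hx⟩)
    (fun l hl x hx => by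
      funext i
      have h1 := congrFun hx i
      change - bus (c i) (((Shifts.dil o).δ l x).iso o) = 0
      change - bus (c i) (x.iso o) = 0 at h1
      rw [bus_shift_dil (hc.1 i) (hc.2.1 i) hl]
      linear_combination l * h1)
  have hgen : ∀ x y, dist (coord c x) (coord c y) ≤ dist x y ∧
      ∃ x', coord c x' = coord c x ∧ dist x' y = dist (coord c x) (coord c y) := fun x y => by
    obtain ⟨g, rfl⟩ := Shifts.exists_apply_eq o y
    obtain ⟨z, rfl⟩ := g.iso.surjective x
    have hz : dist (coord c (g.iso z)) (coord c (g.iso o)) = ‖coord c z‖ := by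
      rw [coord_shift hc g z, dist_eq_norm, add_sub_cancel_left]
    obtain ⟨h1, z', h2, h3⟩ := exists_coord_eq_norm hc hmax z
    rw [hz]
    refine ⟨by rwa [g.iso.dist_eq], g.iso z', ?_, by rwa [g.iso.dist_eq]⟩
    rw [coord_shift hc, coord_shift hc g z, h2]
  refine ⟨k, p, hk, ⟨coord c, hsurj, coord_eq_iff hc hmax, fun x y => (hgen x y).2, fun x y => (hgen x y).1,
    fun x => ?_⟩, ⟨(Shifts.orbit o).symm.toHomeomorph.trans (e.trans (EuclideanSpace.equiv _ ℝ).toHomeomorph.symm)⟩⟩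
  obtain ⟨g, rfl⟩ := Shifts.exists_apply_eq o x
  obtain ⟨f⟩ := hfib g
  refine ⟨Homeomorph.trans ?_ (f.trans (EuclideanSpace.equiv _ ℝ).toHomeomorph.symm)⟩
  refine ((Shifts.orbit o).toHomeomorph.subtype fun a => ?_).symm
  exact ⟨fun h => congrArg (WithLp.toLp 2) h, fun h => congrArg WithLp.ofLp h⟩

end

section

variable {E E' : Type*} [MetricSpace E] [MetricSpace E']

theorem bus_similarity {h : E → E'} {r : ℝ} (hr : 0 < r) (hh : ∀ a b, dist (h a) (h b) = r * dist a b)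
    {c : ℝ → E} (hc : Isometry c) {c' : ℝ → E'} (hc' : Isometry c') (hhc : ∀ t, h (c t) = c' (r * t)) (x : E) :
    bus c' (h x) = r * bus c x := by
  refine bus_unique hc' ?_
  have h1 : Tendsto (fun t : ℝ => r⁻¹ * t) atTop atTop := tendsto_id.const_mul_atTop (inv_pos.2 hr)
  refine (((bus_tendsto hc x).comp h1).const_mul r).congr fun t => ?_
  have : c' t = h (c (r⁻¹ * t)) := by rw [hhc]; congr 1; field_simp
  simp only [Function.comp]
  rw [this, hh, mul_sub, mul_inv_cancel_left₀ hr.ne']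

theorem Fibered.similarity {k p : ℕ} (hE : Fibered E k p) (h : E ≃ E') {r : ℝ} (hr : 0 < r)
    (hh : ∀ a b, dist (h a) (h b) = r * dist a b) : Fibered E' k p := by
  obtain ⟨F, hs, hb, hx, hd, hf⟩ := hE
  have hcont : Continuous h := (LipschitzWith.of_dist_le_mul (K := ⟨r, hr.le⟩) fun a b => (hh a b).le).continuous
  have hhs : ∀ a b, dist (h.symm a) (h.symm b) = r⁻¹ * dist a b := fun a b => by
    have := hh (h.symm a) (h.symm b)
    rw [Equiv.apply_symm_apply, Equiv.apply_symm_apply] at this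
    rw [this, inv_mul_cancel_left₀ hr.ne']
  have hcont' : Continuous h.symm :=
    (LipschitzWith.of_dist_le_mul (K := ⟨r⁻¹, (inv_pos.2 hr).le⟩) fun a b => (hhs a b).le).continuous
  have heq : ∀ x y, r • F (h.symm x) = r • F (h.symm y) ↔ F (h.symm x) = F (h.symm y) := fun x y =>
    ⟨fun e => smul_right_injective _ hr.ne' e, fun e => by rw [e]⟩
  have hdist : ∀ x y, dist (r • F x) (r • F y) = r * dist (F x) (F y) := fun x y => by
    rw [dist_smul₀, Real.norm_eq_abs, abs_of_pos hr]
  refine ⟨fun x => r • F (h.symm x), fun v => ?_, fun x y => ?_, fun x y => ?_, fun x y => ?_, fun x => ?_⟩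
  · obtain ⟨x, hxv⟩ := hs (r⁻¹ • v)
    refine ⟨h x, ?_⟩
    simp only [Equiv.symm_apply_apply, hxv]
    rw [smul_inv_smul₀ hr.ne']
  · rw [heq, hb]
    refine ⟨fun H c hc => ?_, fun H c hc => ?_⟩
    · have hc' : Isometry fun t => h.symm (c (r * t)) := Isometry.of_dist_eq fun s t => by
        rw [hhs, hc.dist_eq, Real.dist_eq, Real.dist_eq, ← mul_sub, abs_mul, abs_of_pos hr, inv_mul_cancel_left₀ hr.ne']
      have h1 := fun z => bus_similarity hr hh hc' hc (fun t => Equiv.apply_symm_apply _ _) (h.symm z)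
      have h2 := h1 x
      have h3 := h1 y
      rw [Equiv.apply_symm_apply] at h2 h3
      rw [h2, h3, H _ hc']
    · have hc' : Isometry fun t => h (c (r⁻¹ * t)) := Isometry.of_dist_eq fun s t => by
        rw [hh, hc.dist_eq, Real.dist_eq, Real.dist_eq, ← mul_sub, abs_mul, abs_of_pos (inv_pos.2 hr),
          mul_inv_cancel_left₀ hr.ne']
      have h1 := fun z => bus_similarity hr hh hc hc' (fun t => by rw [inv_mul_cancel_left₀ hr.ne']) (h.symm z)
      have h2 := h1 x
      have h3 := h1 y
      rw [Equiv.apply_symm_apply] at h2 h3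
      have h4 := H _ hc'
      rw [h2, h3] at h4
      exact mul_left_cancel₀ hr.ne' h4
  · obtain ⟨x', h1, h2⟩ := hx (h.symm x) (h.symm y)
    refine ⟨h x', ?_, ?_⟩
    · simp only [Equiv.symm_apply_apply, h1]
    · rw [hdist, ← h2, ← hh, Equiv.apply_symm_apply]
  · rw [hdist]
    have := hd (h.symm x) (h.symm y)
    rw [hhs] at this
    calc r * dist (F (h.symm x)) (F (h.symm y)) ≤ r * (r⁻¹ * dist x y) := by gcongr
      _ = dist x y := by rw [mul_inv_cancel_left₀ hr.ne']
  · obtain ⟨e⟩ := hf (h.symm x)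
    refine ⟨Homeomorph.trans ?_ e⟩
    exact (Homeomorph.mk h.symm hcont' hcont).subtype fun a => heq a x

end

section

variable {X : Type*} {S : MobiusStructure X} {P : PtData X} [T : TopologicalSpace X] [CompactSpace X] [T2Space X]

theorem mem_mobiusFiber_iff (M : Model S P) {ω : X} {d : ExtMetric X} (hd : d ∈ S.M) (hω : d.rem = some ω)
    {x y : X} (hx : x ≠ ω) (hy : y ≠ ω) :
    y ∈ mobiusFiber S d ω x ↔ ∀ c : ℝ → P.Aff ω, Isometry c → bus c (⟨y, hy⟩ : P.Aff ω) = bus c ⟨x, hx⟩ := by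
  classical
  obtain ⟨r, hr, hdr⟩ := M.rem d hd ω hω
  have hdd : ∀ a b : P.Aff ω, d.d a.1 b.1 = ENNReal.ofReal (r * dist a b) := fun a b => hdr _ _ a.2 b.2
  have hbt : ∀ (z : P.Aff ω) (c : ℝ → P.Aff ω) (_ : Isometry c) (c' : ℝ → X), (∀ t, c' t = (c (r⁻¹ * t)).1) →
      Tendsto (fun t => (d.d z.1 (c' t)).toReal - t) atTop (𝓝 (r * bus c z)) := fun z c hc c' hcc => by
    have h1 : Tendsto (fun t : ℝ => r⁻¹ * t) atTop atTop := tendsto_id.const_mul_atTop (inv_pos.2 hr)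
    refine (((bus_tendsto hc z).comp h1).const_mul r).congr fun t => ?_
    rw [hcc, hdd, ENNReal.toReal_ofReal (mul_nonneg hr.le dist_nonneg)]
    simp only [Function.comp]
    rw [mul_sub, mul_inv_cancel_left₀ hr.ne']
  refine ⟨fun h c hc => ?_, fun h => ⟨hy, fun l b hb => ?_⟩⟩
  · have hrange : insert ω (Set.range (P.val ω ∘ c)) \ {ω} = Set.range (P.val ω ∘ c) := by
      rw [Set.insert_diff_of_mem _ (Set.mem_singleton ω), Set.diff_singleton_eq_self]
      rintro ⟨t, ht⟩
      exact (c t).2 ht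
    obtain ⟨b, hbz⟩ : ∃ b : X → ℝ, ∀ z : P.Aff ω, b z.1 = r * bus c z :=
      ⟨fun z => if hz : z ≠ ω then r * bus c (⟨z, hz⟩ : P.Aff ω) else 0, fun z => dif_pos z.2⟩
    have hb := h.2 (insert ω (Set.range (P.val ω ∘ c)) \ {ω})
      b ⟨⟨_, isPtolemyCircle_of_line M hc, Set.mem_insert _ _, rfl⟩, fun t => P.val ω (c (r⁻¹ * t)), ⟨?_, fun s t => ?_⟩,
        0, fun z hz => ?_⟩
    · exact mul_left_cancel₀ hr.ne' ((hbz ⟨y, hy⟩).symm.trans (hb.trans (hbz ⟨x, hx⟩)))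
    · rw [hrange]
      ext z
      constructor
      · rintro ⟨t, rfl⟩
        exact ⟨_, rfl⟩
      · rintro ⟨t, rfl⟩
        exact ⟨r * t, by simp only [inv_mul_cancel_left₀ hr.ne', Function.comp]⟩
    · refine (hdd _ _).trans ?_
      rw [hc.dist_eq, Real.dist_eq, ← mul_sub, abs_mul, abs_of_pos (inv_pos.2 hr), mul_inv_cancel_left₀ hr.ne']
    · exact (hbt ⟨z, hz⟩ c hc _ fun _ => rfl).mono_right
        (le_of_eq (congrArg 𝓝 ((add_zero _).trans (hbz ⟨z, hz⟩)).symm))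
  · obtain ⟨⟨σ, hσ, hωσ, rfl⟩, c, ⟨hcr, hcd⟩, C, hbC⟩ := hb
    have hcω : ∀ t, c t ≠ ω := fun t => by
      have : c t ∈ σ \ {ω} := hcr ▸ Set.mem_range_self t
      exact this.2
    let m : ℝ → P.Aff ω := fun t => ⟨c (r * t), hcω _⟩
    have hm : Isometry m := Isometry.of_dist_eq fun s t => by
      have h1 := hdd (m s) (m t)
      have h2 := hcd (r * s) (r * t)
      change d.d (c (r * s)) (c (r * t)) = _ at h1
      rw [h1, ENNReal.ofReal_eq_ofReal_iff (mul_nonneg hr.le dist_nonneg) (abs_nonneg _), ← mul_sub, abs_mul,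
        abs_of_pos hr] at h2
      exact mul_left_cancel₀ hr.ne' h2
    have key : ∀ z (hz : z ≠ ω), b z + C = r * bus m (⟨z, hz⟩ : P.Aff ω) := fun z hz =>
      tendsto_nhds_unique (hbC z hz) (hbt ⟨z, hz⟩ m hm c fun t => by simp only [m, mul_inv_cancel_left₀ hr.ne'])
    have h1 := key x hx
    have h2 := key y hy
    rw [h m hm] at h2
    linarith

theorem canonicalFibration_of_fibered (M : Model S P) {ω : X} {k p : ℕ} (hF : Fibered (P.Aff ω) k p)
    {d : ExtMetric X} (hd : d ∈ S.M) (hω : d.rem = some ω) :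
    (∃ f : {F : Set X // F ∈ mobiusBase S d ω} → EuclideanSpace ℝ (Fin k),
      Function.Bijective f ∧ ∀ F F' : {F : Set X // F ∈ mobiusBase S d ω},
        dist (f F) (f F') = fiberDist d F.1 F'.1) ∧
    ∀ x : X, x ≠ ω → SubsetHomeoToEuclidean S (mobiusFiber S d ω x) p := by
  obtain ⟨F, hs, hb, hx, hle, hf⟩ := hF
  obtain ⟨r, hr, hdr⟩ := M.rem d hd ω hω
  have hdd : ∀ a b : P.Aff ω, (d.d a.1 b.1).toReal = r * dist a b := fun a b => by
    have : d.d a.1 b.1 = ENNReal.ofReal (r * dist a b) := hdr _ _ a.2 b.2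
    rw [this, ENNReal.toReal_ofReal (mul_nonneg hr.le dist_nonneg)]
  have hfib : ∀ x : P.Aff ω, mobiusFiber S d ω x.1 = P.val ω '' {y | F y = F x} := fun x => by
    ext y
    constructor
    · intro h
      exact ⟨⟨y, h.1⟩, (hb _ _).2 ((mem_mobiusFiber_iff M hd hω x.2 h.1).1 h), rfl⟩
    · rintro ⟨y, hy, rfl⟩
      exact (mem_mobiusFiber_iff M hd hω x.2 y.2).2 ((hb _ _).1 hy)
  refine ⟨?_, fun x hxω => ?_⟩
  · have hex : ∀ Φ : {Φ : Set X // Φ ∈ mobiusBase S d ω}, ∃ x : P.Aff ω, Φ.1 = P.val ω '' {y | F y = F x} := fun Φ => by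
      obtain ⟨x, hx, h⟩ := Φ.2
      exact ⟨⟨x, hx⟩, h.trans (hfib ⟨x, hx⟩)⟩
    choose g hg using hex
    refine ⟨fun Φ => r • F (g Φ), ⟨fun Φ Ψ h => ?_, fun v => ?_⟩, fun Φ Ψ => ?_⟩
    · have h1 : F (g Φ) = F (g Ψ) := smul_right_injective _ hr.ne' h
      refine Subtype.ext ?_
      rw [hg Φ, hg Ψ, h1]
    · obtain ⟨x, hxv⟩ := hs (r⁻¹ • v)
      refine ⟨⟨mobiusFiber S d ω x.1, x.1, x.2, rfl⟩, ?_⟩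
      set Φ : {Φ : Set X // Φ ∈ mobiusBase S d ω} := ⟨mobiusFiber S d ω x.1, x.1, x.2, rfl⟩
      have h1 : mobiusFiber S d ω x.1 = P.val ω '' {y | F y = F (g Φ)} := hg Φ
      rw [hfib, (P.val_injective ω).image_injective.eq_iff] at h1
      have h2 : x ∈ {y | F y = F x} := rfl
      rw [h1] at h2
      change r • F (g Φ) = v
      rw [← show F x = F (g Φ) from h2, hxv, smul_inv_smul₀ hr.ne']
    · rw [dist_smul₀, Real.norm_eq_abs, abs_of_pos hr, fiberDist, hg Φ, hg Ψ]
      refine (IsLeast.csInf_eq ⟨?_, ?_⟩).symm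
      · obtain ⟨x', h1, h2⟩ := hx (g Φ) (g Ψ)
        refine ⟨_, ⟨x', h1, rfl⟩, _, ⟨g Ψ, rfl, rfl⟩, ?_⟩
        rw [← h2]
        exact (hdd _ _).symm
      · rintro _ ⟨_, ⟨a, ha, rfl⟩, _, ⟨b, hb', rfl⟩, rfl⟩
        have h1 := hle a b
        rw [show F a = F (g Φ) from ha, show F b = F (g Ψ) from hb'] at h1
        refine le_trans ?_ (hdd a b).ge
        gcongr
  · unfold SubsetHomeoToEuclidean
    rw [← M.top]
    obtain ⟨e⟩ := hf ⟨x, hxω⟩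
    have h1 := hfib ⟨x, hxω⟩
    change mobiusFiber S d ω x = _ at h1
    rw [h1]
    exact ⟨((M.emb ω).isEmbedding.homeomorphImage _).symm.trans e⟩

theorem Model.sphere (M : Model S P) (hE : PropertyE S) (hI : PropertyI S) (ω₀ : X) :
    ∃ n k p : ℕ, 1 ≤ n ∧ 1 ≤ k ∧ k + p = n ∧
      HomeoToSphere S n ∧
      ∀ ω : X, ∀ d ∈ S.M, d.rem = some ω →
        (∃ f : {F : Set X // F ∈ mobiusBase S d ω} → EuclideanSpace ℝ (Fin k),
          Function.Bijective f ∧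
          ∀ F F' : {F : Set X // F ∈ mobiusBase S d ω},
            dist (f F) (f F') = fiberDist d F.1 F'.1) ∧
        ∀ x : X, x ≠ ω → SubsetHomeoToEuclidean S (mobiusFiber S d ω x) p := by
  haveI := M.proper
  have hV := M.invSpace hE hI
  haveI := hV
  haveI : RigidSpace (P.Aff ω₀) := ⟨fun g hg o ho x => eq_refl_of_isShift M hV g hg ho x⟩
  obtain ⟨c, -⟩ := M.exists_line hE hI ω₀
  haveI : Nonempty (P.Aff ω₀) := ⟨c 0⟩
  obtain ⟨k, p, hk, hF, ⟨e⟩⟩ := exists_fibered (P.Aff ω₀)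
  refine ⟨k + p, k, p, by omega, hk, rfl, ?_, fun ω d hd hω => ?_⟩
  · unfold HomeoToSphere
    rw [← M.top]
    obtain ⟨e'⟩ := M.nonempty_homeo_onePoint ω₀
    exact ⟨e'.symm.trans (e.onePointCongr.trans (onePointEquivSphereOfFinrankEq (by simp)))⟩
  · obtain ⟨f, hf, hfω⟩ := M.exists_swap hI ω₀ ω
    obtain ⟨r, hr, h, -, hh⟩ := M.exists_similarity hf hfω
    exact canonicalFibration_of_fibered M (hF.similarity h hr hh) hd hω

end

/-- part of Theorem 4.1 of the paper.  A compact Ptolemy space `X`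
with properties (E) and (I) is homeomorphic to a sphere `Sⁿ ⊆ ℝ^{n+1}` for some
`n ≥ 1`, and there are integers `k ≥ 1`, `p ≥ 0` with `k + p = n` such that for every
`ω ∈ X` the base `B_ω` of the canonical fibration is isometric to the Euclidean space
`ℝᵏ` and every fiber of `π_ω` is homeomorphic to `ℝᵖ`. -/
theorem stmt_13 {X : Type*} (S : MobiusStructure X)
    (hpt : IsPtolemyStructure S) (hcomp : MobiusCompact S)
    (hE : PropertyE S) (hI : PropertyI S) :
    ∃ n k p : ℕ, 1 ≤ n ∧ 1 ≤ k ∧ k + p = n ∧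
      HomeoToSphere S n ∧
      ∀ ω : X, ∀ d ∈ S.M, d.rem = some ω →
        (∃ f : {F : Set X // F ∈ mobiusBase S d ω} → EuclideanSpace ℝ (Fin k),
          Function.Bijective f ∧
          ∀ F F' : {F : Set X // F ∈ mobiusBase S d ω},
            dist (f F) (f F') = fiberDist d F.1 F'.1) ∧
        ∀ x : X, x ≠ ω → SubsetHomeoToEuclidean S (mobiusFiber S d ω x) p := by
  letI : TopologicalSpace X := mobiusTop S
  haveI : CompactSpace X := hcomp
  obtain ⟨d, hd⟩ := S.nonempty
  have hE' := hE
  obtain ⟨σ, ⟨e⟩, -⟩ := hE'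
  obtain ⟨f, hf, -⟩ := exists_circle_param ⟨1, by simp⟩
  have hinj : Function.Injective fun t => (e.symm (f t)).1 :=
    Subtype.val_injective.comp (e.symm.injective.comp hf.injective)
  haveI : Infinite X := Infinite.of_injective _ hinj
  haveI : T2Space X := t2Space_of_infinite hpt hd rfl
  exact (model_ptData hpt hd rfl).sphere hE hI (e.symm (f 0)).1

end Mobius
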